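/- Assume a ≥ 2 and b ≥ 2. Let M be the (d+b−1)×(b+1) matrix with entries in S defined as follows: for 0 ≤ r ≤ d+b−2 and 0 ≤ c ≤ b, the entry M_{r,c} is the coefficient of x^r y^{d+b−2−r} in the Jacobian determinant ∂F/∂x · ∂g_c/∂y − ∂F/∂y · ∂g_c/∂x, where F = Σ_{j=0}^{d} z_j x^j y^{d−j} ∈ S[x,y] is the generic binary form of degree d and g_c = x^c y^{b−c}; each entry M_{r,c} is a linear form in S. Then ker(α) equals the ideal of S generated by all (b+1)×(b+1) minors of M, i.e., the determinants of the square submatrices of M obtained by selecting b+1 of the rows. (Determinantal description of I(X): Theorem 1.1 combined with Lemma 4.3.) -/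

import Mathlib

open MvPolynomial

/-- The generic binary form `G = ∑_{i=0}^{b} u_i x^i y^{b-i}` of degree `b`,
viewed as a polynomial in two variables `x = X 0`, `y = X 1` with coefficients in
`R = MvPolynomial (Fin (b+1)) ℂ`. -/
noncomputable def genForm (b : ℕ) : MvPolynomial (Fin 2) (MvPolynomial (Fin (b + 1)) ℂ) :=
  ∑ i : Fin (b + 1),
    MvPolynomial.C (MvPolynomial.X i) *
      MvPolynomial.X (0 : Fin 2) ^ (i : ℕ) * MvPolynomial.X (1 : Fin 2) ^ (b - (i : ℕ))

/-- The coefficient `c_j ∈ R` of `x^j y^{ab-j}` in `G^a`. -/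
noncomputable def coeffC (a b j : ℕ) : MvPolynomial (Fin (b + 1)) ℂ :=
  MvPolynomial.coeff
    (Finsupp.single (0 : Fin 2) j + Finsupp.single (1 : Fin 2) (a * b - j))
    (genForm b ^ a)

/-- The Foulkes–Howe homomorphism `α : S → R`, `z_j ↦ c_j`. -/
noncomputable def FH (a b : ℕ) :
    MvPolynomial (Fin (a * b + 1)) ℂ →ₐ[ℂ] MvPolynomial (Fin (b + 1)) ℂ :=
  MvPolynomial.aeval fun j : Fin (a * b + 1) => coeffC a b (j : ℕ)

/-- The Jacobian determinant `∂F/∂x · ∂g/∂y − ∂F/∂y · ∂g/∂x` of the generic binary form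
`F = ∑_{j=0}^{d} z_j x^j y^{d-j}` of degree `d = ab` (with coefficients in
`S = MvPolynomial (Fin (d+1)) ℂ`, realized as `genForm (a*b)`) against the monomial
`g = x^c y^{b-c}`. -/
noncomputable def jacPair (a b c : ℕ) :
    MvPolynomial (Fin 2) (MvPolynomial (Fin (a * b + 1)) ℂ) :=
  MvPolynomial.pderiv (0 : Fin 2) (genForm (a * b)) *
      MvPolynomial.pderiv (1 : Fin 2)
        (MvPolynomial.X (0 : Fin 2) ^ c * MvPolynomial.X (1 : Fin 2) ^ (b - c)) -
    MvPolynomial.pderiv (1 : Fin 2) (genForm (a * b)) *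
      MvPolynomial.pderiv (0 : Fin 2)
        (MvPolynomial.X (0 : Fin 2) ^ c * MvPolynomial.X (1 : Fin 2) ^ (b - c))

/-- The `(d+b−1) × (b+1)` matrix of linear forms in `S`: the `(r,c)` entry is the
coefficient of `x^r y^{d+b−2−r}` in the Jacobian determinant of `F` against
`g_c = x^c y^{b−c}`. -/
noncomputable def jacMatrix (a b : ℕ) :
    Matrix (Fin (a * b + b - 1)) (Fin (b + 1)) (MvPolynomial (Fin (a * b + 1)) ℂ) :=
  fun r c =>
    MvPolynomial.coeff
      (Finsupp.single (0 : Fin 2) (r : ℕ) +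
        Finsupp.single (1 : Fin 2) (a * b + b - 2 - (r : ℕ)))
      (jacPair a b (c : ℕ))

section DividedDifference

set_option linter.unusedSectionVars false

variable {σ : Type*} [DecidableEq σ]

/-- The algebra automorphism exchanging two variables. -/
noncomputable def swapVar (i j : σ) : MvPolynomial σ ℂ →ₐ[ℂ] MvPolynomial σ ℂ :=
  rename (Equiv.swap i j)

theorem swapVar_X (i j l : σ) : swapVar i j (X l : MvPolynomial σ ℂ) = X (Equiv.swap i j l) := by
  simp [swapVar]

theorem swapVar_swapVar (i j : σ) (f : MvPolynomial σ ℂ) : swapVar i j (swapVar i j f) = f := by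
  simp only [swapVar, rename_rename]
  have : (Equiv.swap i j : σ → σ) ∘ (Equiv.swap i j) = id := by
    ext x; simp
  rw [this, rename_id]; rfl

theorem X_sub_X_ne_zero {i j : σ} (h : i ≠ j) : (X i - X j : MvPolynomial σ ℂ) ≠ 0 :=
  sub_ne_zero.mpr fun e => h (X_injective e)

theorem X_sub_X_dvd_sub_swapVar (i j : σ) (f : MvPolynomial σ ℂ) :
    (X i - X j : MvPolynomial σ ℂ) ∣ f - swapVar i j f := by
  induction f using MvPolynomial.induction_on with
  | C c => simp [swapVar]
  | add p q hp hq =>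
    rw [map_add, add_sub_add_comm]
    exact dvd_add hp hq
  | mul_X p l hp =>
    rw [map_mul, swapVar_X]
    have e : p * X l - swapVar i j p * X (Equiv.swap i j l) =
        (p - swapVar i j p) * X l + swapVar i j p * (X l - X (Equiv.swap i j l)) := by ring
    rw [e]
    refine dvd_add (hp.mul_right _) (Dvd.dvd.mul_left ?_ _)
    by_cases hi : l = i
    · subst hi; simp
    by_cases hj : l = j
    · subst hj
      rw [Equiv.swap_apply_right]
      exact ⟨-1, by ring⟩
    · rw [Equiv.swap_apply_of_ne_of_ne hi hj]; simp

/-- The divided difference `(f - s f) / (X i - X j)`, where `s` exchanges `X i` and `X j`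
(it vanishes for `i = j`). -/
noncomputable def divDiffAux (i j : σ) (f : MvPolynomial σ ℂ) : MvPolynomial σ ℂ :=
  if i = j then 0 else (X_sub_X_dvd_sub_swapVar i j f).choose

theorem X_sub_X_mul_divDiffAux (i j : σ) (f : MvPolynomial σ ℂ) :
    (X i - X j) * divDiffAux i j f = f - swapVar i j f := by
  unfold divDiffAux
  split_ifs with h
  · subst h; simp [swapVar]
  · exact (X_sub_X_dvd_sub_swapVar i j f).choose_spec.symm

/-- The divided difference as a linear map. -/
noncomputable def divDiff (i j : σ) : MvPolynomial σ ℂ →ₗ[ℂ] MvPolynomial σ ℂ where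
  toFun := divDiffAux i j
  map_add' f g := by
    by_cases h : i = j
    · simp [divDiffAux, h]
    · refine mul_left_cancel₀ (X_sub_X_ne_zero h) ?_
      rw [mul_add]
      simp only [X_sub_X_mul_divDiffAux, map_add]
      ring
  map_smul' c f := by
    by_cases h : i = j
    · simp [divDiffAux, h]
    · refine mul_left_cancel₀ (X_sub_X_ne_zero h) ?_
      rw [RingHom.id_apply, mul_smul_comm]
      simp only [X_sub_X_mul_divDiffAux, map_smul, smul_sub]

theorem X_sub_X_mul_divDiff (i j : σ) (f : MvPolynomial σ ℂ) :
    (X i - X j) * divDiff i j f = f - swapVar i j f :=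
  X_sub_X_mul_divDiffAux i j f

theorem divDiff_self (i : σ) (f : MvPolynomial σ ℂ) : divDiff i i f = 0 := by
  simp [divDiff, divDiffAux]

theorem divDiff_eq_of_mul_eq {i j : σ} (h : i ≠ j) {f g : MvPolynomial σ ℂ}
    (e : (X i - X j) * g = f - swapVar i j f) : divDiff i j f = g :=
  mul_left_cancel₀ (X_sub_X_ne_zero h) (by rw [X_sub_X_mul_divDiff, e])

theorem divDiff_eq_zero {i j : σ} {f : MvPolynomial σ ℂ} (hf : swapVar i j f = f) :
    divDiff i j f = 0 := by
  by_cases h : i = j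
  · rw [h, divDiff_self]
  · exact divDiff_eq_of_mul_eq h (by simp [hf])

theorem divDiff_comm (i j : σ) (f : MvPolynomial σ ℂ) : divDiff i j f = -divDiff j i f := by
  by_cases h : i = j
  · rw [h, divDiff_self, neg_zero]
  refine divDiff_eq_of_mul_eq h ?_
  have := X_sub_X_mul_divDiff j i f
  rw [swapVar, Equiv.swap_comm] at this
  rw [swapVar]
  linear_combination this

theorem swapVar_divDiff (i j : σ) (f : MvPolynomial σ ℂ) :
    swapVar i j (divDiff i j f) = divDiff i j f := by
  by_cases h : i = j
  · simp [h, divDiff_self]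
  · symm
    refine divDiff_eq_of_mul_eq h ?_
    have := congrArg (swapVar i j) (X_sub_X_mul_divDiff i j f)
    simp only [map_mul, map_sub, swapVar_X, Equiv.swap_apply_left, Equiv.swap_apply_right,
      swapVar_swapVar] at this
    linear_combination -this

theorem rename_swapVar {τ : Type*} [DecidableEq τ] (w : σ ≃ τ) (i j : σ) (f : MvPolynomial σ ℂ) :
    rename w (swapVar i j f) = swapVar (w i) (w j) (rename w f) := by
  simp only [swapVar, rename_rename]
  congr 2
  funext x
  simp only [Function.comp_apply]
  exact w.injective.map_swap i j x

theorem rename_divDiff {τ : Type*} [DecidableEq τ] (w : σ ≃ τ) (i j : σ) (f : MvPolynomial σ ℂ) :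
    rename w (divDiff i j f) = divDiff (w i) (w j) (rename w f) := by
  by_cases h : i = j
  · simp [h, divDiff_self]
  · symm
    refine divDiff_eq_of_mul_eq (fun e => h (w.injective e)) ?_
    rw [← rename_swapVar, ← map_sub, ← X_sub_X_mul_divDiff i j f]
    simp

theorem divDiff_X_left_mul {i j : σ} (h : i ≠ j) (f : MvPolynomial σ ℂ) :
    divDiff i j (X i * f) = X i * divDiff i j f + swapVar i j f := by
  refine divDiff_eq_of_mul_eq h ?_
  rw [map_mul, swapVar_X, Equiv.swap_apply_left]
  linear_combination X i * X_sub_X_mul_divDiff i j f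

theorem divDiff_X_right_mul {i j : σ} (h : i ≠ j) (f : MvPolynomial σ ℂ) :
    divDiff i j (X j * f) = X j * divDiff i j f - swapVar i j f := by
  refine divDiff_eq_of_mul_eq h ?_
  rw [map_mul, swapVar_X, Equiv.swap_apply_right]
  linear_combination X j * X_sub_X_mul_divDiff i j f

theorem divDiff_mul_of_swapVar_eq {i j : σ} {g : MvPolynomial σ ℂ} (hg : swapVar i j g = g)
    (f : MvPolynomial σ ℂ) : divDiff i j (g * f) = g * divDiff i j f := by
  by_cases h : i = j
  · simp [h, divDiff_self]
  refine divDiff_eq_of_mul_eq h ?_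
  rw [map_mul, hg]
  linear_combination g * X_sub_X_mul_divDiff i j f

theorem pderiv_rename_equiv {τ : Type*} (w : σ ≃ τ) (i : σ) (f : MvPolynomial σ ℂ) :
    pderiv (w i) (rename w f) = rename w (pderiv i f) :=
  pderiv_rename w.injective i f

theorem pderiv_swapVar_of_ne {i j l : σ} (hi : l ≠ i) (hj : l ≠ j) (f : MvPolynomial σ ℂ) :
    pderiv l (swapVar i j f) = swapVar i j (pderiv l f) := by
  have := pderiv_rename_equiv (Equiv.swap i j) l f
  rwa [Equiv.swap_apply_of_ne_of_ne hi hj] at this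

end DividedDifference

section Dunkl

set_option linter.unusedSectionVars false

variable {σ ι κ : Type*} [DecidableEq σ] [Fintype ι] [Fintype κ] [DecidableEq ι] [DecidableEq κ]

/-- The Dunkl operator `∂_i - a ∑_j (1 - s_{ij}) / (X_i - X_j)` of type `A` in the block of
variables indexed by `e`. -/
noncomputable def dunkl (a : ℂ) (e : ι ↪ σ) (i : ι) : Module.End ℂ (MvPolynomial σ ℂ) :=
  (pderiv (e i)).toLinearMap - a • ∑ j, divDiff (e i) (e j)

theorem dunkl_apply (a : ℂ) (e : ι ↪ σ) (i : ι) (f : MvPolynomial σ ℂ) :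
    dunkl a e i f = pderiv (e i) f - a • ∑ j, divDiff (e i) (e j) f := by
  simp [dunkl, LinearMap.sum_apply]

theorem dunkl_C (a : ℂ) (e : ι ↪ σ) (i : ι) (c : ℂ) : dunkl a e i (C c) = 0 := by
  rw [dunkl_apply, pderiv_C, Finset.sum_eq_zero, smul_zero, sub_zero]
  intro j _
  exact divDiff_eq_zero (by simp [swapVar])

theorem dunkl_X_mul_of_ne (a : ℂ) (e : ι ↪ σ) {i j : ι} (h : i ≠ j) (f : MvPolynomial σ ℂ) :
    dunkl a e i (X (e j) * f) = X (e j) * dunkl a e i f + a • swapVar (e i) (e j) f := by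
  have hij : e i ≠ e j := e.injective.ne h
  have key : ∀ l, divDiff (e i) (e l) (X (e j) * f) =
      X (e j) * divDiff (e i) (e l) f - if l = j then swapVar (e i) (e j) f else 0 := by
    intro l
    split_ifs with hl
    · subst hl
      exact divDiff_X_right_mul hij f
    · rw [sub_zero]
      refine divDiff_mul_of_swapVar_eq ?_ f
      rw [swapVar_X, Equiv.swap_apply_of_ne_of_ne hij.symm (e.injective.ne (Ne.symm hl))]
  rw [dunkl_apply, dunkl_apply, Derivation.leibniz, pderiv_X_of_ne hij.symm]
  simp only [key, Finset.sum_sub_distrib, ← Finset.mul_sum, Finset.sum_ite_eq', Finset.mem_univ,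
    if_true, smul_eq_mul, mul_zero, add_zero, smul_sub, mul_sub, mul_smul_comm]
  ring

theorem dunkl_X_mul_self (a : ℂ) (e : ι ↪ σ) (i : ι) (f : MvPolynomial σ ℂ) :
    dunkl a e i (X (e i) * f) = X (e i) * dunkl a e i f + (1 + a) • f
      - a • ∑ j, swapVar (e i) (e j) f := by
  have key : ∀ l, divDiff (e i) (e l) (X (e i) * f) =
      X (e i) * divDiff (e i) (e l) f + (swapVar (e i) (e l) f - if l = i then f else 0) := by
    intro l
    split_ifs with hl
    · subst hl
      simp [divDiff_self, swapVar]
    · rw [divDiff_X_left_mul (e.injective.ne (Ne.symm hl)), sub_zero]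
  rw [dunkl_apply, dunkl_apply, Derivation.leibniz, pderiv_X_self]
  simp only [key, Finset.sum_add_distrib, Finset.sum_sub_distrib, ← Finset.mul_sum,
    Finset.sum_ite_eq', Finset.mem_univ,
    if_true, smul_eq_mul, smul_sub, smul_add, mul_sub, mul_smul_comm, add_smul, one_smul, mul_one]
  ring

theorem dunkl_X_mul_of_notMem (a : ℂ) (e : ι ↪ σ) (i : ι) {l : σ} (h : ∀ j, e j ≠ l)
    (f : MvPolynomial σ ℂ) :
    dunkl a e i (X l * f) = X l * dunkl a e i f := by
  have key : ∀ j, divDiff (e i) (e j) (X l * f) = X l * divDiff (e i) (e j) f := by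
    intro j
    refine divDiff_mul_of_swapVar_eq ?_ f
    rw [swapVar_X, Equiv.swap_apply_of_ne_of_ne (h i).symm (h j).symm]
  rw [dunkl_apply, dunkl_apply, Derivation.leibniz, pderiv_X_of_ne (h i).symm]
  simp only [key, ← Finset.mul_sum, smul_eq_mul, mul_zero, add_zero, mul_sub, mul_smul_comm]

theorem rename_dunkl {τ : Type*} [DecidableEq τ] (a : ℂ) (e : ι ↪ σ) (e' : κ ↪ τ) (w : σ ≃ τ)
    (v : ι ≃ κ) (h : ∀ i, w (e i) = e' (v i)) (i : ι) (f : MvPolynomial σ ℂ) :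
    rename w (dunkl a e i f) = dunkl a e' (v i) (rename w f) := by
  rw [dunkl_apply, dunkl_apply, map_sub, map_smul, map_sum, ← h, pderiv_rename_equiv]
  simp only [rename_divDiff, h]
  congr 2
  exact Equiv.sum_comp v fun j => divDiff (e' (v i)) (e' j) (rename w f)

theorem swapVar_dunkl (a : ℂ) (e : ι ↪ σ) (i k l : ι) (f : MvPolynomial σ ℂ) :
    swapVar (e k) (e l) (dunkl a e i f) =
      dunkl a e (Equiv.swap k l i) (swapVar (e k) (e l) f) :=
  rename_dunkl a e e _ _ (fun j => (e.injective.map_swap k l j).symm) i f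

theorem swapVar_dunkl_of_disjoint (a : ℂ) (e : ι ↪ σ) (i : ι) {k l : σ}
    (hk : ∀ j, e j ≠ k) (hl : ∀ j, e j ≠ l) (f : MvPolynomial σ ℂ) :
    swapVar k l (dunkl a e i f) = dunkl a e i (swapVar k l f) :=
  rename_dunkl a e e _ (Equiv.refl ι)
    (fun j => Equiv.swap_apply_of_ne_of_ne (hk j) (hl j)) i f

/-- Operators whose commutator commutes with all variables and kills constants commute. -/
theorem commute_of_commutator {D D' : Module.End ℂ (MvPolynomial σ ℂ)}
    (h : ∀ c, D (D' (C c)) = D' (D (C c)))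
    (hX : ∀ l f, D (D' (X l * f)) - D' (D (X l * f)) = X l * (D (D' f) - D' (D f))) :
    Commute D D' := by
  refine LinearMap.ext fun f => ?_
  rw [Module.End.mul_apply, Module.End.mul_apply]
  induction f using MvPolynomial.induction_on with
  | C c => exact h c
  | add p q hp hq => simp only [map_add, hp, hq]
  | mul_X p l hp =>
    rw [mul_comm, ← sub_eq_zero, hX, hp, sub_self, mul_zero]

theorem dunkl_commute (a : ℂ) (e : ι ↪ σ) (i j : ι) :
    Commute (dunkl a e i) (dunkl a e j) := by
  by_cases hij : i = j
  · rw [hij]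
  refine commute_of_commutator (fun c => by simp [dunkl_C]) fun l f => ?_
  have main : ∀ {i j : ι}, i ≠ j →
      dunkl a e i (dunkl a e j (X (e i) * f)) - dunkl a e j (dunkl a e i (X (e i) * f)) =
        X (e i) * (dunkl a e i (dunkl a e j f) - dunkl a e j (dunkl a e i f)) := by
    intro i j hij
    have h1 : ∑ k, dunkl a e j (swapVar (e i) (e k) f) =
        ∑ k, swapVar (e i) (e k) (dunkl a e j f) +
          (dunkl a e j (swapVar (e i) (e j) f) - dunkl a e i (swapVar (e i) (e j) f)) := by
      rw [← sub_eq_iff_eq_add', ← Finset.sum_sub_distrib, Finset.sum_eq_single j]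
      · rw [swapVar_dunkl, Equiv.swap_apply_right]
      · intro k _ hk
        rw [swapVar_dunkl, Equiv.swap_apply_of_ne_of_ne (Ne.symm hij) (Ne.symm hk), sub_self]
      · simp
    rw [dunkl_X_mul_of_ne a e (Ne.symm hij), dunkl_X_mul_self, map_add, map_sub, map_add,
      dunkl_X_mul_self, dunkl_X_mul_of_ne a e (Ne.symm hij)]
    simp only [map_smul, map_sum, h1]
    rw [show swapVar (e j) (e i) f = swapVar (e i) (e j) f by
        rw [swapVar, swapVar, Equiv.swap_comm],
      show swapVar (e j) (e i) (dunkl a e i f) = dunkl a e j (swapVar (e i) (e j) f) by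
        rw [swapVar_dunkl, Equiv.swap_apply_right, swapVar, swapVar, Equiv.swap_comm]]
    simp only [smul_eq_C_mul]
    ring
  by_cases hl : ∃ k, e k = l
  · obtain ⟨k, rfl⟩ := hl
    by_cases hki : k = i
    · subst hki; exact main hij
    by_cases hkj : k = j
    · subst hkj
      have := main (Ne.symm hij)
      linear_combination -this
    rw [dunkl_X_mul_of_ne a e (Ne.symm hkj), dunkl_X_mul_of_ne a e (Ne.symm hki), map_add, map_add,
      dunkl_X_mul_of_ne a e (Ne.symm hki), dunkl_X_mul_of_ne a e (Ne.symm hkj)]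
    simp only [map_smul, swapVar_dunkl]
    rw [Equiv.swap_apply_of_ne_of_ne (Ne.symm hij) (Ne.symm hkj),
      Equiv.swap_apply_of_ne_of_ne hij (Ne.symm hki)]
    ring
  · push Not at hl
    simp only [dunkl_X_mul_of_notMem a e _ hl, mul_sub]

theorem commutator_dunkl_X_mul_of_disjoint (a : ℂ) (e : ι ↪ σ) (e' : κ ↪ σ)
    (h : ∀ i j, e i ≠ e' j) (i k : ι) (j : κ) (f : MvPolynomial σ ℂ) :
    dunkl a e i (dunkl a e' j (X (e k) * f)) - dunkl a e' j (dunkl a e i (X (e k) * f)) =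
      X (e k) * (dunkl a e i (dunkl a e' j f) - dunkl a e' j (dunkl a e i f)) := by
  have h' : ∀ k, ∀ j, e' j ≠ e k := fun k j => (h k j).symm
  rw [dunkl_X_mul_of_notMem a e' j (h' k)]
  by_cases hk : k = i
  · subst hk
    rw [dunkl_X_mul_self, dunkl_X_mul_self, map_sub, map_add, dunkl_X_mul_of_notMem a e' j (h' k)]
    simp only [map_smul, map_sum, swapVar_dunkl_of_disjoint a e' j (h' _) (h' _)]
    ring
  · rw [dunkl_X_mul_of_ne a e (Ne.symm hk), dunkl_X_mul_of_ne a e (Ne.symm hk), map_add,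
      dunkl_X_mul_of_notMem a e' j (h' k)]
    simp only [map_smul, swapVar_dunkl_of_disjoint a e' j (h' _) (h' _)]
    ring

theorem dunkl_commute_of_disjoint (a : ℂ) (e : ι ↪ σ) (e' : κ ↪ σ) (h : ∀ i j, e i ≠ e' j)
    (i : ι) (j : κ) : Commute (dunkl a e i) (dunkl a e' j) := by
  refine commute_of_commutator (fun c => by simp [dunkl_C]) fun l f => ?_
  by_cases hl : ∃ k, e k = l
  · obtain ⟨k, rfl⟩ := hl
    exact commutator_dunkl_X_mul_of_disjoint a e e' h i k j f
  push Not at hl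
  by_cases hl' : ∃ k, e' k = l
  · obtain ⟨k, rfl⟩ := hl'
    have := commutator_dunkl_X_mul_of_disjoint a e' e (fun i j => (h j i).symm) j k i f
    linear_combination -this
  · push Not at hl'
    simp only [dunkl_X_mul_of_notMem a e _ hl, dunkl_X_mul_of_notMem a e' _ hl', mul_sub]

/-- The algebra generated by the Dunkl operators is commutative. -/
noncomputable abbrev dunklAlgebraCommRing (a : ℂ) (e : ι ↪ σ) :
    CommRing (Algebra.adjoin ℂ (Set.range (dunkl a e))) :=
  { Subalgebra.toRing (Algebra.adjoin ℂ (Set.range (dunkl a e))) with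
    mul_comm := (Algebra.isMulCommutative_adjoin ℂ (s := Set.range (dunkl a e)) (by
      rintro _ ⟨i, rfl⟩ _ ⟨j, rfl⟩
      exact dunkl_commute a e i j)).is_comm.comm }

/-- Substitution of the (commuting) Dunkl operators into a polynomial. -/
noncomputable def dunklHom (a : ℂ) (e : ι ↪ σ) :
    MvPolynomial ι ℂ →ₐ[ℂ] Module.End ℂ (MvPolynomial σ ℂ) :=
  letI := dunklAlgebraCommRing a e
  (Algebra.adjoin ℂ (Set.range (dunkl a e))).val.comp
    (aeval fun i => ⟨dunkl a e i, Algebra.subset_adjoin ⟨i, rfl⟩⟩)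

theorem dunklHom_X (a : ℂ) (e : ι ↪ σ) (i : ι) : dunklHom a e (X i) = dunkl a e i := by
  let := dunklAlgebraCommRing a e
  change ((Algebra.adjoin ℂ (Set.range (dunkl a e))).val.comp
    (aeval fun i => ⟨dunkl a e i, Algebra.subset_adjoin ⟨i, rfl⟩⟩)) (X i) = _
  rw [AlgHom.comp_apply, aeval_X]
  rfl

theorem rename_dunklHom {τ : Type*} [DecidableEq τ] (a : ℂ) (e : ι ↪ σ) (e' : κ ↪ τ) (w : σ ≃ τ)
    (v : ι ≃ κ) (h : ∀ i, w (e i) = e' (v i)) (g : MvPolynomial ι ℂ) (f : MvPolynomial σ ℂ) :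
    rename w (dunklHom a e g f) = dunklHom a e' (rename v g) (rename w f) := by
  induction g using MvPolynomial.induction_on generalizing f with
  | C c =>
    rw [rename_C, ← algebraMap_eq, ← algebraMap_eq, AlgHom.commutes, AlgHom.commutes,
      Module.algebraMap_end_apply, Module.algebraMap_end_apply, map_smul]
  | add p q hp hq => simp only [map_add, LinearMap.add_apply, hp, hq]
  | mul_X p l hp =>
    simp only [map_mul, Module.End.mul_apply, rename_X, dunklHom_X, hp]
    rw [rename_dunkl a e e' w v h]

theorem commute_dunklHom {a : ℂ} {e : ι ↪ σ} {D : Module.End ℂ (MvPolynomial σ ℂ)}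
    (h : ∀ i, Commute D (dunkl a e i)) (g : MvPolynomial ι ℂ) : Commute D (dunklHom a e g) := by
  induction g using MvPolynomial.induction_on with
  | C c =>
    rw [← algebraMap_eq, AlgHom.commutes]
    exact Algebra.commute_algebraMap_right _ _
  | add p q hp hq => rw [map_add]; exact hp.add_right hq
  | mul_X p l hp =>
    rw [map_mul, dunklHom_X]
    exact hp.mul_right (h l)

theorem dunklHom_commute_of_disjoint (a : ℂ) (e : ι ↪ σ) (e' : κ ↪ σ) (h : ∀ i j, e i ≠ e' j)
    (g : MvPolynomial ι ℂ) (g' : MvPolynomial κ ℂ) :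
    Commute (dunklHom a e g) (dunklHom a e' g') :=
  commute_dunklHom (fun j => (commute_dunklHom
    (fun i => (dunkl_commute_of_disjoint a e e' h i j).symm) g).symm) g'

theorem swapVar_dunklHom (a : ℂ) (e : ι ↪ σ) (k l : ι) (g : MvPolynomial ι ℂ)
    (f : MvPolynomial σ ℂ) :
    swapVar (e k) (e l) (dunklHom a e g f) =
      dunklHom a e (swapVar k l g) (swapVar (e k) (e l) f) :=
  rename_dunklHom a e e _ _ (fun j => (e.injective.map_swap k l j).symm) g f

theorem dunklHom_C (a : ℂ) (e : ι ↪ σ) (c : ℂ) (g : MvPolynomial σ ℂ) :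
    dunklHom a e (C c) g = c • g := by
  rw [← algebraMap_eq, AlgHom.commutes, Module.algebraMap_end_apply]

theorem dunklHom_X_mul_apply (a : ℂ) (e : ι ↪ σ) (i : ι) (f : MvPolynomial ι ℂ)
    (g : MvPolynomial σ ℂ) : dunklHom a e (X i * f) g = dunkl a e i (dunklHom a e f g) := by
  rw [map_mul, dunklHom_X, Module.End.mul_apply]

/-- Conjugate form of the commutation rule: moving a variable through `f(T)`. -/
theorem dunklHom_apply_X_mul (a : ℂ) (e : ι ↪ σ) (i : ι) (f : MvPolynomial ι ℂ)
    (g : MvPolynomial σ ℂ) :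
    dunklHom a e f (X (e i) * g) = X (e i) * dunklHom a e f g + dunklHom a e (pderiv i f) g -
      a • ∑ j, dunklHom a e (divDiff i j f) (swapVar (e i) (e j) g) := by
  induction f using MvPolynomial.induction_on with
  | C c =>
    have : ∀ j, divDiff i j (C c : MvPolynomial ι ℂ) = 0 := fun j =>
      divDiff_eq_zero (by simp [swapVar])
    simp [this]
  | add p q hp hq =>
    simp only [map_add, LinearMap.add_apply, hp, hq, Finset.sum_add_distrib, smul_add]
    ring
  | mul_X p l hp =>
    rw [mul_comm p, dunklHom_X_mul_apply, hp, dunklHom_X_mul_apply, map_sub, map_add]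
    by_cases hl : l = i
    · subst hl
      have key : ∀ j, divDiff l j (X l * p) =
          X l * divDiff l j p + (swapVar l j p - if j = l then p else 0) := by
        intro j
        split_ifs with hj
        · subst hj
          simp [divDiff_self, swapVar]
        · rw [divDiff_X_left_mul (Ne.symm hj), sub_zero]
      have hd : pderiv l (X l * p) = X l * pderiv l p + p := by
        rw [Derivation.leibniz, pderiv_X_self]; simp
      simp only [key, hd, dunkl_X_mul_self, map_add, map_sub, LinearMap.add_apply,
        LinearMap.sub_apply, dunklHom_X_mul_apply, Finset.sum_add_distrib, Finset.sum_sub_distrib,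
        map_smul, map_sum, swapVar_dunklHom]
      have hs : ∑ j, dunklHom a e (if j = l then p else 0) (swapVar (e l) (e j) g) =
          dunklHom a e p g := by
        rw [Finset.sum_eq_single l]
        · simp [swapVar]
        · intro j _ hj; simp [hj]
        · simp
      rw [hs]
      simp only [smul_eq_C_mul, C_add, C_1]
      ring
    · have key : ∀ j, divDiff i j (X l * p) =
          X l * divDiff i j p - if j = l then swapVar i l p else 0 := by
        intro j
        split_ifs with hj
        · subst hj
          exact divDiff_X_right_mul (Ne.symm hl) p
        · rw [sub_zero]
          refine divDiff_mul_of_swapVar_eq ?_ p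
          rw [swapVar_X, Equiv.swap_apply_of_ne_of_ne hl (Ne.symm hj)]
      have hd : pderiv i (X l * p) = X l * pderiv i p := by
        rw [Derivation.leibniz, pderiv_X_of_ne hl]; simp
      have hs : ∑ j, dunklHom a e (if j = l then swapVar i l p else 0) (swapVar (e i) (e j) g) =
          dunklHom a e (swapVar i l p) (swapVar (e i) (e l) g) := by
        rw [Finset.sum_eq_single l]
        · simp
        · intro j _ hj; simp [hj]
        · simp
      simp only [key, hd, dunkl_X_mul_of_ne a e hl, map_sub,
        LinearMap.sub_apply, dunklHom_X_mul_apply, Finset.sum_sub_distrib, hs,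
        map_smul, map_sum, swapVar_dunklHom]
      rw [show swapVar l i p = swapVar i l p by rw [swapVar, swapVar, Equiv.swap_comm],
        show swapVar (e l) (e i) g = swapVar (e i) (e l) g by
          rw [swapVar, swapVar, Equiv.swap_comm]]
      simp only [smul_eq_C_mul]
      ring

theorem constantCoeff_swapVar (i j : σ) (f : MvPolynomial σ ℂ) :
    constantCoeff (swapVar i j f) = constantCoeff f := by
  rw [swapVar, constantCoeff_rename]

/-- Multiplication by a variable is adjoint to the Dunkl operator for the Dunkl pairing. -/
theorem constantCoeff_dunklHom_X_mul (a : ℂ) (i : ι) (f g : MvPolynomial ι ℂ) :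
    constantCoeff (dunklHom a (Function.Embedding.refl ι) f (X i * g)) =
      constantCoeff (dunklHom a (Function.Embedding.refl ι)
        (dunkl a (Function.Embedding.refl ι) i f) g) := by
  have h := dunklHom_apply_X_mul a (Function.Embedding.refl ι) i f g
  simp only [Function.Embedding.refl_apply] at h
  have hs : ∀ j, constantCoeff (dunklHom a (Function.Embedding.refl ι) (divDiff i j f)
      (swapVar i j g)) =
      constantCoeff (dunklHom a (Function.Embedding.refl ι) (divDiff i j f) g) := by
    intro j
    have := swapVar_dunklHom a (Function.Embedding.refl ι) i j (divDiff i j f) g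
    simp only [Function.Embedding.refl_apply, swapVar_divDiff] at this
    rw [← this, constantCoeff_swapVar]
  rw [h, dunkl_apply]
  simp only [map_sub, map_add, map_mul, constantCoeff_X, zero_mul, zero_add, map_smul, map_sum,
    LinearMap.sub_apply, LinearMap.smul_apply, LinearMap.sum_apply, constantCoeff_smul, hs,
    Function.Embedding.refl_apply]

end Dunkl

section Contract

set_option linter.unusedSectionVars false

variable {σ τ ι κ : Type*} [DecidableEq σ] [DecidableEq τ] [Fintype ι] [DecidableEq ι]
  [DecidableEq κ]

/-- A linear map compatible with multiplication by variables, exchanges of variables and partial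
derivatives in a block intertwines the Dunkl operators of the block. -/
theorem map_dunkl {L : MvPolynomial σ ℂ →ₗ[ℂ] MvPolynomial τ ℂ} {e : ι ↪ σ} {e' : ι ↪ τ}
    (hX : ∀ i f, L (X (e i) * f) = X (e' i) * L f)
    (hs : ∀ i j f, L (swapVar (e i) (e j) f) = swapVar (e' i) (e' j) (L f))
    (hd : ∀ i f, L (pderiv (e i) f) = pderiv (e' i) (L f)) (a : ℂ) (i : ι)
    (f : MvPolynomial σ ℂ) : L (dunkl a e i f) = dunkl a e' i (L f) := by
  have key : ∀ j, L (divDiff (e i) (e j) f) = divDiff (e' i) (e' j) (L f) := by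
    intro j
    by_cases h : i = j
    · simp [h, divDiff_self]
    · symm
      refine divDiff_eq_of_mul_eq (e'.injective.ne h) ?_
      rw [← hs, ← map_sub, ← X_sub_X_mul_divDiff (e i) (e j) f, sub_mul, sub_mul, map_sub, hX, hX]
  rw [dunkl_apply, dunkl_apply, map_sub, map_smul, map_sum, hd]
  simp only [key]

theorem map_dunklHom {L : MvPolynomial σ ℂ →ₗ[ℂ] MvPolynomial τ ℂ} {e : ι ↪ σ} {e' : ι ↪ τ}
    {a : ℂ} (h : ∀ i f, L (dunkl a e i f) = dunkl a e' i (L f)) (g : MvPolynomial ι ℂ)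
    (f : MvPolynomial σ ℂ) : L (dunklHom a e g f) = dunklHom a e' g (L f) := by
  induction g using MvPolynomial.induction_on generalizing f with
  | C c => simp
  | add p q hp hq => simp only [map_add, LinearMap.add_apply, hp, hq]
  | mul_X p l hp => simp only [map_mul, Module.End.mul_apply, dunklHom_X, hp, h]

/-- Substitute a linear map into the second block of variables. -/
noncomputable def contractWith (ξ : MvPolynomial κ ℂ →ₗ[ℂ] MvPolynomial ι ℂ) :
    MvPolynomial (ι ⊕ κ) ℂ →ₗ[ℂ] MvPolynomial ι ℂ :=
  (basisMonomials (ι ⊕ κ) ℂ).constr ℂ fun m =>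
    ξ (monomial (Finsupp.sumFinsuppEquivProdFinsupp m).2 1) *
      monomial (Finsupp.sumFinsuppEquivProdFinsupp m).1 1

theorem rename_inl_monomial_mul_rename_inr_monomial (s : ι →₀ ℕ) (t : κ →₀ ℕ) :
    rename Sum.inl (monomial s (1 : ℂ)) * rename Sum.inr (monomial t (1 : ℂ)) =
      monomial (Finsupp.sumElim s t) 1 := by
  have h : Finsupp.mapDomain Sum.inl s + Finsupp.mapDomain Sum.inr t = Finsupp.sumElim s t := by
    ext (i | i)
    · rw [Finsupp.add_apply, Finsupp.mapDomain_apply Sum.inl_injective,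
        Finsupp.mapDomain_of_notMem_range]
      · simp
      · simp
    · rw [Finsupp.add_apply, Finsupp.mapDomain_apply Sum.inr_injective,
        Finsupp.mapDomain_of_notMem_range]
      · simp
      · simp
  rw [rename_monomial, rename_monomial, monomial_mul, one_mul, h]

/-- Linear maps out of a polynomial ring in two blocks are determined by products. -/
theorem linearMap_sum_ext {M : Type*} [AddCommGroup M] [Module ℂ M]
    {L L' : MvPolynomial (ι ⊕ κ) ℂ →ₗ[ℂ] M}
    (h : ∀ f g, L (rename Sum.inl f * rename Sum.inr g) =
      L' (rename Sum.inl f * rename Sum.inr g)) : L = L' := by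
  refine (basisMonomials (ι ⊕ κ) ℂ).ext fun m => ?_
  have := h (monomial (Finsupp.sumFinsuppEquivProdFinsupp m).1 1)
    (monomial (Finsupp.sumFinsuppEquivProdFinsupp m).2 1)
  rw [rename_inl_monomial_mul_rename_inr_monomial] at this
  have e : Finsupp.sumElim (Finsupp.sumFinsuppEquivProdFinsupp m).1
      (Finsupp.sumFinsuppEquivProdFinsupp m).2 = m :=
    Finsupp.sumFinsuppEquivProdFinsupp.symm_apply_apply m
  rw [e] at this
  simpa using this

theorem contractWith_mul (ξ : MvPolynomial κ ℂ →ₗ[ℂ] MvPolynomial ι ℂ) (f : MvPolynomial ι ℂ)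
    (g : MvPolynomial κ ℂ) :
    contractWith ξ (rename Sum.inl f * rename Sum.inr g) = ξ g * f := by
  have hmon : ∀ (s : ι →₀ ℕ) (t : κ →₀ ℕ),
      contractWith ξ
        (rename Sum.inl (monomial s (1 : ℂ)) * rename Sum.inr (monomial t (1 : ℂ))) =
        ξ (monomial t 1) * monomial s 1 := by
    intro s t
    rw [rename_inl_monomial_mul_rename_inr_monomial]
    have := (basisMonomials (ι ⊕ κ) ℂ).constr_basis ℂ (fun m =>
      ξ (monomial (Finsupp.sumFinsuppEquivProdFinsupp m).2 1) *
        monomial (Finsupp.sumFinsuppEquivProdFinsupp m).1 1) (Finsupp.sumElim s t)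
    rw [coe_basisMonomials] at this
    rw [contractWith, this]
    have e : Finsupp.sumFinsuppEquivProdFinsupp (Finsupp.sumElim s t) = (s, t) :=
      Finsupp.sumFinsuppEquivProdFinsupp.apply_symm_apply (s, t)
    rw [e]
  induction f using MvPolynomial.induction_on' with
  | monomial s r =>
    induction g using MvPolynomial.induction_on' with
    | monomial t r' =>
      have h1 : (monomial s r : MvPolynomial ι ℂ) = r • monomial s 1 := by
        rw [smul_monomial, smul_eq_mul, mul_one]
      have h2 : (monomial t r' : MvPolynomial κ ℂ) = r' • monomial t 1 := by
        rw [smul_monomial, smul_eq_mul, mul_one]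
      rw [h1, h2, map_smul, map_smul, smul_mul_smul_comm, map_smul, hmon, map_smul,
        smul_mul_smul_comm, mul_comm r]
    | add p q hp hq => simp only [map_add, mul_add, add_mul, hp, hq]
  | add p q hp hq => simp only [map_add, add_mul, mul_add, hp, hq]

/-- Apply a linear functional to the variables of the second block. -/
noncomputable def contract (ξ : MvPolynomial κ ℂ →ₗ[ℂ] ℂ) :
    MvPolynomial (ι ⊕ κ) ℂ →ₗ[ℂ] MvPolynomial ι ℂ :=
  contractWith ((Algebra.linearMap ℂ (MvPolynomial ι ℂ)).comp ξ)

theorem contract_mul (ξ : MvPolynomial κ ℂ →ₗ[ℂ] ℂ) (f : MvPolynomial ι ℂ)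
    (g : MvPolynomial κ ℂ) :
    contract ξ (rename Sum.inl f * rename Sum.inr g) = ξ g • f := by
  rw [contract, contractWith_mul, Algebra.smul_def]
  rfl

theorem swapVar_inl_rename_inl (i j : ι) (f : MvPolynomial ι ℂ) :
    swapVar (Sum.inl i : ι ⊕ κ) (Sum.inl j) (rename Sum.inl f) =
      rename Sum.inl (swapVar i j f) := by
  simp only [swapVar, rename_rename]
  congr 2
  funext x
  exact (Sum.inl_injective.map_swap i j x).symm

theorem swapVar_inl_rename_inr (i j : ι) (g : MvPolynomial κ ℂ) :
    swapVar (Sum.inl i : ι ⊕ κ) (Sum.inl j) (rename Sum.inr g) = rename Sum.inr g := by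
  simp only [swapVar, rename_rename]
  congr 2

theorem contract_X_mul (ξ : MvPolynomial κ ℂ →ₗ[ℂ] ℂ) (i : ι) (f : MvPolynomial (ι ⊕ κ) ℂ) :
    contract ξ (X (Sum.inl i) * f) = X i * contract ξ f := by
  have : (contract ξ).comp (LinearMap.mulLeft ℂ (X (Sum.inl i))) =
      (LinearMap.mulLeft ℂ (X i)).comp (contract ξ) := by
    refine linearMap_sum_ext fun f g => ?_
    simp only [LinearMap.comp_apply, LinearMap.mulLeft_apply]
    rw [← mul_assoc, ← rename_X, ← map_mul, contract_mul, contract_mul, mul_smul_comm]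
  exact LinearMap.congr_fun this f

theorem contract_swapVar (ξ : MvPolynomial κ ℂ →ₗ[ℂ] ℂ) (i j : ι) (f : MvPolynomial (ι ⊕ κ) ℂ) :
    contract ξ (swapVar (Sum.inl i) (Sum.inl j) f) = swapVar i j (contract ξ f) := by
  have : (contract ξ).comp (swapVar (Sum.inl i) (Sum.inl j)).toLinearMap =
      (swapVar i j).toLinearMap.comp (contract ξ) := by
    refine linearMap_sum_ext fun f g => ?_
    simp only [LinearMap.comp_apply, AlgHom.toLinearMap_apply]
    rw [map_mul, swapVar_inl_rename_inl, swapVar_inl_rename_inr, contract_mul, contract_mul,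
      map_smul]
  exact LinearMap.congr_fun this f

theorem pderiv_inl_rename_inr (i : ι) (g : MvPolynomial κ ℂ) :
    pderiv (Sum.inl i : ι ⊕ κ) (rename Sum.inr g) = 0 := by
  induction g using MvPolynomial.induction_on with
  | C c => simp
  | add p q hp hq => simp only [map_add, hp, hq, add_zero]
  | mul_X p l hp =>
    rw [map_mul, Derivation.leibniz, hp, rename_X, pderiv_X_of_ne Sum.inr_ne_inl]
    simp

theorem contract_pderiv (ξ : MvPolynomial κ ℂ →ₗ[ℂ] ℂ) (i : ι) (f : MvPolynomial (ι ⊕ κ) ℂ) :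
    contract ξ (pderiv (Sum.inl i) f) = pderiv i (contract ξ f) := by
  have : (contract ξ).comp (pderiv (Sum.inl i)).toLinearMap =
      (pderiv i).toLinearMap.comp (contract ξ) := by
    refine linearMap_sum_ext fun f g => ?_
    change contract ξ (pderiv (Sum.inl i) _) = pderiv i (contract ξ _)
    rw [Derivation.leibniz, pderiv_rename Sum.inl_injective, pderiv_inl_rename_inr, smul_zero,
      zero_add, smul_eq_mul, mul_comm, contract_mul, contract_mul, Derivation.map_smul]
  exact LinearMap.congr_fun this f

theorem contract_dunkl (ξ : MvPolynomial κ ℂ →ₗ[ℂ] ℂ) (a : ℂ) (i : ι)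
    (f : MvPolynomial (ι ⊕ κ) ℂ) :
    contract ξ (dunkl a Function.Embedding.inl i f) =
      dunkl a (Function.Embedding.refl ι) i (contract ξ f) :=
  map_dunkl (e := Function.Embedding.inl) (e' := Function.Embedding.refl ι)
    (contract_X_mul ξ) (contract_swapVar ξ) (contract_pderiv ξ) a i f

/-- Specialize the first block of variables. -/
noncomputable def specialize (t : ι → ℂ) : MvPolynomial (ι ⊕ κ) ℂ →ₐ[ℂ] MvPolynomial κ ℂ :=
  aeval (Sum.elim (fun i => C (t i)) X)

theorem specialize_X_inl (t : ι → ℂ) (i : ι) :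
    specialize t (X (Sum.inl i) : MvPolynomial (ι ⊕ κ) ℂ) = C (t i) := by
  simp [specialize]

theorem specialize_X_inr (t : ι → ℂ) (i : κ) :
    specialize t (X (Sum.inr i) : MvPolynomial (ι ⊕ κ) ℂ) = X i := by
  simp [specialize]

theorem specialize_rename_inl (t : ι → ℂ) (f : MvPolynomial ι ℂ) :
    specialize (κ := κ) t (rename Sum.inl f) = C (eval t f) := by
  induction f using MvPolynomial.induction_on with
  | C c => simp [specialize, algebraMap_eq]
  | add p q hp hq => simp only [map_add, hp, hq]
  | mul_X p l hp => rw [map_mul, map_mul, hp, rename_X, specialize_X_inl, map_mul, map_mul, eval_X]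

theorem specialize_rename_inr (t : ι → ℂ) (g : MvPolynomial κ ℂ) :
    specialize t (rename Sum.inr g) = g := by
  rw [specialize, aeval_rename, Sum.elim_comp_inr, aeval_X_left_apply]

theorem eval_contract (ξ : MvPolynomial κ ℂ →ₗ[ℂ] ℂ) (t : ι → ℂ) (f : MvPolynomial (ι ⊕ κ) ℂ) :
    eval t (contract ξ f) = ξ (specialize t f) := by
  have : (aeval t).toLinearMap.comp (contract ξ) = ξ.comp (specialize t).toLinearMap := by
    refine linearMap_sum_ext fun f g => ?_
    simp only [LinearMap.comp_apply, AlgHom.toLinearMap_apply, contract_mul, map_smul, map_mul,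
      specialize_rename_inl, specialize_rename_inr]
    rw [← smul_eq_C_mul, map_smul, smul_eq_mul, smul_eq_mul, mul_comm]
    rfl
  exact LinearMap.congr_fun this f

theorem specialize_pderiv (t : ι → ℂ) (i : κ) (f : MvPolynomial (ι ⊕ κ) ℂ) :
    specialize t (pderiv (Sum.inr i) f) = pderiv i (specialize t f) := by
  induction f using MvPolynomial.induction_on with
  | C c => simp [specialize, algebraMap_eq]
  | add p q hp hq => simp only [map_add, hp, hq]
  | mul_X p l hp =>
    have key : specialize t (pderiv (Sum.inr i) (X l : MvPolynomial (ι ⊕ κ) ℂ)) =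
        pderiv i (specialize t (X l)) := by
      rcases l with l | l
      · rw [pderiv_X_of_ne Sum.inl_ne_inr, specialize_X_inl, pderiv_C, map_zero]
      · rw [specialize_X_inr]
        by_cases h : l = i
        · rw [h, pderiv_X_self, pderiv_X_self, map_one]
        · rw [pderiv_X_of_ne h, pderiv_X_of_ne (Sum.inr_injective.ne h), map_zero]
    simp only [Derivation.leibniz, map_mul, map_add, smul_eq_mul, hp, key]

theorem specialize_swapVar (t : ι → ℂ) (i j : κ) (f : MvPolynomial (ι ⊕ κ) ℂ) :
    specialize t (swapVar (Sum.inr i) (Sum.inr j) f) = swapVar i j (specialize t f) := by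
  have : (specialize t).comp (swapVar (Sum.inr i) (Sum.inr j)) =
      (swapVar i j).comp (specialize (κ := κ) t) := by
    apply MvPolynomial.algHom_ext
    rintro (l | l)
    · rw [AlgHom.comp_apply, AlgHom.comp_apply, swapVar_X,
        Equiv.swap_apply_of_ne_of_ne Sum.inl_ne_inr Sum.inl_ne_inr, specialize_X_inl]
      simp [swapVar]
    · rw [AlgHom.comp_apply, AlgHom.comp_apply, swapVar_X, ← Sum.inr_injective.map_swap,
        specialize_X_inr, specialize_X_inr, swapVar_X]
  exact DFunLike.congr_fun this f

theorem specialize_dunkl [Fintype κ] (t : ι → ℂ) (a : ℂ) (i : κ)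
    (f : MvPolynomial (ι ⊕ κ) ℂ) :
    specialize t (dunkl a Function.Embedding.inr i f) =
      dunkl a (Function.Embedding.refl κ) i (specialize t f) :=
  map_dunkl (L := (specialize t).toLinearMap) (e := Function.Embedding.inr)
    (e' := Function.Embedding.refl κ)
    (fun i f => by
      rw [AlgHom.toLinearMap_apply, map_mul, Function.Embedding.inr_apply, specialize_X_inr]; rfl)
    (specialize_swapVar t) (specialize_pderiv t) a i f

end Contract

section Kernel

set_option linter.unusedSectionVars false

variable {ι κ : Type*} [Fintype ι] [DecidableEq ι] [Fintype κ] [DecidableEq κ]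

/-- The linear factor `y_k - t_i`; the `t`-variables form the first block, the `y`-variables the
second one. -/
noncomputable def linFactor (k : κ) (i : ι) : MvPolynomial (ι ⊕ κ) ℂ := X (Sum.inr k) - X (Sum.inl i)

/-- The reproducing kernel `∏ (y_k - t_i)^a`. -/
noncomputable def kernelPoly (ι κ : Type*) [Fintype ι] [Fintype κ] (a : ℕ) :
    MvPolynomial (ι ⊕ κ) ℂ :=
  ∏ p : κ × ι, linFactor p.1 p.2 ^ a

/-- The kernel divided by one of its linear factors. -/
noncomputable def kernelQuot (a : ℕ) (k : κ) (i : ι) : MvPolynomial (ι ⊕ κ) ℂ :=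
  linFactor k i ^ (a - 1) * ∏ p ∈ Finset.univ.erase (k, i), linFactor p.1 p.2 ^ a

theorem linFactor_ne_zero (k : κ) (i : ι) : linFactor k i ≠ 0 :=
  X_sub_X_ne_zero Sum.inr_ne_inl

theorem linFactor_mul_kernelQuot {a : ℕ} (ha : a ≠ 0) (k : κ) (i : ι) :
    linFactor k i * kernelQuot a k i = kernelPoly ι κ a := by
  have h := Finset.mul_prod_erase Finset.univ (fun p : κ × ι => linFactor p.1 p.2 ^ a)
    (Finset.mem_univ (k, i))
  rw [kernelPoly, ← h, ← mul_pow_sub_one ha, kernelQuot, mul_assoc]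

theorem rename_sumCongr_linFactor (v : Equiv.Perm ι) (w : Equiv.Perm κ) (k : κ) (i : ι) :
    rename (Equiv.sumCongr v w) (linFactor k i) = linFactor (w k) (v i) := by
  simp [linFactor]

theorem rename_sumCongr_kernelPoly (v : Equiv.Perm ι) (w : Equiv.Perm κ) (a : ℕ) :
    rename (Equiv.sumCongr v w) (kernelPoly ι κ a) = kernelPoly ι κ a := by
  rw [kernelPoly, map_prod]
  simp only [map_pow, rename_sumCongr_linFactor]
  exact (Equiv.prodCongr w v).prod_comp fun p : κ × ι => linFactor p.1 p.2 ^ a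

theorem rename_sumCongr_kernelQuot (v : Equiv.Perm ι) (w : Equiv.Perm κ) {a : ℕ} (ha : a ≠ 0)
    (k : κ) (i : ι) :
    rename (Equiv.sumCongr v w) (kernelQuot a k i) = kernelQuot a (w k) (v i) := by
  refine mul_left_cancel₀ (linFactor_ne_zero (w k) (v i)) ?_
  rw [← rename_sumCongr_linFactor, ← map_mul, linFactor_mul_kernelQuot ha,
    rename_sumCongr_kernelPoly, rename_sumCongr_linFactor, linFactor_mul_kernelQuot ha]

theorem swapVar_inr_eq (k l : κ) (f : MvPolynomial (ι ⊕ κ) ℂ) :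
    swapVar (Sum.inr k) (Sum.inr l) f =
      rename (Equiv.sumCongr (Equiv.refl ι) (Equiv.swap k l)) f := by
  rw [swapVar, ← Equiv.Perm.sumCongr_refl_swap]

theorem swapVar_inl_eq (i j : ι) (f : MvPolynomial (ι ⊕ κ) ℂ) :
    swapVar (Sum.inl i) (Sum.inl j) f =
      rename (Equiv.sumCongr (Equiv.swap i j) (Equiv.refl κ)) f := by
  rw [swapVar, ← Equiv.Perm.sumCongr_swap_refl]

theorem pderiv_kernelPoly (s : ι ⊕ κ) (a : ℕ) :
    pderiv s (kernelPoly ι κ a) =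
      (a : ℂ) • ∑ p : κ × ι, pderiv s (linFactor p.1 p.2) * kernelQuot a p.1 p.2 := by
  have key : ∀ u : Finset (κ × ι), pderiv s (∏ p ∈ u, linFactor p.1 p.2 ^ a) =
      (a : ℂ) • ∑ p ∈ u, pderiv s (linFactor p.1 p.2) *
        (linFactor p.1 p.2 ^ (a - 1) * ∏ p' ∈ u.erase p, linFactor p'.1 p'.2 ^ a) := by
    intro u
    induction u using Finset.induction_on with
    | empty => simp
    | insert p u hp ih =>
      have h : ∀ x ∈ u, pderiv s (linFactor x.1 x.2) * (linFactor x.1 x.2 ^ (a - 1) *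
          ∏ p' ∈ (insert p u).erase x, linFactor p'.1 p'.2 ^ a) =
          linFactor p.1 p.2 ^ a * (pderiv s (linFactor x.1 x.2) * (linFactor x.1 x.2 ^ (a - 1) *
            ∏ p' ∈ u.erase x, linFactor p'.1 p'.2 ^ a)) := by
        intro x hx
        have hpx : p ≠ x := fun e => hp (e ▸ hx)
        rw [Finset.erase_insert_of_ne hpx,
          Finset.prod_insert (fun h => hp (Finset.mem_of_mem_erase h))]
        ring
      rw [Finset.prod_insert hp, Derivation.leibniz, ih, Finset.sum_insert hp,
        Finset.erase_insert hp, Finset.sum_congr rfl h, ← Finset.mul_sum, Derivation.leibniz_pow]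
      simp only [smul_eq_mul, smul_add, nsmul_eq_mul, smul_eq_C_mul, map_natCast]
      ring
  exact key Finset.univ

theorem pderiv_inr_kernelPoly (k : κ) (a : ℕ) :
    pderiv (Sum.inr k) (kernelPoly ι κ a) = (a : ℂ) • ∑ i, kernelQuot a k i := by
  have h : ∀ p : κ × ι, pderiv (Sum.inr k) (linFactor p.1 p.2) = if p.1 = k then 1 else 0 := by
    intro p
    rw [linFactor, map_sub, pderiv_X_of_ne Sum.inl_ne_inr, sub_zero]
    split_ifs with hp
    · rw [hp, pderiv_X_self]
    · rw [pderiv_X_of_ne (Sum.inr_injective.ne hp)]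
  simp only [pderiv_kernelPoly, h, ite_mul, one_mul, zero_mul, Fintype.sum_prod_type]
  congr 1
  rw [Finset.sum_eq_single k] <;> simp +contextual

theorem pderiv_inl_kernelPoly (i : ι) (a : ℕ) :
    pderiv (Sum.inl i) (kernelPoly ι κ a) = -((a : ℂ) • ∑ k : κ, kernelQuot a k i) := by
  have h : ∀ p : κ × ι, pderiv (Sum.inl i) (linFactor p.1 p.2) = if p.2 = i then -1 else 0 := by
    intro p
    rw [linFactor, map_sub, pderiv_X_of_ne Sum.inr_ne_inl, zero_sub]
    split_ifs with hp
    · rw [hp, pderiv_X_self]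
    · rw [pderiv_X_of_ne (Sum.inl_injective.ne hp), neg_zero]
  simp only [pderiv_kernelPoly, h, ite_mul, neg_mul, one_mul, zero_mul, Fintype.sum_prod_type]
  simp [Finset.sum_neg_distrib]

theorem divDiff_inr_kernelPoly (k l : κ) (a : ℕ) :
    divDiff (Sum.inr k) (Sum.inr l) (kernelPoly ι κ a) = 0 :=
  divDiff_eq_zero (by rw [swapVar_inr_eq]; exact rename_sumCongr_kernelPoly (Equiv.refl ι) _ a)

theorem divDiff_inl_kernelPoly (i j : ι) (a : ℕ) :
    divDiff (Sum.inl i) (Sum.inl j) (kernelPoly ι κ a) = 0 :=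
  divDiff_eq_zero (by rw [swapVar_inl_eq]; exact rename_sumCongr_kernelPoly _ (Equiv.refl κ) a)

theorem linFactor_mul_divDiff_inr {a : ℕ} (ha : a ≠ 0) {k l : κ} (h : k ≠ l) (i : ι) :
    linFactor k i * divDiff (Sum.inr k) (Sum.inr l) (kernelQuot a k i) = -kernelQuot a l i := by
  refine mul_left_cancel₀ (X_sub_X_ne_zero (Sum.inr_injective.ne h)) ?_
  rw [mul_left_comm, X_sub_X_mul_divDiff, swapVar_inr_eq, mul_sub, linFactor_mul_kernelQuot ha,
    show rename _ (kernelQuot a k i) = kernelQuot a l i by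
      simpa using rename_sumCongr_kernelQuot (Equiv.refl ι) (Equiv.swap k l) ha k i,
    ← linFactor_mul_kernelQuot ha l i, linFactor, linFactor]
  ring

theorem linFactor_mul_divDiff_inl {a : ℕ} (ha : a ≠ 0) {i j : ι} (h : i ≠ j) (k : κ) :
    linFactor k i * divDiff (Sum.inl i) (Sum.inl j) (kernelQuot a k i) = kernelQuot a k j := by
  refine mul_left_cancel₀ (X_sub_X_ne_zero (Sum.inl_injective.ne h)) ?_
  rw [mul_left_comm, X_sub_X_mul_divDiff, swapVar_inl_eq, mul_sub, linFactor_mul_kernelQuot ha,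
    show rename _ (kernelQuot a k i) = kernelQuot a k j by
      simpa using rename_sumCongr_kernelQuot (Equiv.swap i j) (Equiv.refl κ) ha k i,
    ← linFactor_mul_kernelQuot ha k j, linFactor, linFactor]
  ring

theorem dunkl_inr_kernelPoly (b : ℂ) (k : κ) (a : ℕ) :
    dunkl b Function.Embedding.inr k (kernelPoly ι κ a) = (a : ℂ) • ∑ i, kernelQuot a k i := by
  have h : ∑ l, divDiff (Function.Embedding.inr k) (Function.Embedding.inr l)
      (kernelPoly ι κ a) = 0 :=
    Finset.sum_eq_zero fun l _ => divDiff_inr_kernelPoly k l a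
  rw [dunkl_apply, h, smul_zero, sub_zero]
  exact pderiv_inr_kernelPoly k a

theorem dunkl_inl_kernelPoly (b : ℂ) (i : ι) (a : ℕ) :
    dunkl b Function.Embedding.inl i (kernelPoly ι κ a) =
      -((a : ℂ) • ∑ k : κ, kernelQuot a k i) := by
  have h : ∑ l, divDiff (Function.Embedding.inl i) (Function.Embedding.inl l)
      (kernelPoly ι κ a) = 0 :=
    Finset.sum_eq_zero fun l _ => divDiff_inl_kernelPoly i l a
  rw [dunkl_apply, h, smul_zero, sub_zero]
  exact pderiv_inl_kernelPoly i a

theorem linFactor_mul_pderiv_inr {a : ℕ} (ha : a ≠ 0) (k : κ) (i : ι) :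
    linFactor k i * pderiv (Sum.inr k) (kernelQuot a k i) =
      (a : ℂ) • ∑ j, kernelQuot a k j - kernelQuot a k i := by
  have := congrArg (pderiv (Sum.inr k)) (linFactor_mul_kernelQuot ha k i)
  rw [pderiv_inr_kernelPoly, Derivation.leibniz, linFactor, map_sub, pderiv_X_self,
    pderiv_X_of_ne Sum.inl_ne_inr] at this
  rw [← this, linFactor]
  simp

theorem linFactor_mul_pderiv_inl {a : ℕ} (ha : a ≠ 0) (k : κ) (i : ι) :
    linFactor k i * pderiv (Sum.inl i) (kernelQuot a k i) =
      kernelQuot a k i - (a : ℂ) • ∑ l, kernelQuot a l i := by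
  have := congrArg (pderiv (Sum.inl i)) (linFactor_mul_kernelQuot ha k i)
  rw [pderiv_inl_kernelPoly, Derivation.leibniz, linFactor, map_sub, pderiv_X_self,
    pderiv_X_of_ne Sum.inr_ne_inl, smul_eq_mul, smul_eq_mul] at this
  rw [linFactor]
  linear_combination this

theorem sum_eq_add_of_forall_ne {ι M : Type*} [Fintype ι] [DecidableEq ι] [AddCommGroup M]
    {f g : ι → M} (i : ι) (hi : f i = 0) (h : ∀ j, j ≠ i → f j = g j) :
    ∑ j, f j = ∑ j, g j - g i := by
  rw [eq_sub_iff_add_eq, ← Finset.add_sum_erase _ f (Finset.mem_univ i),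
    ← Finset.add_sum_erase _ g (Finset.mem_univ i), hi, zero_add, add_comm]
  congr 1
  exact Finset.sum_congr rfl fun j hj => h j (Finset.ne_of_mem_erase hj)

theorem dunkl_inr_kernelQuot {a : ℕ} (ha : a ≠ 0) (k : κ) (i : ι) :
    dunkl a Function.Embedding.inr k (kernelQuot a k i) =
      -dunkl a Function.Embedding.inl i (kernelQuot a k i) := by
  refine mul_left_cancel₀ (linFactor_ne_zero k i) ?_
  have h1 : linFactor k i * ∑ l, divDiff (Sum.inr k) (Sum.inr l) (kernelQuot a k i) =
      -(∑ l, kernelQuot a l i - kernelQuot a k i) := by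
    rw [Finset.mul_sum, sum_eq_add_of_forall_ne (g := fun l => -kernelQuot a l i) k]
    · rw [Finset.sum_neg_distrib]; ring
    · rw [divDiff_self, mul_zero]
    · intro l hl
      exact linFactor_mul_divDiff_inr ha (Ne.symm hl) i
  have h2 : linFactor k i * ∑ j, divDiff (Sum.inl i) (Sum.inl j) (kernelQuot a k i) =
      ∑ j, kernelQuot a k j - kernelQuot a k i := by
    rw [Finset.mul_sum, sum_eq_add_of_forall_ne (g := fun j => kernelQuot a k j) i]
    · rw [divDiff_self, mul_zero]
    · intro l hl
      exact linFactor_mul_divDiff_inl ha (Ne.symm hl) k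
  have h3 := linFactor_mul_pderiv_inr ha k i
  have h4 := linFactor_mul_pderiv_inl ha k i
  simp only [smul_eq_C_mul] at h3 h4
  rw [dunkl_apply, dunkl_apply]
  simp only [smul_eq_C_mul, Function.Embedding.inr_apply, Function.Embedding.inl_apply]
  linear_combination h3 + h4 - C (a : ℂ) * h1 - C (a : ℂ) * h2

theorem dunklHom_psum (b : ℂ) {σ : Type*} [DecidableEq σ] (e : ι ↪ σ) (r : ℕ)
    (f : MvPolynomial σ ℂ) :
    dunklHom b e (psum ι ℂ r) f = ∑ i, (dunkl b e i ^ r) f := by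
  simp [psum, dunklHom_X, LinearMap.sum_apply]

theorem dunklHom_inr_psum_kernelPoly {a : ℕ} (ha : a ≠ 0) (r : ℕ) :
    dunklHom a Function.Embedding.inr (psum κ ℂ (r + 1)) (kernelPoly ι κ a) =
      (-1) ^ (r + 1) •
        dunklHom a Function.Embedding.inl (psum ι ℂ (r + 1)) (kernelPoly ι κ a) := by
  have key : ∀ (r : ℕ) (k : κ) (i : ι),
      (dunkl a Function.Embedding.inr k ^ r) (kernelQuot a k i) =
        (-1) ^ r • (dunkl a Function.Embedding.inl i ^ r) (kernelQuot a k i) := by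
    intro r k i
    induction r with
    | zero => simp
    | succ r ih =>
      have hc : Commute (dunkl (a : ℂ) Function.Embedding.inr k)
          (dunkl (a : ℂ) (Function.Embedding.inl : ι ↪ ι ⊕ κ) i) :=
        dunkl_commute_of_disjoint _ _ _ (fun _ _ => Sum.inr_ne_inl) _ _
      rw [pow_succ', Module.End.mul_apply, ih, map_zsmul, ← Module.End.mul_apply,
        (hc.pow_right r).eq, Module.End.mul_apply, dunkl_inr_kernelQuot ha, map_neg,
        ← Module.End.mul_apply, ← pow_succ, pow_succ (-1 : ℤ)]
      simp
  rw [dunklHom_psum, dunklHom_psum]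
  simp only [pow_succ _ r, Module.End.mul_apply, dunkl_inr_kernelPoly, dunkl_inl_kernelPoly,
    map_smul, map_sum, map_neg, key]
  rw [Finset.sum_neg_distrib, ← Finset.smul_sum, ← Finset.smul_sum, Finset.sum_comm]
  simp only [mul_neg_one, neg_smul, smul_neg, neg_neg, ← Finset.smul_sum]
  rw [smul_comm]

end Kernel

section TestFunctions

set_option linter.unusedSectionVars false

variable {ι κ : Type*} [Fintype ι] [DecidableEq ι] [Fintype κ] [DecidableEq κ]

theorem swapVar_psum (i j : ι) (n : ℕ) : swapVar i j (psum ι ℂ n) = psum ι ℂ n :=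
  rename_psum ι ℂ n _

theorem pderiv_psum (i : ι) (n : ℕ) :
    pderiv i (psum ι ℂ (n + 1)) = C ((n : ℂ) + 1) * X i ^ n := by
  rw [psum, map_sum, Finset.sum_eq_single i]
  · rw [Derivation.leibniz_pow, pderiv_X_self]
    simp
  · intro j _ hj
    rw [Derivation.leibniz_pow, pderiv_X_of_ne hj]
    simp
  · simp

theorem dunkl_mul_of_swapVar_eq {σ : Type*} [DecidableEq σ] (b : ℂ) (e : ι ↪ σ) (i : ι)
    {P : MvPolynomial σ ℂ} (hP : ∀ j, swapVar (e i) (e j) P = P) (f : MvPolynomial σ ℂ) :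
    dunkl b e i (P * f) = P * dunkl b e i f + pderiv (e i) P * f := by
  simp only [dunkl_apply, divDiff_mul_of_swapVar_eq (hP _), ← Finset.mul_sum, Derivation.leibniz,
    smul_eq_mul, mul_sub, mul_smul_comm]
  ring

theorem dunkl_inl_mul_rename_inr (b : ℂ) (i : ι) (f : MvPolynomial (ι ⊕ κ) ℂ)
    (g : MvPolynomial κ ℂ) :
    dunkl b Function.Embedding.inl i (rename Sum.inr g * f) =
      rename Sum.inr g * dunkl b Function.Embedding.inl i f := by
  rw [dunkl_mul_of_swapVar_eq]
  · simp [pderiv_inl_rename_inr]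
  · intro j
    exact swapVar_inl_rename_inr i j g

theorem dunkl_inl_rename_inl (b : ℂ) (i : ι) (f : MvPolynomial ι ℂ) :
    dunkl b Function.Embedding.inl i (rename Sum.inl f : MvPolynomial (ι ⊕ κ) ℂ) =
      rename Sum.inl (dunkl b (Function.Embedding.refl ι) i f) := by
  refine (map_dunkl (L := (rename Sum.inl).toLinearMap) (e := Function.Embedding.refl ι)
    (e' := Function.Embedding.inl) (fun i f => ?_) (fun i j f => ?_) (fun i f => ?_) b i f).symm
  · simp
  · exact (swapVar_inl_rename_inl i j f).symm
  · exact (pderiv_rename Sum.inl_injective i f).symm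

theorem linearMap_sum_unit_ext {M : Type*} [AddCommGroup M] [Module ℂ M]
    {L L' : MvPolynomial (ι ⊕ Unit) ℂ →ₗ[ℂ] M}
    (h : ∀ f n, L (rename Sum.inl f * X (Sum.inr ()) ^ n) =
      L' (rename Sum.inl f * X (Sum.inr ()) ^ n)) : L = L' := by
  refine linearMap_sum_ext fun f g => ?_
  induction g using MvPolynomial.induction_on' with
  | monomial s c =>
    have : (monomial s c : MvPolynomial Unit ℂ) = c • X () ^ (s ()) := by
      rw [X_pow_eq_monomial, smul_monomial, smul_eq_mul, mul_one]
      congr 1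
      exact congrArg _ (Finsupp.unique_single s)
    rw [this, map_smul, map_pow, rename_X, mul_smul_comm, LinearMap.map_smul, LinearMap.map_smul,
      h]
  | add p q hp hq => simp only [map_add, mul_add, hp, hq]

/-- The operator `f(z) ↦ ∑_l ∫_0^{y_l} z^k f(z) dz`. -/
noncomputable def powerIntegral (k : ℕ) : MvPolynomial (ι ⊕ Unit) ℂ →ₗ[ℂ] MvPolynomial ι ℂ :=
  contractWith ((basisMonomials Unit ℂ).constr ℂ fun m =>
    C ((m () + k + 1 : ℂ)⁻¹) * psum ι ℂ (m () + k + 1))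

theorem powerIntegral_mul_pow (k n : ℕ) (f : MvPolynomial ι ℂ) :
    powerIntegral k (rename Sum.inl f * X (Sum.inr ()) ^ n) =
      C ((n + k + 1 : ℂ)⁻¹) * psum ι ℂ (n + k + 1) * f := by
  have h := (basisMonomials Unit ℂ).constr_basis ℂ (fun m =>
    C ((m () + k + 1 : ℂ)⁻¹) * psum ι ℂ (m () + k + 1)) (Finsupp.single () n)
  rw [coe_basisMonomials] at h
  rw [← rename_X, ← map_pow, powerIntegral, contractWith_mul, X_pow_eq_monomial, h]
  simp

/-- Substitute a polynomial for the additional variable. -/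
noncomputable def substLast (p : MvPolynomial ι ℂ) :
    MvPolynomial (ι ⊕ Unit) ℂ →ₐ[ℂ] MvPolynomial ι ℂ :=
  aeval (Sum.elim X fun _ => p)

theorem substLast_rename_inl (p f : MvPolynomial ι ℂ) : substLast p (rename Sum.inl f) = f := by
  rw [substLast, aeval_rename, Sum.elim_comp_inl, aeval_X_left_apply]

theorem substLast_X_inr (p : MvPolynomial ι ℂ) : substLast p (X (Sum.inr ())) = p := by
  simp [substLast]

theorem substLast_mul_pow (p f : MvPolynomial ι ℂ) (n : ℕ) :
    substLast p (rename Sum.inl f * X (Sum.inr ()) ^ n) = f * p ^ n := by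
  rw [map_mul, map_pow, substLast_rename_inl, substLast_X_inr]

theorem dunkl_powerIntegral (b : ℂ) (k : ℕ) (i : ι) (f : MvPolynomial (ι ⊕ Unit) ℂ) :
    dunkl b (Function.Embedding.refl ι) i (powerIntegral k f) =
      powerIntegral k (dunkl b Function.Embedding.inl i f) + X i ^ k * substLast (X i) f := by
  have : (dunkl b (Function.Embedding.refl ι) i).comp (powerIntegral k) =
      (powerIntegral k).comp (dunkl b Function.Embedding.inl i) +
        (LinearMap.mulLeft ℂ (X i ^ k)).comp (substLast (X i)).toLinearMap := by
    refine linearMap_sum_unit_ext fun f n => ?_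
    simp only [LinearMap.comp_apply, LinearMap.add_apply, LinearMap.mulLeft_apply,
      AlgHom.toLinearMap_apply]
    have h0 : (n + k + 1 : ℂ) ≠ 0 := by exact_mod_cast Nat.succ_ne_zero (n + k)
    have h1 := dunkl_inl_mul_rename_inr b i (rename Sum.inl f) (X () ^ n : MvPolynomial Unit ℂ)
    rw [map_pow, rename_X, dunkl_inl_rename_inl, mul_comm _ (rename Sum.inl f), mul_comm (_ ^ _)]
      at h1
    rw [h1, powerIntegral_mul_pow, powerIntegral_mul_pow, substLast_mul_pow,
      dunkl_mul_of_swapVar_eq _ _ _ (by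
        intro j
        rw [map_mul, swapVar_psum, swapVar, rename_C]), Function.Embedding.refl_apply,
        ← smul_eq_C_mul, Derivation.map_smul, pderiv_psum, ← smul_eq_C_mul,
        smul_smul]
    push_cast
    rw [inv_mul_cancel₀ h0, one_smul, smul_eq_C_mul]
    ring
  exact LinearMap.congr_fun this f

theorem pderiv_inr_rename_inl (f : MvPolynomial ι ℂ) :
    pderiv (Sum.inr ()) (rename Sum.inl f : MvPolynomial (ι ⊕ Unit) ℂ) = 0 := by
  induction f using MvPolynomial.induction_on with
  | C c => simp
  | add p q hp hq => simp only [map_add, hp, hq, add_zero]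
  | mul_X p l hp =>
    rw [map_mul, Derivation.leibniz, hp, rename_X, pderiv_X_of_ne Sum.inl_ne_inr]
    simp

theorem pderiv_inr_mul_pow (f : MvPolynomial ι ℂ) (n : ℕ) :
    pderiv (Sum.inr ()) (rename Sum.inl f * X (Sum.inr ()) ^ (n + 1) : MvPolynomial (ι ⊕ Unit) ℂ) =
      ((n : ℂ) + 1) • (rename Sum.inl f * X (Sum.inr ()) ^ n) := by
  rw [Derivation.leibniz, pderiv_inr_rename_inl, Derivation.leibniz_pow, pderiv_X_self]
  simp only [smul_eq_mul, smul_eq_C_mul, map_add, map_natCast, map_one, nsmul_eq_mul]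
  push_cast
  simp
  ring

theorem powerIntegral_pderiv_zero (f : MvPolynomial (ι ⊕ Unit) ℂ) :
    powerIntegral 0 (pderiv (Sum.inr ()) f) =
      ∑ l, substLast (X l) f - Fintype.card ι • substLast 0 f := by
  have : (powerIntegral 0).comp ((pderiv (Sum.inr ()) : Derivation ℂ (MvPolynomial (ι ⊕ Unit) ℂ) (MvPolynomial (ι ⊕ Unit) ℂ)) :
        MvPolynomial (ι ⊕ Unit) ℂ →ₗ[ℂ] MvPolynomial (ι ⊕ Unit) ℂ) =
      ∑ l : ι, (substLast (X l)).toLinearMap - Fintype.card ι • (substLast 0).toLinearMap := by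
    refine linearMap_sum_unit_ext fun f n => ?_
    simp only [LinearMap.comp_apply, Derivation.coeFn_coe, LinearMap.sub_apply, LinearMap.smul_apply, LinearMap.sum_apply,
      AlgHom.toLinearMap_apply, substLast_mul_pow]
    rcases n with _ | n
    · simp [pderiv_inr_rename_inl]
    · have h0 : (n + 1 : ℂ) ≠ 0 := by exact_mod_cast Nat.succ_ne_zero n
      rw [pderiv_inr_mul_pow, map_smul, powerIntegral_mul_pow, zero_pow (Nat.succ_ne_zero n),
        mul_zero, smul_zero, sub_zero, smul_eq_C_mul, ← mul_assoc, ← mul_assoc, ← map_mul]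
      push_cast
      rw [add_zero, mul_inv_cancel₀ h0, C_1, one_mul, psum, Finset.sum_mul]
      exact Finset.sum_congr rfl fun l _ => mul_comm _ _
  have := LinearMap.congr_fun this f
  simpa only [LinearMap.comp_apply, Derivation.coeFn_coe, LinearMap.sub_apply,
    LinearMap.smul_apply, LinearMap.sum_apply, AlgHom.toLinearMap_apply,
    LinearMap.mulLeft_apply] using this

theorem powerIntegral_pderiv_succ (k : ℕ) (f : MvPolynomial (ι ⊕ Unit) ℂ) :
    powerIntegral (k + 1) (pderiv (Sum.inr ()) f) =
      ∑ l, X l ^ (k + 1) * substLast (X l) f - (k + 1 : ℂ) • powerIntegral k f := by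
  have : (powerIntegral (k + 1)).comp ((pderiv (Sum.inr ()) : Derivation ℂ (MvPolynomial (ι ⊕ Unit) ℂ) (MvPolynomial (ι ⊕ Unit) ℂ)) :
        MvPolynomial (ι ⊕ Unit) ℂ →ₗ[ℂ] MvPolynomial (ι ⊕ Unit) ℂ) =
      ∑ l : ι, (LinearMap.mulLeft ℂ (X l ^ (k + 1))).comp (substLast (X l)).toLinearMap -
        (k + 1 : ℂ) • powerIntegral k := by
    refine linearMap_sum_unit_ext fun f n => ?_
    simp only [LinearMap.comp_apply, Derivation.coeFn_coe, LinearMap.sub_apply, LinearMap.smul_apply, LinearMap.sum_apply,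
      AlgHom.toLinearMap_apply, substLast_mul_pow, LinearMap.mulLeft_apply,
      powerIntegral_mul_pow]
    have h1 : ∑ l : ι, X l ^ (k + 1) * (f * X l ^ n) = psum ι ℂ (n + k + 1) * f := by
      rw [psum, Finset.sum_mul]
      refine Finset.sum_congr rfl fun l _ => ?_
      ring
    rw [h1]
    have h2 : ∀ c : ℂ, C c * psum ι ℂ (n + k + 1) * f = c • (psum ι ℂ (n + k + 1) * f) := by
      intro c; rw [smul_eq_C_mul, mul_assoc]
    rw [h2, smul_smul]
    rcases n with _ | n
    · rw [pow_zero, mul_one, pderiv_inr_rename_inl, map_zero]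
      have h0 : (k + 1 : ℂ) ≠ 0 := by exact_mod_cast Nat.succ_ne_zero k
      push_cast
      rw [zero_add (k : ℂ), mul_inv_cancel₀ h0, one_smul, sub_self]
    · have h0 : (n + 1 + k + 1 : ℂ) ≠ 0 := by exact_mod_cast Nat.succ_ne_zero (n + 1 + k)
      rw [pderiv_inr_mul_pow, map_smul, powerIntegral_mul_pow,
        show n + (k + 1) + 1 = n + 1 + k + 1 by ring, h2, smul_smul]
      nth_rewrite 2 [← one_smul ℂ (psum ι ℂ (n + 1 + k + 1) * f)]
      rw [← sub_smul]
      congr 1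
      push_cast
      have h3 : (n + (k + 1) + 1 : ℂ) ≠ 0 := by convert h0 using 1; ring
      field_simp
      ring
  have := LinearMap.congr_fun this f
  simpa only [LinearMap.comp_apply, Derivation.coeFn_coe, LinearMap.sub_apply,
    LinearMap.smul_apply, LinearMap.sum_apply, AlgHom.toLinearMap_apply,
    LinearMap.mulLeft_apply] using this

end TestFunctions

section Nonsingular

set_option linter.unusedSectionVars false

variable {ι κ : Type*} [Fintype ι] [DecidableEq ι] [Fintype κ] [DecidableEq κ]

/-- View a polynomial as a univariate polynomial in the additional variable. -/
noncomputable def toPolynomialLast :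
    MvPolynomial (ι ⊕ Unit) ℂ →ₐ[ℂ] Polynomial (MvPolynomial ι ℂ) :=
  aeval (Sum.elim (fun i => Polynomial.C (X i)) fun _ => Polynomial.X)

theorem toPolynomialLast_pderiv (f : MvPolynomial (ι ⊕ Unit) ℂ) :
    toPolynomialLast (pderiv (Sum.inr ()) f) = Polynomial.derivative (toPolynomialLast f) := by
  induction f using MvPolynomial.induction_on with
  | C c =>
    rw [pderiv_C, map_zero, ← algebraMap_eq, AlgHom.commutes, IsScalarTower.algebraMap_apply ℂ
      (MvPolynomial ι ℂ), Polynomial.algebraMap_eq, Polynomial.derivative_C]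
  | add p q hp hq => simp only [map_add, hp, hq]
  | mul_X p l hp =>
    have h : toPolynomialLast (pderiv (Sum.inr ()) (X l : MvPolynomial (ι ⊕ Unit) ℂ)) =
        Polynomial.derivative (toPolynomialLast (X l)) := by
      rcases l with l | l
      · rw [pderiv_X_of_ne Sum.inl_ne_inr]; simp [toPolynomialLast]
      · rw [pderiv_X_self]; simp [toPolynomialLast]
    rw [Derivation.leibniz, map_mul, Polynomial.derivative_mul, map_add, smul_eq_mul, smul_eq_mul,
      map_mul, map_mul, hp, h]
    ring

theorem coeff_zero_toPolynomialLast (f : MvPolynomial (ι ⊕ Unit) ℂ) :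
    (toPolynomialLast f).coeff 0 = substLast 0 f := by
  induction f using MvPolynomial.induction_on with
  | C c =>
    rw [← algebraMap_eq, AlgHom.commutes, AlgHom.commutes, IsScalarTower.algebraMap_apply ℂ
      (MvPolynomial ι ℂ), Polynomial.algebraMap_eq, Polynomial.coeff_C_zero]
  | add p q hp hq => simp only [map_add, Polynomial.coeff_add, hp, hq]
  | mul_X p l hp =>
    rw [map_mul, map_mul, Polynomial.mul_coeff_zero, hp]
    rcases l with l | l <;> simp [toPolynomialLast, substLast]

theorem monic_toPolynomialLast_kernelQuot (a : ℕ) (i : ι) :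
    (toPolynomialLast (kernelQuot a () i)).Monic := by
  have h : ∀ p : Unit × ι, (toPolynomialLast (linFactor p.1 p.2)).Monic := by
    intro p
    have : toPolynomialLast (linFactor p.1 p.2) = Polynomial.X - Polynomial.C (X p.2) := by
      simp [toPolynomialLast, linFactor]
    rw [this]
    exact Polynomial.monic_X_sub_C _
  rw [kernelQuot, map_mul, map_prod, map_pow]
  refine ((h ((), i)).pow _).mul (Polynomial.monic_prod_of_monic _ _ fun p _ => ?_)
  rw [map_pow]
  exact (h p).pow _

theorem substLast_zero_eq_contract (f : MvPolynomial (ι ⊕ Unit) ℂ) :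
    substLast 0 f = contract (aeval fun _ => (0 : ℂ)).toLinearMap f := by
  have : (substLast 0).toLinearMap =
      contract (ι := ι) (κ := Unit) (aeval fun _ => (0 : ℂ)).toLinearMap := by
    refine linearMap_sum_ext fun f g => ?_
    have h : substLast (ι := ι) 0 (rename Sum.inr g) =
        algebraMap ℂ _ (aeval (fun _ => (0 : ℂ)) g) := by
      rw [substLast, aeval_rename, Sum.elim_comp_inr]
      induction g using MvPolynomial.induction_on with
      | C c => simp
      | add p q hp hq => simp only [map_add, hp, hq]
      | mul_X p l hp => simp
    rw [contract_mul, AlgHom.toLinearMap_apply, AlgHom.toLinearMap_apply, map_mul,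
      substLast_rename_inl, h, Algebra.smul_def, mul_comm]
  exact LinearMap.congr_fun this f

theorem dunkl_substLast_zero (b : ℂ) (i : ι) (f : MvPolynomial (ι ⊕ Unit) ℂ) :
    substLast 0 (dunkl b Function.Embedding.inl i f) =
      dunkl b (Function.Embedding.refl ι) i (substLast 0 f) := by
  rw [substLast_zero_eq_contract, substLast_zero_eq_contract, contract_dunkl]

theorem dunkl_inl_kernelQuot_unit {a : ℕ} (ha : a ≠ 0) (i : ι) :
    dunkl a Function.Embedding.inl i (kernelQuot a () i) =
      -pderiv (Sum.inr ()) (kernelQuot a () i) := by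
  have h := dunkl_inr_kernelQuot ha () i
  rw [dunkl_apply] at h
  simp only [Finset.univ_unique, PUnit.default_eq_unit, Finset.sum_singleton, divDiff_self,
    smul_zero, sub_zero, Function.Embedding.inr_apply] at h
  rw [h, neg_neg]

theorem dunkl_inl_kernelQuot_unit_of_ne {a : ℕ} (ha : a ≠ 0) {i j : ι} (h : j ≠ i) :
    dunkl a Function.Embedding.inl j (kernelQuot a () i) = 0 := by
  refine (mul_eq_zero.mp ?_).resolve_left (linFactor_ne_zero () i)
  have h1 : linFactor () i * pderiv (Sum.inl j) (kernelQuot a () i) =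
      -((a : ℂ) • kernelQuot a () j) := by
    have := congrArg (pderiv (Sum.inl j)) (linFactor_mul_kernelQuot ha () i)
    rw [pderiv_inl_kernelPoly, Derivation.leibniz, linFactor, map_sub,
      pderiv_X_of_ne Sum.inr_ne_inl, pderiv_X_of_ne (Sum.inl_injective.ne (Ne.symm h))] at this
    simpa [linFactor] using this
  have h2 : linFactor () i * ∑ l, divDiff (Sum.inl j) (Sum.inl l) (kernelQuot a () i) =
      -kernelQuot a () j := by
    rw [Finset.mul_sum, Finset.sum_eq_single i]
    · rw [divDiff_comm, mul_neg, linFactor_mul_divDiff_inl ha (Ne.symm h)]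
    · intro l _ hl
      rw [divDiff_eq_zero, mul_zero]
      rw [swapVar_inl_eq]
      have := rename_sumCongr_kernelQuot (Equiv.swap j l) (Equiv.refl Unit) ha () i
      rwa [Equiv.refl_apply, Equiv.swap_apply_of_ne_of_ne (Ne.symm h) (Ne.symm hl)] at this
    · simp
  rw [dunkl_apply, mul_sub, mul_smul_comm]
  simp only [Function.Embedding.inl_apply]
  rw [h1, h2, smul_neg, sub_self]

theorem substLast_X_kernelQuot_of_ne {a : ℕ} (ha : a ≠ 0) {i j : ι} (h : j ≠ i) :
    substLast (X j) (kernelQuot a () i) = 0 := by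
  rw [kernelQuot, map_mul, map_prod, Finset.prod_eq_zero (i := ((), j)), mul_zero]
  · simpa using h
  · simp [linFactor, substLast, ha]

theorem dunkl_powerIntegral_kernelQuot_of_ne {a : ℕ} (ha : a ≠ 0) {i j : ι} (h : j ≠ i) (k : ℕ) :
    dunkl a (Function.Embedding.refl ι) j (powerIntegral k (kernelQuot a () i)) = 0 := by
  rw [dunkl_powerIntegral, dunkl_inl_kernelQuot_unit_of_ne ha h, substLast_X_kernelQuot_of_ne ha h]
  simp

theorem dunkl_powerIntegral_zero_kernelQuot {a : ℕ} (ha : a ≠ 0) (i : ι) :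
    dunkl a (Function.Embedding.refl ι) i (powerIntegral 0 (kernelQuot a () i)) =
      Fintype.card ι • substLast 0 (kernelQuot a () i) := by
  rw [dunkl_powerIntegral, dunkl_inl_kernelQuot_unit ha, map_neg, powerIntegral_pderiv_zero,
    Finset.sum_eq_single i (fun j _ h => substLast_X_kernelQuot_of_ne ha h) (by simp)]
  ring

theorem dunkl_powerIntegral_succ_kernelQuot {a : ℕ} (ha : a ≠ 0) (i : ι) (k : ℕ) :
    dunkl a (Function.Embedding.refl ι) i (powerIntegral (k + 1) (kernelQuot a () i)) =
      (k + 1 : ℂ) • powerIntegral k (kernelQuot a () i) := by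
  rw [dunkl_powerIntegral, dunkl_inl_kernelQuot_unit ha, map_neg, powerIntegral_pderiv_succ,
    Finset.sum_eq_single i (fun j _ h => by rw [substLast_X_kernelQuot_of_ne ha h, mul_zero])
      (by simp)]
  ring

theorem dunkl_pow_powerIntegral_kernelQuot {a : ℕ} (ha : a ≠ 0) (i : ι) (k : ℕ) :
    ∃ c : ℂ, c ≠ 0 ∧ (dunkl a (Function.Embedding.refl ι) i ^ (k + 1))
      (powerIntegral k (kernelQuot a () i)) = c • substLast 0 (kernelQuot a () i) := by
  induction k with
  | zero =>
    refine ⟨Fintype.card ι, ?_, ?_⟩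
    · have : Nonempty ι := ⟨i⟩
      exact_mod_cast Fintype.card_ne_zero
    · rw [zero_add, pow_one, dunkl_powerIntegral_zero_kernelQuot ha, Nat.cast_smul_eq_nsmul]
  | succ k ih =>
    obtain ⟨c, hc, h⟩ := ih
    refine ⟨(k + 1) * c, mul_ne_zero (by exact_mod_cast Nat.succ_ne_zero k) hc, ?_⟩
    rw [pow_succ, Module.End.mul_apply, dunkl_powerIntegral_succ_kernelQuot ha, map_smul, h,
      smul_smul]

theorem dunkl_pow_substLast_kernelQuot {a : ℕ} (ha : a ≠ 0) (i : ι) :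
    ∃ (D : ℕ) (c : ℂ), c ≠ 0 ∧ (dunkl a (Function.Embedding.refl ι) i ^ D)
      (substLast 0 (kernelQuot a () i)) = C c := by
  set D : Module.End ℂ (MvPolynomial (ι ⊕ Unit) ℂ) := dunkl a Function.Embedding.inr () with hD
  set T : Module.End ℂ (MvPolynomial (ι ⊕ Unit) ℂ) := dunkl a Function.Embedding.inl i with hT
  set W := kernelQuot (κ := Unit) a () i with hW
  have hc : Commute T D := dunkl_commute_of_disjoint (a : ℂ) Function.Embedding.inl
    Function.Embedding.inr (fun _ _ => Sum.inl_ne_inr) i ()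
  have h : ∀ r : ℕ, (T ^ r) W = (-1 : ℂ) ^ r • (D ^ r) W := by
    intro r
    induction r with
    | zero => simp
    | succ r ih =>
      have h1 : D W = -T W := dunkl_inr_kernelQuot ha () i
      rw [pow_succ, Module.End.mul_apply, ← neg_neg (T W), ← h1, map_neg,
        ← Module.End.mul_apply, (hc.pow_left r).eq, Module.End.mul_apply, ih, map_smul,
        ← Module.End.mul_apply, ← pow_succ', pow_succ (-1 : ℂ), mul_neg_one, neg_smul]
  have hd : ∀ f, toPolynomialLast (D f) = Polynomial.derivative (toPolynomialLast f) := by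
    intro f
    rw [← toPolynomialLast_pderiv, hD, dunkl_apply]
    simp only [Finset.univ_unique, PUnit.default_eq_unit, Finset.sum_singleton, divDiff_self,
      smul_zero, sub_zero, Function.Embedding.inr_apply]
  have hd' : ∀ r : ℕ, toPolynomialLast ((D ^ r) W) =
      Polynomial.derivative^[r] (toPolynomialLast W) := by
    intro r
    induction r with
    | zero => rfl
    | succ r ih =>
      rw [pow_succ', Module.End.mul_apply, hd, ih, Function.iterate_succ_apply']
  have hs : ∀ r : ℕ, substLast 0 ((T ^ r) W) =
      (dunkl a (Function.Embedding.refl ι) i ^ r) (substLast 0 W) := by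
    intro r
    induction r with
    | zero => rfl
    | succ r ih =>
      rw [pow_succ', Module.End.mul_apply, dunkl_substLast_zero, ih, pow_succ',
        Module.End.mul_apply]
  set p := toPolynomialLast W with hp
  refine ⟨p.natDegree, (-1) ^ p.natDegree * (p.natDegree.factorial : ℂ),
    mul_ne_zero (pow_ne_zero _ (by norm_num)) (by exact_mod_cast Nat.factorial_ne_zero _), ?_⟩
  rw [← hs, h, map_smul, ← coeff_zero_toPolynomialLast, hd', Polynomial.coeff_iterate_derivative,
    zero_add, Nat.descFactorial_self, Polynomial.coeff_natDegree,
    (monic_toPolynomialLast_kernelQuot a i).leadingCoeff, smul_eq_C_mul, map_mul, nsmul_one,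
    map_natCast]

/-- For every variable and every exponent there is a polynomial detecting the pure power. -/
theorem exists_dunkl_pow_eq_C {a : ℕ} (ha : a ≠ 0) (i : ι) (s : ℕ) :
    ∃ G : MvPolynomial ι ℂ, (∀ j, j ≠ i → dunkl a (Function.Embedding.refl ι) j G = 0) ∧
      ∃ c : ℂ, c ≠ 0 ∧ (dunkl a (Function.Embedding.refl ι) i ^ s) G = C c := by
  obtain ⟨D, c, hc, h⟩ := dunkl_pow_substLast_kernelQuot ha i
  obtain ⟨c', hc', h'⟩ := dunkl_pow_powerIntegral_kernelQuot ha i s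
  refine ⟨(dunkl a (Function.Embedding.refl ι) i ^ (D + 1))
    (powerIntegral s (kernelQuot a () i)), fun j hj => ?_, c' * c, mul_ne_zero hc' hc, ?_⟩
  · rw [← Module.End.mul_apply, ((dunkl_commute (a : ℂ) _ j i).pow_right _).eq,
      Module.End.mul_apply, dunkl_powerIntegral_kernelQuot_of_ne ha hj, map_zero]
  · rw [← Module.End.mul_apply, ← pow_add, show s + (D + 1) = D + (s + 1) by omega, pow_add,
      Module.End.mul_apply, h', map_smul, h, smul_eq_C_mul, map_mul]

end Nonsingular

section Singular

set_option linter.unusedSectionVars false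

variable {ι κ : Type*} [Fintype ι] [DecidableEq ι] [Fintype κ] [DecidableEq κ]

theorem contract_monomial (ξ : MvPolynomial κ ℂ →ₗ[ℂ] ℂ) (s : ι →₀ ℕ) (t : κ →₀ ℕ) :
    contract ξ (monomial (Finsupp.sumElim s t) 1) = ξ (monomial t 1) • monomial s 1 := by
  rw [← rename_inl_monomial_mul_rename_inr_monomial, contract_mul]

theorem coeff_contract_lcoeff (s : ι →₀ ℕ) (t : κ →₀ ℕ) (f : MvPolynomial (ι ⊕ κ) ℂ) :
    coeff s (contract (lcoeff ℂ t) f) = coeff (Finsupp.sumElim s t) f := by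
  have : (lcoeff ℂ s).comp (contract (lcoeff ℂ t)) =
      lcoeff (σ := ι ⊕ κ) ℂ (Finsupp.sumElim s t) := by
    refine (basisMonomials (ι ⊕ κ) ℂ).ext fun m => ?_
    have e : Finsupp.sumElim (Finsupp.sumFinsuppEquivProdFinsupp m).1
      (Finsupp.sumFinsuppEquivProdFinsupp m).2 = m :=
      Finsupp.sumFinsuppEquivProdFinsupp.symm_apply_apply m
    rw [coe_basisMonomials, LinearMap.comp_apply, ← e, contract_monomial]
    simp only [lcoeff_apply, coeff_smul, coeff_monomial, smul_eq_mul]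
    have h : ∀ (p p' : ι →₀ ℕ) (q q' : κ →₀ ℕ),
        Finsupp.sumElim p q = Finsupp.sumElim p' q' ↔ p = p' ∧ q = q' := by
      intro p p' q q'
      rw [← Prod.mk.injEq]
      exact Finsupp.sumFinsuppEquivProdFinsupp.symm.injective.eq_iff (a := (p, q)) (b := (p', q'))
    simp only [h]
    split_ifs <;> simp_all
  exact LinearMap.congr_fun this f

theorem dunklHom_apply_C (a : ℂ) (f : MvPolynomial ι ℂ) (c : ℂ) :
    dunklHom a (Function.Embedding.refl ι) f (C c) = C (constantCoeff f * c) := by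
  induction f using MvPolynomial.induction_on with
  | C r => rw [dunklHom_C, smul_eq_C_mul, ← C_mul, constantCoeff_C]
  | add p q hp hq => rw [map_add, LinearMap.add_apply, hp, hq, map_add, add_mul, C_add]
  | mul_X p l hp =>
    rw [map_mul, Module.End.mul_apply, dunklHom_X, dunkl_C, map_zero]
    simp

/-- A polynomial killed by all Dunkl operators is in the radical of the Dunkl pairing up to its
constant term. -/
theorem constantCoeff_dunklHom_of_singular {a : ℂ} {f : MvPolynomial ι ℂ}
    (h : ∀ i, dunkl a (Function.Embedding.refl ι) i f = 0) (h0 : constantCoeff f = 0)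
    (g : MvPolynomial ι ℂ) :
    constantCoeff (dunklHom a (Function.Embedding.refl ι) f g) = 0 := by
  induction g using MvPolynomial.induction_on with
  | C r => rw [dunklHom_apply_C, h0, zero_mul, C_0, map_zero]
  | add p q hp hq => rw [map_add, map_add, hp, hq, add_zero]
  | mul_X p l hp => rw [mul_comm, constantCoeff_dunklHom_X_mul, h, map_zero]; simp

theorem dunklHom_monomial_apply {a : ℂ} {i : ι} {G : MvPolynomial ι ℂ}
    (hG : ∀ j, j ≠ i → dunkl a (Function.Embedding.refl ι) j G = 0) (m : ι →₀ ℕ) (r : ℂ) :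
    dunklHom a (Function.Embedding.refl ι) (monomial m r) G =
      if m = Finsupp.single i (m i) then r • (dunkl a (Function.Embedding.refl ι) i ^ m i) G
      else 0 := by
  split_ifs with h
  · have : (monomial m r : MvPolynomial ι ℂ) = C r * X i ^ m i := by
      rw [X_pow_eq_monomial, C_mul_monomial, mul_one, ← h]
    rw [this, map_mul, Module.End.mul_apply, dunklHom_C, map_pow, dunklHom_X]
  · obtain ⟨j, hj, hj'⟩ : ∃ j, j ≠ i ∧ m j ≠ 0 := by
      by_contra! hc
      refine h (Finsupp.ext fun j => ?_)
      by_cases hj : j = i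
      · rw [hj, Finsupp.single_eq_same]
      · rw [hc j hj, Finsupp.single_eq_of_ne hj]
    obtain ⟨p, hp⟩ : X j ∣ (monomial m r : MvPolynomial ι ℂ) :=
      X_dvd_monomial.mpr (Or.inr hj')
    rw [hp, mul_comm, map_mul, Module.End.mul_apply, dunklHom_X, hG j hj, map_zero]

/-- A polynomial without constant term killed by all Dunkl operators has no pure power of a
variable among its monomials. -/
theorem coeff_single_of_singular {a : ℕ} (ha : a ≠ 0) {f : MvPolynomial ι ℂ}
    (h : ∀ i, dunkl a (Function.Embedding.refl ι) i f = 0) (h0 : constantCoeff f = 0) (i : ι)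
    (s : ℕ) : coeff (Finsupp.single i s) f = 0 := by
  induction s using Nat.strong_induction_on with
  | _ s ih =>
    obtain ⟨G, hG, c, hc, hs⟩ := exists_dunkl_pow_eq_C ha i s
    have key : dunklHom a (Function.Embedding.refl ι) f G =
        C (coeff (Finsupp.single i s) f * c) := by
      conv_lhs => rw [f.as_sum, map_sum, LinearMap.sum_apply]
      simp only [dunklHom_monomial_apply hG]
      have e : ∀ m ∈ f.support, (if m = Finsupp.single i (m i) then
          coeff m f • (dunkl a (Function.Embedding.refl ι) i ^ m i) G else 0) =
          if m = Finsupp.single i s then C (coeff (Finsupp.single i s) f * c) else 0 := by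
        intro m _
        by_cases hm : m = Finsupp.single i (m i)
        · rw [if_pos hm]
          rcases lt_trichotomy (m i) s with hlt | heq | hgt
          · rw [if_neg, hm, ih _ hlt, zero_smul]
            intro e
            rw [e, Finsupp.single_eq_same] at hlt
            exact hlt.false
          · rw [heq] at hm ⊢
            rw [if_pos hm, ← hm, hs, smul_eq_C_mul, map_mul]
          · rw [if_neg, show m i = (m i - s - 1) + 1 + s by omega, pow_add, pow_succ,
              Module.End.mul_apply, hs, Module.End.mul_apply, dunkl_C, map_zero, smul_zero]
            intro e
            rw [e, Finsupp.single_eq_same] at hgt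
            exact hgt.false
        · rw [if_neg hm, if_neg]
          intro e
          apply hm
          rw [e, Finsupp.single_eq_same]
      rw [Finset.sum_congr rfl e, Finset.sum_ite_eq' f.support]
      split_ifs with hmem
      · rfl
      · rw [notMem_support_iff.mp hmem, zero_mul, C_0]
    have := constantCoeff_dunklHom_of_singular h h0 G
    rw [key, constantCoeff_C] at this
    exact (mul_eq_zero.mp this).resolve_right hc

theorem degreeOf_divDiff_lt {σ : Type*} [DecidableEq σ] {i j : σ} {f : MvPolynomial σ ℂ}
    (h : degreeOf i f ≤ degreeOf j f) (hpos : 0 < degreeOf j f) :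
    degreeOf j (divDiff i j f) < degreeOf j f := by
  by_cases hij : i = j
  · subst hij; rwa [divDiff_self, degreeOf_zero]
  by_cases h0 : divDiff i j f = 0
  · rwa [h0, degreeOf_zero]
  have h1 := congrArg (degreeOf j) (X_sub_X_mul_divDiff i j f)
  rw [degreeOf_mul_eq (X_sub_X_ne_zero hij) h0] at h1
  have h2 : degreeOf j (f - swapVar i j f) ≤ degreeOf j f := by
    refine (degreeOf_sub_le _ _ _).trans (max_le le_rfl ?_)
    have := degreeOf_rename_of_injective (p := f) (Equiv.swap i j).injective i
    rw [Equiv.swap_apply_left] at this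
    rw [swapVar, this]
    exact h
  have h3 : 1 ≤ degreeOf j (X i - X j : MvPolynomial σ ℂ) := by
    have := monomial_le_degreeOf j (f := (X i - X j : MvPolynomial σ ℂ))
      (m := Finsupp.single j 1) (by
        rw [mem_support_iff, coeff_sub, coeff_X, coeff_X, if_neg]
        · simp
        · rw [Finsupp.single_left_inj one_ne_zero]; exact hij)
    simpa using this
  omega

theorem degreeOf_inr_eq_zero_of_singular {a : ℕ} (ha : a ≠ 0)
    (hι : ∀ f : MvPolynomial ι ℂ, (∀ i, dunkl a (Function.Embedding.refl ι) i f = 0) →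
      f = C (constantCoeff f))
    {f : MvPolynomial (ι ⊕ Unit) ℂ} (h : ∀ s, dunkl a (Function.Embedding.refl _) s f = 0)
    (h0 : constantCoeff f = 0)
    (hmax : ∀ i, degreeOf (Sum.inl i) f ≤ degreeOf (Sum.inr ()) f) :
    degreeOf (Sum.inr ()) f = 0 := by
  by_contra hpos
  set m := degreeOf (Sum.inr ()) f with hm
  set γ := contract (lcoeff ℂ (Finsupp.single () m)) f with hγ
  have hconst : γ = C (constantCoeff γ) := by
    refine hι γ fun i => ?_
    have h1 := h (Sum.inl i)
    rw [dunkl_apply] at h1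
    simp only [Fintype.sum_sum_type, Finset.univ_unique, PUnit.default_eq_unit,
      Finset.sum_singleton, Function.Embedding.refl_apply] at h1
    have h2 : dunkl a Function.Embedding.inl i f =
        (a : ℂ) • divDiff (Sum.inl i) (Sum.inr ()) f := by
      rw [dunkl_apply]
      simp only [Function.Embedding.inl_apply]
      rw [smul_add, ← sub_sub, sub_eq_zero] at h1
      exact h1
    rw [hγ, ← contract_dunkl, h2, map_smul]
    have h3 := degreeOf_divDiff_lt (hmax i) (Nat.pos_of_ne_zero hpos)
    have h4 : contract (lcoeff ℂ (Finsupp.single () m)) (divDiff (Sum.inl i) (Sum.inr ()) f) =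
        0 := by
      ext s
      rw [coeff_contract_lcoeff, coeff_zero, ← notMem_support_iff]
      intro hs
      have := monomial_le_degreeOf (Sum.inr ()) hs
      simp at this
      omega
    rw [h4, smul_zero]
  have hne : γ ≠ 0 := by
    have hf : f ≠ 0 := by
      rintro rfl
      exact hpos (by rw [hm, degreeOf_zero])
    obtain ⟨t, ht, htm⟩ : ∃ t ∈ f.support, t (Sum.inr ()) = m := by
      have := Finset.exists_mem_eq_sup f.support (support_nonempty.mpr hf)
        fun t => t (Sum.inr ())
      obtain ⟨t, ht, e⟩ := this
      exact ⟨t, ht, by rw [hm, degreeOf_eq_sup, e]⟩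
    intro hz
    have e : Finsupp.sumElim (Finsupp.sumFinsuppEquivProdFinsupp t).1
      (Finsupp.single () m) = t := by
      ext (j | j)
      · simp
      · simp [htm]
    have := coeff_contract_lcoeff (Finsupp.sumFinsuppEquivProdFinsupp t).1 (Finsupp.single () m) f
    rw [e, ← hγ, hz, coeff_zero] at this
    exact mem_support_iff.mp ht this.symm
  have hc := coeff_single_of_singular ha h h0 (Sum.inr ()) m
  have e : Finsupp.sumElim (0 : ι →₀ ℕ) (Finsupp.single () m) =
      Finsupp.single (Sum.inr ()) m := by
    ext (j | j)
    · simp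
    · simp
  rw [← e, ← coeff_contract_lcoeff, ← hγ, hconst, coeff_C, if_pos rfl] at hc
  rw [hconst, hc, C_0] at hne
  exact hne rfl

theorem singular_rename {a : ℂ} (w : ι ≃ κ) {f : MvPolynomial ι ℂ}
    (h : ∀ i, dunkl a (Function.Embedding.refl ι) i f = 0) (k : κ) :
    dunkl a (Function.Embedding.refl κ) k (rename w f) = 0 := by
  have := rename_dunkl a (Function.Embedding.refl ι) (Function.Embedding.refl κ) w w
    (fun _ => rfl) (w.symm k) f
  rw [h, map_zero, Equiv.apply_symm_apply] at this
  exact this.symm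

/-- Only constants are killed by all Dunkl operators. -/
theorem eq_C_of_singular {a : ℕ} (ha : a ≠ 0) {f : MvPolynomial ι ℂ}
    (h : ∀ i, dunkl a (Function.Embedding.refl ι) i f = 0) : f = C (constantCoeff f) := by
  have H : ∀ (n : ℕ) (f : MvPolynomial (Fin n) ℂ),
      (∀ i, dunkl a (Function.Embedding.refl _) i f = 0) → f = C (constantCoeff f) := by
    intro n
    induction n with
    | zero => exact fun f _ => eq_C_of_isEmpty f
    | succ n ih =>
      intro f hf
      let w : Fin (n + 1) ≃ Fin n ⊕ Unit := Fintype.equivOfCardEq (by simp)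
      set g := f - C (constantCoeff f) with hg
      have hg0 : constantCoeff g = 0 := by simp [hg]
      have hgs : ∀ i, dunkl a (Function.Embedding.refl _) i g = 0 := by
        intro i
        rw [hg, map_sub, hf, dunkl_C, sub_zero]
      obtain ⟨s, -, hs⟩ := Finset.exists_max_image Finset.univ (fun i => degreeOf i g)
        ⟨0, Finset.mem_univ _⟩
      let v := w.trans (Equiv.swap (w s) (Sum.inr ()))
      have hv : v s = Sum.inr () := by simp [v]
      have hdeg : ∀ i, degreeOf (v i) (rename v g) = degreeOf i g := fun i =>
        degreeOf_rename_of_injective v.injective i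
      have h0 := degreeOf_inr_eq_zero_of_singular ha ih (singular_rename v hgs)
        (by rw [constantCoeff_rename, hg0]) (fun i => by
          rw [← hv, hdeg, ← v.apply_symm_apply (Sum.inl i), hdeg]
          exact hs _ (Finset.mem_univ _))
      rw [← hv, hdeg] at h0
      have : g = 0 := by
        ext m
        by_contra hm
        rw [coeff_zero] at hm
        have : m = 0 := by
          ext i
          have h1 := monomial_le_degreeOf i (mem_support_iff.mpr hm)
          have h2 := hs i (Finset.mem_univ _)
          rw [Finsupp.coe_zero, Pi.zero_apply]
          omega
        rw [this] at hm
        exact hm hg0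
      exact sub_eq_zero.mp this
  let w : ι ≃ Fin (Fintype.card ι) := Fintype.equivFin ι
  have := H _ _ (singular_rename w h)
  rw [constantCoeff_rename, ← rename_C w] at this
  exact rename_injective w w.injective this

end Singular

section Symmetric

set_option linter.unusedSectionVars false

variable {ι κ : Type*} [Fintype ι] [DecidableEq ι] [Fintype κ] [DecidableEq κ]

theorem totalDegree_pderiv_le (i : ι) (f : MvPolynomial ι ℂ) :
    totalDegree (pderiv i f) ≤ totalDegree f - 1 := by
  rw [f.as_sum, map_sum, ← f.as_sum]
  refine (totalDegree_finsetSum _ _).trans (Finset.sup_le fun m hm => ?_)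
  rw [pderiv_monomial]
  by_cases h : m i = 0
  · simp [h]
  refine (totalDegree_monomial_le _ _).trans ?_
  have h1 := le_totalDegree hm
  have h2 : m = (m - Finsupp.single i 1) + Finsupp.single i 1 := by
    rw [tsub_add_cancel_of_le]
    rw [Finsupp.single_le_iff]
    omega
  have h3 : (m.sum fun _ e => e) = ((m - Finsupp.single i 1).sum fun _ e => e) + 1 := by
    conv_lhs => rw [h2]
    rw [Finsupp.sum_add_index' (fun _ => rfl) (fun _ _ _ => rfl), Finsupp.sum_single_index rfl]
  simp only [Finsupp.sum] at *
  simp only [id]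
  omega

theorem totalDegree_divDiff_le (i j : ι) (f : MvPolynomial ι ℂ) :
    totalDegree (divDiff i j f) ≤ totalDegree f - 1 := by
  by_cases hij : i = j
  · subst hij; simp [divDiff_self]
  by_cases h0 : divDiff i j f = 0
  · simp [h0]
  have h1 := congrArg totalDegree (X_sub_X_mul_divDiff i j f)
  rw [totalDegree_mul_of_isDomain (X_sub_X_ne_zero hij) h0] at h1
  have h2 : totalDegree (f - swapVar i j f) ≤ totalDegree f :=
    (totalDegree_sub _ _).trans (max_le le_rfl (totalDegree_rename_le _ _))
  have h3 : 1 ≤ totalDegree (X i - X j : MvPolynomial ι ℂ) := by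
    have := le_totalDegree (p := (X i - X j : MvPolynomial ι ℂ))
      (s := Finsupp.single j 1) (by
        rw [mem_support_iff, coeff_sub, coeff_X, coeff_X, if_neg]
        · simp
        · rw [Finsupp.single_left_inj one_ne_zero]; exact hij)
    simpa using this
  omega

theorem totalDegree_dunkl_le (a : ℂ) (i : ι) (f : MvPolynomial ι ℂ) :
    totalDegree (dunkl a (Function.Embedding.refl ι) i f) ≤ totalDegree f - 1 := by
  rw [dunkl_apply]
  refine (totalDegree_sub _ _).trans (max_le (totalDegree_pderiv_le _ _) ?_)
  refine (totalDegree_smul_le _ _).trans ((totalDegree_finsetSum _ _).trans ?_)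
  exact Finset.sup_le fun j _ => totalDegree_divDiff_le _ _ _

/-- The Dunkl pairing is nondegenerate. -/
theorem exists_constantCoeff_dunklHom_ne_zero {a : ℕ} (ha : a ≠ 0) {f : MvPolynomial ι ℂ}
    (hf : f ≠ 0) :
    ∃ g, constantCoeff (dunklHom a (Function.Embedding.refl ι) g f) ≠ 0 := by
  induction hn : totalDegree f using Nat.strong_induction_on generalizing f with
  | _ n ih =>
    by_cases h : ∀ i, dunkl a (Function.Embedding.refl ι) i f = 0
    · refine ⟨1, ?_⟩
      rw [map_one, Module.End.one_apply]
      intro h0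
      rw [eq_C_of_singular ha h, h0, C_0] at hf
      exact hf rfl
    · push Not at h
      obtain ⟨i, hi⟩ := h
      have hd := totalDegree_dunkl_le (a : ℂ) i f
      have hpos : totalDegree f ≠ 0 := by
        intro h0
        rw [totalDegree_eq_zero_iff_eq_C] at h0
        rw [h0, dunkl_C] at hi
        exact hi rfl
      obtain ⟨g, hg⟩ := ih _ (by omega) hi rfl
      refine ⟨g * X i, ?_⟩
      rwa [map_mul, Module.End.mul_apply, dunklHom_X]

/-- The Dunkl pairing is nondegenerate on symmetric polynomials. -/
theorem exists_isSymmetric_constantCoeff_dunklHom_ne_zero {a : ℕ} (ha : a ≠ 0)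
    {f : MvPolynomial ι ℂ} (hs : f.IsSymmetric) (hf : f ≠ 0) :
    ∃ g : MvPolynomial ι ℂ, g.IsSymmetric ∧
      constantCoeff (dunklHom a (Function.Embedding.refl ι) g f) ≠ 0 := by
  obtain ⟨g, hg⟩ := exists_constantCoeff_dunklHom_ne_zero ha hf
  refine ⟨∑ w : Equiv.Perm ι, rename w g, fun v => ?_, ?_⟩
  · rw [map_sum]
    simp only [rename_rename]
    exact Fintype.sum_equiv (Equiv.mulLeft v) _ _ fun w => rfl
  · have h : ∀ w : Equiv.Perm ι, constantCoeff (dunklHom a (Function.Embedding.refl ι)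
        (rename w g) f) = constantCoeff (dunklHom a (Function.Embedding.refl ι) g f) := by
      intro w
      have := rename_dunklHom (a : ℂ) (Function.Embedding.refl ι) (Function.Embedding.refl ι) w w
        (fun _ => rfl) g f
      rw [hs w] at this
      rw [← this, constantCoeff_rename]
    rw [map_sum, LinearMap.sum_apply, map_sum, Finset.sum_congr rfl fun w _ => h w,
      Finset.sum_const, nsmul_eq_mul]
    refine mul_ne_zero ?_ hg
    rw [Finset.card_univ]
    exact_mod_cast Fintype.card_ne_zero

theorem symmetricSubalgebra_le_adjoin_psum :
    symmetricSubalgebra ι ℂ ≤ Algebra.adjoin ℂ (Set.range fun r : ℕ => psum ι ℂ (r + 1)) := by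
  have hp : ∀ r, r ≠ 0 → psum ι ℂ r ∈ Algebra.adjoin ℂ (Set.range fun r : ℕ => psum ι ℂ (r + 1)) :=
    fun r hr => Algebra.subset_adjoin ⟨r - 1, by
      simp only
      rw [Nat.sub_add_cancel (Nat.pos_of_ne_zero hr)]⟩
  have he : ∀ k, esymm ι ℂ k ∈ Algebra.adjoin ℂ (Set.range fun r : ℕ => psum ι ℂ (r + 1)) := by
    intro k
    induction k using Nat.strong_induction_on with
    | _ k ih =>
      by_cases hk : k = 0
      · rw [hk, esymm_zero]
        exact one_mem _
      have h := mul_esymm_eq_sum ι ℂ k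
      have hk' : (k : ℂ) ≠ 0 := Nat.cast_ne_zero.mpr hk
      have : esymm ι ℂ k = (k : ℂ)⁻¹ • ((k : MvPolynomial ι ℂ) * esymm ι ℂ k) := by
        rw [smul_eq_C_mul, ← mul_assoc, ← C_eq_coe_nat, ← C_mul, inv_mul_cancel₀ hk', C_1, one_mul]
      rw [this, h]
      refine Subalgebra.smul_mem _ (mul_mem (pow_mem (neg_mem (one_mem _)) _)
        (sum_mem fun x hx => ?_)) _
      rw [Finset.mem_filter, Finset.HasAntidiagonal.mem_antidiagonal] at hx
      exact mul_mem (mul_mem (pow_mem (neg_mem (one_mem _)) _) (ih _ hx.2)) (hp _ (by omega))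
  intro f hf
  obtain ⟨q, hq⟩ := esymmAlgHom_surjective (σ := ι) (n := Fintype.card ι) ℂ le_rfl ⟨f, hf⟩
  have hq' : f = aeval (fun i : Fin (Fintype.card ι) => esymm ι ℂ (i + 1)) q := by
    have h1 : (symmetricSubalgebra ι ℂ).val.comp (esymmAlgHom ι ℂ (Fintype.card ι)) =
        aeval (fun i : Fin (Fintype.card ι) => esymm ι ℂ (i + 1)) := by
      ext i
      simp [esymmAlgHom]
    rw [← h1, AlgHom.comp_apply, hq]
    rfl
  rw [hq']
  have h2 : (aeval (fun i : Fin (Fintype.card ι) => esymm ι ℂ (i + 1))).range ≤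
      Algebra.adjoin ℂ (Set.range fun r : ℕ => psum ι ℂ (r + 1)) := by
    rw [← Algebra.adjoin_range_eq_range_aeval]
    exact Algebra.adjoin_le (by rintro _ ⟨i, rfl⟩; exact he _)
  exact h2 ⟨q, rfl⟩

end Symmetric

section Transfer

set_option linter.unusedSectionVars false

variable {ι κ : Type*} [Fintype ι] [DecidableEq ι] [Fintype κ] [DecidableEq κ]

theorem exists_apply_eq_of_mem_adjoin {A B M R : Type*} [CommRing A] [Algebra ℂ A] [CommRing B]
    [Algebra ℂ B] [AddCommGroup M] [Module ℂ M] {φ : A →ₐ[ℂ] Module.End ℂ M}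
    {ψ : B →ₐ[ℂ] Module.End ℂ M} (hc : ∀ x y, Commute (φ x) (ψ y)) {v : M} {x : R → A}
    {B' : Subalgebra ℂ B} (h : ∀ r, ∃ y ∈ B', φ (x r) v = ψ y v) {g : A}
    (hg : g ∈ Algebra.adjoin ℂ (Set.range x)) : ∃ g' ∈ B', φ g v = ψ g' v := by
  induction hg using Algebra.adjoin_induction with
  | mem g hg => obtain ⟨r, rfl⟩ := hg; exact h r
  | algebraMap c =>
    exact ⟨algebraMap ℂ B c, B'.algebraMap_mem c, by rw [AlgHom.commutes, AlgHom.commutes]⟩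
  | add f g _ _ hf hg =>
    obtain ⟨f', hf', h1⟩ := hf
    obtain ⟨g', hg', h2⟩ := hg
    exact ⟨f' + g', add_mem hf' hg', by
      rw [map_add, map_add, LinearMap.add_apply, LinearMap.add_apply, h1, h2]⟩
  | mul f g _ _ hf hg =>
    obtain ⟨f', hf', h1⟩ := hf
    obtain ⟨g', hg', h2⟩ := hg
    refine ⟨g' * f', mul_mem hg' hf', ?_⟩
    rw [map_mul, map_mul, Module.End.mul_apply, Module.End.mul_apply, h2, ← h1]
    exact LinearMap.congr_fun (hc f g') v

theorem exists_dunklHom_inl_kernelPoly {a : ℕ} (ha : a ≠ 0) {g : MvPolynomial κ ℂ}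
    (hg : g.IsSymmetric) : ∃ g' : MvPolynomial ι ℂ, g'.IsSymmetric ∧
      dunklHom a Function.Embedding.inr g (kernelPoly ι κ a) =
        dunklHom a Function.Embedding.inl g' (kernelPoly ι κ a) := by
  refine exists_apply_eq_of_mem_adjoin (B' := symmetricSubalgebra ι ℂ)
    (fun x y => (dunklHom_commute_of_disjoint (a : ℂ) _ _ (fun _ _ => by simp) x y))
    (fun r => ⟨(-1) ^ (r + 1) • psum ι ℂ (r + 1), ?_, ?_⟩)
    (symmetricSubalgebra_le_adjoin_psum hg)
  · exact Subalgebra.zsmul_mem _ (psum_isSymmetric ι ℂ _) _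
  · rw [dunklHom_inr_psum_kernelPoly ha, map_zsmul, LinearMap.smul_apply]

theorem exists_dunklHom_inr_kernelPoly {a : ℕ} (ha : a ≠ 0) {g : MvPolynomial ι ℂ}
    (hg : g.IsSymmetric) : ∃ g' : MvPolynomial κ ℂ, g'.IsSymmetric ∧
      dunklHom a Function.Embedding.inl g (kernelPoly ι κ a) =
        dunklHom a Function.Embedding.inr g' (kernelPoly ι κ a) := by
  refine exists_apply_eq_of_mem_adjoin (B' := symmetricSubalgebra κ ℂ)
    (fun x y => (dunklHom_commute_of_disjoint (a : ℂ) _ _ (fun _ _ => by simp) x y))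
    (fun r => ⟨(-1) ^ (r + 1) • psum κ ℂ (r + 1), ?_, ?_⟩)
    (symmetricSubalgebra_le_adjoin_psum hg)
  · exact Subalgebra.zsmul_mem _ (psum_isSymmetric κ ℂ _) _
  · rw [map_zsmul, LinearMap.smul_apply, dunklHom_inr_psum_kernelPoly ha, smul_smul, ← mul_pow]
    simp

/-- The span of the products `∏ (y_k - t_i)^a` over all choices of `t`. -/
noncomputable def splitSpan (ι κ : Type*) [Fintype ι] [Fintype κ] (a : ℕ) :
    Submodule ℂ (MvPolynomial κ ℂ) :=
  Submodule.span ℂ (Set.range fun t : ι → ℂ => specialize t (kernelPoly ι κ a))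

/-- The image of `f` under all symmetric polynomials in the Dunkl operators. -/
noncomputable def dunklSpan (a : ℂ) (f : MvPolynomial κ ℂ) : Submodule ℂ (MvPolynomial κ ℂ) :=
  (Subalgebra.toSubmodule (symmetricSubalgebra κ ℂ)).map
    ((dunklHom a (Function.Embedding.refl κ)).toLinearMap.flip f)

theorem dunklHom_mem_dunklSpan {a : ℂ} {f : MvPolynomial κ ℂ} {g : MvPolynomial κ ℂ}
    (hg : g.IsSymmetric) : dunklHom a (Function.Embedding.refl κ) g f ∈ dunklSpan a f :=
  ⟨g, hg, rfl⟩

theorem specialize_zero_kernelPoly (a : ℕ) :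
    specialize (0 : ι → ℂ) (kernelPoly ι κ a) = ∏ k : κ, X k ^ (a * Fintype.card ι) := by
  simp only [kernelPoly, linFactor, map_prod, map_pow, map_sub, specialize_X_inl, specialize_X_inr,
    Pi.zero_apply, C_0, sub_zero]
  rw [Fintype.prod_prod_type]
  simp only [Finset.prod_const, Finset.card_univ, pow_mul]

theorem contract_rename (ξ : MvPolynomial κ ℂ →ₗ[ℂ] ℂ) (w : Equiv.Perm ι)
    (f : MvPolynomial (ι ⊕ κ) ℂ) :
    contract ξ (rename (Equiv.sumCongr w (Equiv.refl κ)) f) = rename w (contract ξ f) := by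
  have : contract ξ ∘ₗ (rename (R := ℂ) (Equiv.sumCongr w (Equiv.refl κ))).toLinearMap =
      (rename (R := ℂ) w).toLinearMap ∘ₗ contract ξ := by
    refine linearMap_sum_ext fun f g => ?_
    simp only [LinearMap.comp_apply, AlgHom.toLinearMap_apply, map_mul, rename_rename,
      contract_mul, map_smul]
    rw [show (Equiv.sumCongr w (Equiv.refl κ)) ∘ Sum.inl = Sum.inl ∘ w from rfl,
      show (Equiv.sumCongr w (Equiv.refl κ)) ∘ Sum.inr = Sum.inr from rfl, ← rename_rename,
      contract_mul]
  exact LinearMap.congr_fun this f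

theorem isSymmetric_contract_kernelPoly (ξ : MvPolynomial κ ℂ →ₗ[ℂ] ℂ) (a : ℕ) :
    (contract ξ (kernelPoly ι κ a)).IsSymmetric := by
  intro w
  rw [← contract_rename, rename_sumCongr_kernelPoly]

theorem splitSpan_eq_dunklSpan {a : ℕ} (ha : a ≠ 0) :
    splitSpan ι κ a = dunklSpan a (∏ k : κ, X k ^ (a * Fintype.card ι)) := by
  have hspec : ∀ (t : ι → ℂ) (g : MvPolynomial κ ℂ) (f : MvPolynomial (ι ⊕ κ) ℂ),
      specialize t (dunklHom a Function.Embedding.inr g f) =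
        dunklHom a (Function.Embedding.refl κ) g (specialize t f) := fun t g f =>
    map_dunklHom (L := (specialize (κ := κ) t).toLinearMap)
      (fun i f => specialize_dunkl t a i f) g f
  have hcon : ∀ (ξ : MvPolynomial κ ℂ →ₗ[ℂ] ℂ) (g : MvPolynomial ι ℂ) (f : MvPolynomial (ι ⊕ κ) ℂ),
      contract ξ (dunklHom a Function.Embedding.inl g f) =
        dunklHom a (Function.Embedding.refl ι) g (contract ξ f) := fun ξ g f =>
    map_dunklHom (fun i f => contract_dunkl ξ a i f) g f
  have h0 : ∀ (ξ : MvPolynomial κ ℂ →ₗ[ℂ] ℂ) (g : MvPolynomial ι ℂ) (g' : MvPolynomial κ ℂ),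
      dunklHom a Function.Embedding.inl g (kernelPoly ι κ a) =
        dunklHom a Function.Embedding.inr g' (kernelPoly ι κ a) →
      constantCoeff (dunklHom a (Function.Embedding.refl ι) g (contract ξ (kernelPoly ι κ a))) =
        ξ (dunklHom a (Function.Embedding.refl κ) g' (∏ k : κ, X k ^ (a * Fintype.card ι))) := by
    intro ξ g g' h
    rw [← hcon, h, ← eval_zero, eval_contract, hspec]
    rw [← specialize_zero_kernelPoly]
  apply le_antisymm
  · rw [splitSpan, Submodule.span_le]
    rintro _ ⟨t, rfl⟩
    rw [SetLike.mem_coe, ← Subspace.forall_mem_dualAnnihilator_apply_eq_zero_iff]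
    intro ξ hξ
    rw [Submodule.mem_dualAnnihilator] at hξ
    rw [← eval_contract]
    suffices contract ξ (kernelPoly ι κ a) = 0 by rw [this, map_zero]
    by_contra hF
    obtain ⟨g, hg, hne⟩ := exists_isSymmetric_constantCoeff_dunklHom_ne_zero ha
      (isSymmetric_contract_kernelPoly ξ a) hF
    obtain ⟨g', hg', h⟩ := exists_dunklHom_inr_kernelPoly (κ := κ) ha hg
    exact hne ((h0 ξ g g' h).trans (hξ _ (dunklHom_mem_dunklSpan hg')))
  · rintro _ ⟨g', hg', rfl⟩
    rw [← Subspace.forall_mem_dualAnnihilator_apply_eq_zero_iff]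
    intro ξ hξ
    rw [Submodule.mem_dualAnnihilator] at hξ
    have hF : contract ξ (kernelPoly ι κ a) = 0 := by
      refine MvPolynomial.funext fun t => ?_
      rw [eval_contract, map_zero]
      exact hξ _ (Submodule.subset_span ⟨t, rfl⟩)
    obtain ⟨g, hg, h⟩ := exists_dunklHom_inl_kernelPoly (ι := ι) ha hg'
    have := h0 ξ g g' h.symm
    rw [hF, map_zero, map_zero] at this
    exact this.symm

end Transfer

section TopMonomial

set_option linter.unusedSectionVars false

variable {ι κ : Type*} [Fintype ι] [DecidableEq ι] [Fintype κ] [DecidableEq κ]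

theorem swapVar_prod_X_of_mem {i j : ι} {s : Finset ι} (h : i ∈ s ↔ j ∈ s) :
    swapVar i j (∏ l ∈ s, X l : MvPolynomial ι ℂ) = ∏ l ∈ s, X l := by
  rw [map_prod]
  refine Finset.prod_equiv (Equiv.swap i j) (fun l => ?_) fun l _ => swapVar_X i j l
  by_cases h1 : l = i
  · subst h1; rw [Equiv.swap_apply_left, h]
  by_cases h2 : l = j
  · subst h2; rw [Equiv.swap_apply_right, h]
  rw [Equiv.swap_apply_of_ne_of_ne h1 h2]

theorem pderiv_prod_X_of_notMem {i : ι} {s : Finset ι} (h : i ∉ s) :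
    pderiv i (∏ l ∈ s, X l : MvPolynomial ι ℂ) = 0 := by
  refine Finset.prod_induction _ (fun f => pderiv i f = 0) (fun f g hf hg => ?_) ?_ fun l hl => ?_
  · rw [Derivation.leibniz, hf, hg, smul_zero, smul_zero, add_zero]
  · exact Derivation.map_one_eq_zero _
  · exact pderiv_X_of_ne (by rintro rfl; exact h hl)

theorem dunkl_prod_X (a : ℂ) {i : ι} {s : Finset ι} (h : i ∈ s) :
    dunkl a (Function.Embedding.refl ι) i (∏ l ∈ s, X l) =
      (1 - a * sᶜ.card) • ∏ l ∈ s.erase i, X l := by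
  have hp : (∏ l ∈ s, X l : MvPolynomial ι ℂ) = X i * ∏ l ∈ s.erase i, X l :=
    (Finset.mul_prod_erase s (fun l => (X l : MvPolynomial ι ℂ)) h).symm
  have hd : ∀ j, divDiff i j (∏ l ∈ s, X l : MvPolynomial ι ℂ) =
      if j ∈ sᶜ then ∏ l ∈ s.erase i, X l else 0 := by
    intro j
    split_ifs with hj
    · rw [Finset.mem_compl] at hj
      have hij : i ≠ j := by rintro rfl; exact hj h
      have hsw : swapVar i j (∏ l ∈ s.erase i, X l : MvPolynomial ι ℂ) = ∏ l ∈ s.erase i, X l :=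
        swapVar_prod_X_of_mem (by simp [hj])
      rw [hp, divDiff_X_left_mul hij, hsw, divDiff_eq_zero hsw, mul_zero, zero_add]
    · rw [Finset.mem_compl, not_not] at hj
      exact divDiff_eq_zero (swapVar_prod_X_of_mem (by simp [h, hj]))
  rw [dunkl_apply]
  simp only [Function.Embedding.refl_apply]
  rw [Finset.sum_congr rfl fun j _ => hd j, Finset.sum_ite_mem, Finset.univ_inter,
    Finset.sum_const, hp, Derivation.leibniz, pderiv_prod_X_of_notMem (Finset.notMem_erase i s),
    pderiv_X_self, smul_zero, zero_add, smul_eq_mul, mul_one, sub_smul, one_smul,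
    mul_smul, Nat.cast_smul_eq_nsmul]

theorem dunkl_prod_X_pow_mul_prod_X (a : ℂ) (m : ℕ) {i : ι} {s : Finset ι} (h : i ∈ s) :
    dunkl a (Function.Embedding.refl ι) i ((∏ l, X l ^ m) * ∏ l ∈ s, X l) =
      (m + 1 - a * sᶜ.card) • ((∏ l, X l ^ m) * ∏ l ∈ s.erase i, X l) := by
  have hp : (∏ l ∈ s, X l : MvPolynomial ι ℂ) = X i * ∏ l ∈ s.erase i, X l :=
    (Finset.mul_prod_erase s (fun l => (X l : MvPolynomial ι ℂ)) h).symm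
  have hX : pderiv i (∏ l, X l ^ m : MvPolynomial ι ℂ) * X i = (m : ℂ) • ∏ l, X l ^ m := by
    rw [← Finset.mul_prod_erase Finset.univ _ (Finset.mem_univ i), Finset.prod_pow,
      Derivation.leibniz, Derivation.leibniz_pow, Derivation.leibniz_pow,
      pderiv_prod_X_of_notMem (Finset.notMem_erase i _), pderiv_X_self, smul_zero, smul_zero,
      smul_zero, zero_add, smul_eq_mul, smul_eq_mul, mul_one, Nat.cast_smul_eq_nsmul,
      mul_comm, mul_comm (Finset.prod _ _ ^ m)]
    cases m with
    | zero => simp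
    | succ m =>
      simp only [nsmul_eq_mul, Nat.add_sub_cancel]
      ring
  rw [dunkl_mul_of_swapVar_eq, dunkl_prod_X a h]
  · simp only [Function.Embedding.refl_apply]
    rw [hp, ← mul_assoc (pderiv i _), hX]
    simp only [smul_eq_C_mul, map_sub, map_add, map_mul, C_1]
    ring
  · intro j
    simp only [Function.Embedding.refl_apply, Finset.prod_pow]
    rw [map_pow, swapVar_prod_X_of_mem (by simp)]

theorem dunklHom_prod_X_apply_prod_X_pow (a : ℂ) (m : ℕ) (s : Finset ι) :
    dunklHom a (Function.Embedding.refl ι) (∏ i ∈ s, X i) (∏ l, X l ^ (m + 1)) =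
      (∏ j ∈ Finset.range s.card, (m + 1 - a * j)) • ((∏ l, X l ^ m) * ∏ l ∈ sᶜ, X l) := by
  induction s using Finset.induction_on with
  | empty =>
    simp [pow_succ, Finset.prod_mul_distrib]
  | insert i s hi ih =>
    rw [Finset.prod_insert hi, dunklHom_X_mul_apply, ih, map_smul,
      dunkl_prod_X_pow_mul_prod_X a m (Finset.mem_compl.mpr hi), compl_compl,
      Finset.card_insert_of_notMem hi, Finset.prod_range_succ, smul_smul, Finset.compl_insert]

theorem dunklHom_prod_univ_X_apply_prod_X_pow (a : ℂ) (m : ℕ) :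
    dunklHom a (Function.Embedding.refl ι) (∏ i, X i) (∏ l, X l ^ (m + 1)) =
      (∏ j ∈ Finset.range (Fintype.card ι), (m + 1 - a * j)) • ∏ l, X l ^ m := by
  rw [dunklHom_prod_X_apply_prod_X_pow, Finset.compl_univ, Finset.prod_empty, mul_one,
    Finset.card_univ]

end TopMonomial

section SymmetricDegree

/-- Symmetric polynomials of degree at most `n` in each variable. -/
noncomputable def symDegree (κ : Type*) (n : ℕ) : Submodule ℂ (MvPolynomial κ ℂ) :=
  Subalgebra.toSubmodule (symmetricSubalgebra κ ℂ) ⊓ restrictDegree κ ℂ n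

theorem mem_symDegree {κ : Type*} {n : ℕ} {f : MvPolynomial κ ℂ} :
    f ∈ symDegree κ n ↔ f.IsSymmetric ∧ ∀ i, degreeOf i f ≤ n := by
  rw [symDegree, Submodule.mem_inf, mem_restrictDegree]
  refine and_congr Iff.rfl ?_
  simp only [degreeOf_le_iff]
  exact ⟨fun h i s hs => h s hs i, fun h s hs i => h i s hs⟩

instance {κ : Type*} [Finite κ] (n : ℕ) : FiniteDimensional ℂ (symDegree κ n) :=
  Submodule.finiteDimensional_of_le (S₂ := restrictDegree κ ℂ n) inf_le_right

theorem coeff_eq_of_isSymmetric {κ : Type*} [Finite κ] {f : MvPolynomial κ ℂ} (hf : f.IsSymmetric)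
    (w : Equiv.Perm κ) (m : κ → ℕ) :
    coeff (Finsupp.equivFunOnFinite.symm (m ∘ w)) f =
      coeff (Finsupp.equivFunOnFinite.symm m) f := by
  conv_rhs => rw [← coeff_rename_mapDomain w.symm w.symm.injective, hf]
  congr 1
  ext i
  rw [← Finsupp.equivMapDomain_eq_mapDomain]
  simp

theorem finrank_symDegree_le (p n : ℕ) :
    Module.finrank ℂ (symDegree (Fin p) n) ≤ (n + p).choose p := by
  have hex : ∀ s : Sym (Fin (n + 1)) p, ∃ g : Fin p → Fin (n + 1),
      (List.ofFn g : Multiset (Fin (n + 1))) = s := by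
    rintro ⟨s, hs⟩
    induction s using Quotient.inductionOn with
    | h l =>
      have hl : l.length = p := hs
      subst hl
      exact ⟨l.get, by simp⟩
  choose rep hrep using hex
  let L : symDegree (Fin p) n →ₗ[ℂ] (Sym (Fin (n + 1)) p → ℂ) :=
    LinearMap.pi fun s =>
      lcoeff ℂ (Finsupp.equivFunOnFinite.symm fun i => (rep s i : ℕ)) ∘ₗ (symDegree (Fin p) n).subtype
  have hL : Function.Injective L := by
    rw [← LinearMap.ker_eq_bot, LinearMap.ker_eq_bot']
    rintro ⟨f, hf⟩ h0
    rw [mem_symDegree] at hf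
    refine Subtype.ext (MvPolynomial.ext _ _ fun m => ?_)
    by_contra hm
    have hle : ∀ i, m i < n + 1 := fun i =>
      Nat.lt_succ_of_le ((degreeOf_le_iff.mp (hf.2 i)) m (mem_support_iff.mpr hm))
    let g : Fin p → Fin (n + 1) := fun i => ⟨m i, hle i⟩
    let s : Sym (Fin (n + 1)) p := ⟨List.ofFn g, by simp⟩
    have hperm : List.Perm (List.ofFn (rep s)) (List.ofFn g) :=
      Multiset.coe_eq_coe.mp (hrep s)
    have hsort : rep s ∘ Tuple.sort (rep s) = g ∘ Tuple.sort g :=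
      List.ofFn_injective <| ((((Tuple.sort (rep s)).ofFn_comp_perm _).trans hperm).trans
        ((Tuple.sort g).ofFn_comp_perm g).symm).eq_of_pairwise'
          (Tuple.monotone_sort _).sortedLE_ofFn.pairwise
          (Tuple.monotone_sort _).sortedLE_ofFn.pairwise
    have h1 := coeff_eq_of_isSymmetric hf.1 (Tuple.sort (rep s)) (fun i => (rep s i : ℕ))
    have h2 := coeff_eq_of_isSymmetric hf.1 (Tuple.sort g) (fun i => (g i : ℕ))
    have h3 : (fun i => (rep s i : ℕ)) ∘ Tuple.sort (rep s) = (fun i => (g i : ℕ)) ∘ Tuple.sort g :=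
      funext fun i => congrArg Fin.val (congrFun hsort i)
    have h4 : coeff (Finsupp.equivFunOnFinite.symm fun i => (rep s i : ℕ)) f = 0 :=
      congrFun h0 s
    rw [← h1, h3, h2] at h4
    refine hm (Eq.trans ?_ h4)
    congr 1
    ext i
    simp [g]
  refine (LinearMap.finrank_le_finrank_of_injective hL).trans ?_
  rw [Module.finrank_fintype_fun_eq_card, Sym.card_sym_eq_choose, Fintype.card_fin,
    show n + 1 + p - 1 = n + p by omega]

end SymmetricDegree

section Chain

theorem finrank_map_add_finrank_inf_ker {V : Type*} [AddCommGroup V] [Module ℂ V]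
    (X : Module.End ℂ V) (P : Submodule ℂ V) [FiniteDimensional ℂ P] :
    Module.finrank ℂ (P.map X) + Module.finrank ℂ (P ⊓ LinearMap.ker X : Submodule ℂ V) =
      Module.finrank ℂ P := by
  have h := (X.domRestrict P).finrank_range_add_finrank_ker
  rw [LinearMap.range_domRestrict, LinearMap.ker_domRestrict] at h
  rw [← h, ← Submodule.map_comap_subtype]
  congr 1
  exact (Submodule.equivMapOfInjective P.subtype P.injective_subtype _).finrank_eq.symm

/-- If `W'` lies in the kernel of `X` and in `X ^ a W`, and `W` has dimension at most
`(a + 1) * dim W'`, then `W'` is the full kernel of `X` on `W`. -/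
theorem inf_ker_eq_of_finrank_le {V : Type*} [AddCommGroup V] [Module ℂ V] {X : Module.End ℂ V}
    {W W' : Submodule ℂ V} [FiniteDimensional ℂ W] {a : ℕ} (hX : W.map X ≤ W)
    (hW' : W' ≤ LinearMap.ker X) (hWa : W' ≤ W.map (X ^ a))
    (hle : Module.finrank ℂ W ≤ (a + 1) * Module.finrank ℂ W') :
    W ⊓ LinearMap.ker X = W' ∧ Module.finrank ℂ W = (a + 1) * Module.finrank ℂ W' := by
  have hanti : ∀ j, W.map (X ^ (j + 1)) ≤ W.map (X ^ j) := by
    intro j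
    rw [pow_succ, Module.End.mul_eq_comp, Submodule.map_comp]
    exact Submodule.map_mono hX
  have hanti' : Antitone fun j => W.map (X ^ j) := antitone_nat_of_succ_le hanti
  have hstep : ∀ j ≤ a, Module.finrank ℂ (W.map (X ^ (j + 1))) + Module.finrank ℂ W' ≤
      Module.finrank ℂ (W.map (X ^ j)) := by
    intro j hj
    rw [← finrank_map_add_finrank_inf_ker X (W.map (X ^ j)), pow_succ', Module.End.mul_eq_comp,
      Submodule.map_comp]
    gcongr
    exact Submodule.finrank_mono (le_inf (hWa.trans (hanti' hj)) hW')
  have hsum : ∀ j ≤ a, j * Module.finrank ℂ W' ≤ Module.finrank ℂ (W.map (X ^ (a + 1 - j))) := by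
    intro j hj
    induction j with
    | zero => simp
    | succ j ih =>
      have h1 := hstep (a + 1 - (j + 1)) (by omega)
      rw [show a + 1 - (j + 1) + 1 = a + 1 - j by omega] at h1
      have := ih (by omega)
      rw [add_mul, one_mul]
      omega
  have h1 := hsum a le_rfl
  rw [show a + 1 - a = 1 by omega, pow_one] at h1
  have h2 := finrank_map_add_finrank_inf_ker X W
  have hWW : W' ≤ W := hWa.trans ((hanti' (Nat.zero_le a)).trans
    (by simp only [pow_zero, Module.End.one_eq_id, Submodule.map_id, le_refl]))
  have hfin : FiniteDimensional ℂ (W ⊓ LinearMap.ker X : Submodule ℂ V) :=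
    Submodule.finiteDimensional_of_le inf_le_left
  have h3 := Submodule.finrank_mono (le_inf hWW hW')
  rw [add_mul, one_mul] at hle ⊢
  exact ⟨(Submodule.eq_of_le_of_finrank_le (le_inf hWW hW') (by omega)).symm, by omega⟩

theorem splitSpan_le_symDegree (ι κ : Type*) [Fintype ι] [DecidableEq ι] [Fintype κ]
    [DecidableEq κ] (a : ℕ) :
    splitSpan ι κ a ≤ symDegree κ (a * Fintype.card ι) := by
  rw [splitSpan, Submodule.span_le]
  rintro _ ⟨t, rfl⟩
  have hK : specialize t (kernelPoly ι κ a) = ∏ k : κ, ∏ i, (X k - C (t i)) ^ a := by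
    simp only [kernelPoly, linFactor, map_prod, map_pow, map_sub]
    rw [Fintype.prod_prod_type]
    simp only [specialize_X_inl, specialize_X_inr]
  simp only
  rw [hK, SetLike.mem_coe, mem_symDegree]
  constructor
  · intro w
    simp only [map_prod, map_pow, map_sub, rename_X, rename_C]
    exact Fintype.prod_equiv w _ _ fun k => rfl
  · intro k
    have h1 : ∀ l i, degreeOf k ((X l - C (t i)) ^ a : MvPolynomial κ ℂ) ≤
        if l = k then a else 0 := by
      intro l i
      refine (degreeOf_pow_le _ _ _).trans ?_
      have : degreeOf k (X l - C (t i) : MvPolynomial κ ℂ) ≤ if l = k then 1 else 0 := by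
        refine (degreeOf_sub_le _ _ _).trans ?_
        rw [degreeOf_C, degreeOf_X]
        split_ifs with h1 h2 h2 <;> simp_all
      split_ifs at this ⊢ with h
      · nlinarith
      · nlinarith
    refine (degreeOf_prod_le _ _ _).trans ?_
    calc _ ≤ ∑ l : κ, ∑ i : ι, if l = k then a else 0 :=
          Finset.sum_le_sum fun l _ => (degreeOf_prod_le _ _ _).trans
            (Finset.sum_le_sum fun i _ => h1 l i)
      _ = a * Fintype.card ι := by simp [mul_comm]

theorem isSymmetric_prod_X (κ : Type*) [Fintype κ] :
    (∏ k, X k : MvPolynomial κ ℂ).IsSymmetric := fun w => by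
  simp only [map_prod, rename_X]
  exact Fintype.prod_equiv w _ _ fun k => rfl

theorem map_dunklSpan_le {κ : Type*} [Fintype κ] [DecidableEq κ] (a : ℂ) (f : MvPolynomial κ ℂ)
    {g : MvPolynomial κ ℂ} (hg : g.IsSymmetric) :
    (dunklSpan a f).map (dunklHom a (Function.Embedding.refl κ) g) ≤ dunklSpan a f := by
  rintro _ ⟨_, ⟨g', hg', rfl⟩, rfl⟩
  refine ⟨g * g', (symmetricSubalgebra κ ℂ).mul_mem hg hg', ?_⟩
  simp [map_mul]

theorem exists_pow_dunklHom_prod_X {κ : Type*} [Fintype κ] [DecidableEq κ] {a q : ℕ}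
    (hκ : Fintype.card κ = q + 1) (j : ℕ) : ∃ c : ℂ, c ≠ 0 ∧
      ((dunklHom a (Function.Embedding.refl κ) (∏ i, X i)) ^ j) (∏ k, X k ^ (a * q + j)) =
        c • ∏ k, X k ^ (a * q) := by
  induction j with
  | zero => exact ⟨1, one_ne_zero, by simp⟩
  | succ j ih =>
    obtain ⟨c, hc, h⟩ := ih
    refine ⟨(∏ i ∈ Finset.range (q + 1), ((a * q + j : ℕ) + 1 - a * i : ℂ)) * c,
      mul_ne_zero (Finset.prod_ne_zero_iff.mpr fun i hi => ?_) hc, ?_⟩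
    · rw [Finset.mem_range] at hi
      intro h0
      have h1 : ((a * q + j + 1 : ℕ) : ℂ) = (a * i : ℕ) := by
        push_cast at h0 ⊢
        linear_combination h0
      have h2 := Nat.cast_injective h1
      have h3 : a * i ≤ a * q := Nat.mul_le_mul_left a (by omega)
      omega
    · rw [pow_succ, Module.End.mul_apply, ← add_assoc,
        dunklHom_prod_univ_X_apply_prod_X_pow, hκ, map_smul, h, smul_smul]

theorem dunklHom_prod_X_eq_zero {κ : Type*} [Fintype κ] [DecidableEq κ] {a q : ℕ}
    (hκ : Fintype.card κ = q + 1) :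
    dunklHom a (Function.Embedding.refl κ) (∏ i, X i) (∏ k, X k ^ (a * q)) = 0 := by
  by_cases h : a * q = 0
  · rw [h]
    simp only [pow_zero, Finset.prod_const_one]
    rw [show (1 : MvPolynomial κ ℂ) = C 1 from C_1.symm, dunklHom_apply_C, map_prod]
    simp [hκ]
  · obtain ⟨m, hm⟩ := Nat.exists_eq_succ_of_ne_zero h
    rw [hm, Nat.succ_eq_add_one, dunklHom_prod_univ_X_apply_prod_X_pow, hκ,
      Finset.prod_eq_zero (i := q) (by simp), zero_smul]
    have : ((a * q : ℕ) : ℂ) = (m + 1 : ℕ) := by rw [hm]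
    push_cast at this
    rw [this, sub_self]

theorem splitSpan_chain {a q : ℕ} (ha : a ≠ 0)
    (hq : (a * (q + 1) + q).choose q ≤ Module.finrank ℂ (splitSpan (Fin q) (Fin (q + 1)) a)) :
    Module.finrank ℂ (splitSpan (Fin (q + 1)) (Fin (q + 1)) a) =
        (a * (q + 1) + (q + 1)).choose (q + 1) ∧
      ∀ f ∈ symDegree (Fin (q + 1)) (a * (q + 1)),
        dunklHom a (Function.Embedding.refl (Fin (q + 1))) (∏ i, X i) f = 0 →
          f ∈ splitSpan (Fin q) (Fin (q + 1)) a := by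
  have hW := splitSpan_eq_dunklSpan (ι := Fin (q + 1)) (κ := Fin (q + 1)) ha
  have hW' := splitSpan_eq_dunklSpan (ι := Fin q) (κ := Fin (q + 1)) ha
  have hle := splitSpan_le_symDegree (Fin (q + 1)) (Fin (q + 1)) a
  rw [Fintype.card_fin] at hW hW' hle
  set Y := dunklHom a (Function.Embedding.refl (Fin (q + 1))) (∏ i, X i) with hY
  set W := splitSpan (Fin (q + 1)) (Fin (q + 1)) a
  set W' := splitSpan (Fin q) (Fin (q + 1)) a
  have hfin : FiniteDimensional ℂ W := Submodule.finiteDimensional_of_le hle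
  have hdim := finrank_symDegree_le (q + 1) (a * (q + 1))
  have hWA := Submodule.finrank_mono hle
  have hch : (a * (q + 1) + (q + 1)).choose (q + 1) = (a + 1) * (a * (q + 1) + q).choose q := by
    have := Nat.add_one_mul_choose_eq (a * (q + 1) + q) q
    refine Nat.eq_of_mul_eq_mul_right (Nat.succ_pos q) ?_
    rw [← add_assoc, Nat.succ_eq_add_one, ← this]
    ring
  have hmul := Nat.mul_le_mul_left (a + 1) hq
  have hmap : W.map Y ≤ W := by
    rw [hW]
    exact map_dunklSpan_le _ _ (isSymmetric_prod_X _)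
  have hcomm : ∀ g, dunklHom a (Function.Embedding.refl (Fin (q + 1))) g * Y =
      Y * dunklHom a (Function.Embedding.refl (Fin (q + 1))) g := fun g => by
    rw [hY, ← map_mul, ← map_mul, mul_comm]
  have hker : W' ≤ LinearMap.ker Y := by
    rw [hW']
    rintro _ ⟨g, hg, rfl⟩
    have := LinearMap.congr_fun (hcomm g) (∏ k, X k ^ (a * q))
    rw [Module.End.mul_apply, Module.End.mul_apply, dunklHom_prod_X_eq_zero (Fintype.card_fin _),
      map_zero] at this
    exact this.symm
  have hrange : W' ≤ W.map (Y ^ a) := by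
    rw [hW', hW]
    rintro _ ⟨g, hg, rfl⟩
    obtain ⟨c, hc, h⟩ := exists_pow_dunklHom_prod_X (κ := Fin (q + 1)) (Fintype.card_fin _) a
    refine ⟨_, ⟨c⁻¹ • g, Submodule.smul_mem _ _ hg, rfl⟩, ?_⟩
    have h1 : Commute (dunklHom a (Function.Embedding.refl (Fin (q + 1))) g) (Y ^ a) :=
      Commute.pow_right (hcomm g) a
    have h2 := LinearMap.congr_fun h1 (∏ k, X k ^ (a * (q + 1)))
    rw [Module.End.mul_apply, Module.End.mul_apply, mul_add, mul_one, h, map_smul] at h2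
    simp only [LinearMap.flip_apply, AlgHom.toLinearMap_apply, map_smul]
    rw [mul_add, mul_one, ← h2, smul_smul, inv_mul_cancel₀ hc, one_smul]
  obtain ⟨h1, h2⟩ := inf_ker_eq_of_finrank_le hmap hker hrange (by omega)
  have hWA' : W = symDegree (Fin (q + 1)) (a * (q + 1)) :=
    Submodule.eq_of_le_of_finrank_le hle (by omega)
  refine ⟨by omega, fun f hf h0 => ?_⟩
  rw [← h1, hWA']
  exact ⟨hf, h0⟩

end Chain

section PowCoeff

/-- The generic polynomial `∑ u_i x^i` of degree `b`. -/
noncomputable def genPoly (b : ℕ) : Polynomial (MvPolynomial (Fin (b + 1)) ℂ) :=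
  ∑ i : Fin (b + 1), Polynomial.C (X i) * Polynomial.X ^ (i : ℕ)

/-- The coefficient of `x^j` in the `a`-th power of the generic polynomial. -/
noncomputable def powCoeff (a b j : ℕ) : MvPolynomial (Fin (b + 1)) ℂ :=
  (genPoly b ^ a).coeff j

theorem powCoeff_eq_sum (a b j : ℕ) :
    powCoeff a b j = ∑ s : Fin a → Fin (b + 1),
      if ∑ i, (s i : ℕ) = j then ∏ i, X (s i) else 0 := by
  rw [powCoeff, genPoly, Fintype.sum_pow, Polynomial.finsetSum_coeff]
  refine Finset.sum_congr rfl fun s _ => ?_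
  rw [Finset.prod_mul_distrib, ← map_prod, Finset.prod_pow_eq_pow_sum, Polynomial.coeff_C_mul_X_pow]
  simp only [eq_comm]

theorem isHomogeneous_powCoeff (a b j : ℕ) : (powCoeff a b j).IsHomogeneous a := by
  rw [powCoeff_eq_sum]
  refine IsHomogeneous.sum _ _ _ fun s _ => ?_
  split_ifs
  · have := IsHomogeneous.prod Finset.univ (fun i => (X (s i) : MvPolynomial (Fin (b + 1)) ℂ))
      (fun _ => 1) fun i _ => isHomogeneous_X _ _
    simpa using this
  · exact isHomogeneous_zero _ _ _

theorem mul_mem_restrictSupport {σ R : Type*} [CommSemiring R] {s t u : Set (σ →₀ ℕ)}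
    {f g : MvPolynomial σ R} (hf : f ∈ restrictSupport R s) (hg : g ∈ restrictSupport R t)
    (h : ∀ x ∈ s, ∀ y ∈ t, x + y ∈ u) : f * g ∈ restrictSupport R u := by
  have : f * g ∈ restrictSupport R s * restrictSupport R t := Submodule.mul_mem_mul hf hg
  rw [← restrictSupport_add] at this
  refine restrictSupport_mono R ?_ this
  rintro _ ⟨x, hx, y, hy, rfl⟩
  exact h x hx y hy

/-- The weight `∑ i² m_i` of an exponent. -/
noncomputable def sqWeight (b : ℕ) : (Fin (b + 1) →₀ ℕ) →+ ℕ :=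
  Finsupp.weight fun i : Fin (b + 1) => (i : ℕ) ^ 2

/-- `f` is the monomial with exponent `m` plus terms of the same degree and greater weight. -/
def IsLead {b : ℕ} (m : Fin (b + 1) →₀ ℕ) (f : MvPolynomial (Fin (b + 1)) ℂ) : Prop :=
  f - monomial m 1 ∈ restrictSupport ℂ {d | d.degree = m.degree ∧ sqWeight b m < sqWeight b d}

theorem IsLead.mul {b : ℕ} {m m' : Fin (b + 1) →₀ ℕ} {f f' : MvPolynomial (Fin (b + 1)) ℂ}
    (h : IsLead m f) (h' : IsLead m' f') : IsLead (m + m') (f * f') := by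
  have e : f * f' - monomial (m + m') 1 = (f - monomial m 1) * (f' - monomial m' 1) +
      (monomial m 1 * (f' - monomial m' 1) + (f - monomial m 1) * monomial m' 1) := by
    rw [show (monomial (m + m') 1 : MvPolynomial (Fin (b + 1)) ℂ) =
      monomial m 1 * monomial m' 1 by simp]
    ring
  rw [IsLead, e]
  have hm : ∀ m : Fin (b + 1) →₀ ℕ, (monomial m 1 : MvPolynomial (Fin (b + 1)) ℂ) ∈
      restrictSupport ℂ {m} := fun m => by simp [mem_restrictSupport_iff]
  refine add_mem (mul_mem_restrictSupport h h' ?_) (add_mem (mul_mem_restrictSupport (hm m) h' ?_)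
    (mul_mem_restrictSupport h (hm m') ?_)) <;>
  · rintro x hx y hy
    simp only [Set.mem_ofPred_eq, Set.mem_singleton_iff] at hx hy
    simp only [Set.mem_ofPred_eq, map_add, hx, hy, true_and]
    omega

theorem isLead_monomial {b : ℕ} (m : Fin (b + 1) →₀ ℕ) : IsLead m (monomial m 1) := by
  rw [IsLead, sub_self]
  exact zero_mem _

theorem IsLead.pow {b : ℕ} {m : Fin (b + 1) →₀ ℕ} {f : MvPolynomial (Fin (b + 1)) ℂ}
    (h : IsLead m f) (k : ℕ) : IsLead (k • m) (f ^ k) := by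
  induction k with
  | zero => simpa using isLead_monomial (b := b) 0
  | succ k ih =>
    rw [pow_succ, succ_nsmul]
    exact ih.mul h

theorem IsLead.prod {b : ℕ} {ι : Type*} (s : Finset ι) {m : ι → Fin (b + 1) →₀ ℕ}
    {f : ι → MvPolynomial (Fin (b + 1)) ℂ} (h : ∀ i, IsLead (m i) (f i)) :
    IsLead (∑ i ∈ s, m i) (∏ i ∈ s, f i) := by
  classical
  induction s using Finset.induction_on with
  | empty => simpa using isLead_monomial (b := b) 0
  | insert i s hi ih =>
    rw [Finset.sum_insert hi, Finset.prod_insert hi]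
    exact (h i).mul ih

theorem isLead_powCoeff (a b : ℕ) (l : Fin (b + 1)) :
    IsLead (Finsupp.single l a) (powCoeff a b (a * l)) := by
  have hmon : ∀ s : Fin a → Fin (b + 1), (∏ i, X (s i) : MvPolynomial (Fin (b + 1)) ℂ) =
      monomial (∑ i, Finsupp.single (s i) 1) 1 := fun s => by
    rw [monomial_sum_one]
    rfl
  have hl : (monomial (Finsupp.single l a) 1 : MvPolynomial (Fin (b + 1)) ℂ) =
      if ∑ i : Fin a, (((fun _ => l) : Fin a → Fin (b + 1)) i : ℕ) = a * l then
        ∏ i : Fin a, X (((fun _ => l) : Fin a → Fin (b + 1)) i) else 0 := by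
    rw [if_pos (by simp)]
    simp [X_pow_eq_monomial]
  rw [IsLead, powCoeff_eq_sum, hl, ← Finset.sum_erase_eq_sub (Finset.mem_univ _)]
  refine sum_mem fun s hs => ?_
  have hne := Finset.ne_of_mem_erase hs
  split_ifs with hsum
  · rw [hmon, mem_restrictSupport_iff]
    intro d hd
    have hd := Finset.mem_singleton.mp (support_monomial_subset hd)
    subst hd
    simp only [Set.mem_ofPred_eq, map_sum, Finsupp.degree_single, sqWeight, Finsupp.weight_single]
    refine ⟨by simp, ?_⟩
    simp only [smul_eq_mul, one_mul]
    obtain ⟨i, hi⟩ := Function.ne_iff.mp hne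
    have h1 : ∑ i, ((s i : ℤ) - l) ^ 2 = ∑ i, (s i : ℤ) ^ 2 - a * l ^ 2 := by
      have : (∑ i, (s i : ℤ)) = a * l := by exact_mod_cast hsum
      simp only [sub_sq, Finset.sum_add_distrib, Finset.sum_sub_distrib, ← Finset.sum_mul,
        ← Finset.mul_sum, this]
      simp
      ring
    have h2 : 0 < ∑ i, ((s i : ℤ) - l) ^ 2 := by
      refine Finset.sum_pos' (fun _ _ => sq_nonneg _) ⟨i, Finset.mem_univ _, ?_⟩
      have : (s i : ℤ) - l ≠ 0 := fun h => hi (Fin.ext (by omega))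
      positivity
    zify
    linarith
  · exact zero_mem _

end PowCoeff

section LeadProd

theorem homogeneousSubmodule_eq_restrictSupport (σ : Type*) (n : ℕ) :
    homogeneousSubmodule σ ℂ n = restrictSupport ℂ {d | d.degree = n} :=
  homogeneousSubmodule_eq_finsupp_supported σ ℂ n

theorem finite_setOf_degree_eq (b n : ℕ) : {m : Fin (b + 1) →₀ ℕ | m.degree = n}.Finite := by
  classical
  refine ((Finset.univ : Finset (Fin (b + 1))).finsuppAntidiag n).finite_toSet.subset fun m hm => ?_
  simpa [Finset.mem_finsuppAntidiag, Finsupp.degree_eq_sum] using hm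

theorem finrank_homogeneousSubmodule (b n : ℕ) :
    Module.finrank ℂ (homogeneousSubmodule (Fin (b + 1)) ℂ n) =
      Nat.card {m : Fin (b + 1) →₀ ℕ | m.degree = n} := by
  rw [homogeneousSubmodule_eq_restrictSupport,
    Module.finrank_eq_nat_card_basis (basisRestrictSupport ℂ _)]

theorem finrank_homogeneousSubmodule_eq_choose (b n : ℕ) :
    Module.finrank ℂ (homogeneousSubmodule (Fin (b + 1)) ℂ n) = (n + b).choose b := by
  classical
  rw [finrank_homogeneousSubmodule]
  have : {m : Fin (b + 1) →₀ ℕ | m.degree = n} =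
      ((Finset.univ : Finset (Fin (b + 1))).finsuppAntidiag n : Set _) := by
    ext m
    simp [Finset.mem_finsuppAntidiag, Finsupp.degree_eq_sum]
  rw [this, Nat.card_coe_set_eq, Set.ncard_coe_finset, Finset.card_finsuppAntidiag_nat_eq_choose,
    Finset.card_univ, Fintype.card_fin, ← Nat.choose_symm_add]
  congr 1
  omega

instance (b n : ℕ) : FiniteDimensional ℂ (homogeneousSubmodule (Fin (b + 1)) ℂ n) := by
  have : Finite {m : Fin (b + 1) →₀ ℕ | m.degree = n} := finite_setOf_degree_eq b n
  rw [homogeneousSubmodule_eq_restrictSupport]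
  exact Module.Finite.of_basis (basisRestrictSupport ℂ _)

/-- The form of multidegree `m` built from the `a`-th powers `u_l^a`, each replaced by the
coefficient of `x^{al}`. -/
noncomputable def leadProd (a b : ℕ) (m : Fin (b + 1) →₀ ℕ) : MvPolynomial (Fin (b + 1)) ℂ :=
  ∏ l : Fin (b + 1), (powCoeff a b (a * l) ^ (m l / a) * X l ^ (m l % a))

theorem isLead_leadProd (a b : ℕ) (m : Fin (b + 1) →₀ ℕ) : IsLead m (leadProd a b m) := by
  have h : ∀ l, IsLead (Finsupp.single l (m l))
      (powCoeff a b (a * l) ^ (m l / a) * X l ^ (m l % a)) := fun l => by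
    have h1 := ((isLead_powCoeff a b l).pow (m l / a)).mul
      (isLead_monomial (Finsupp.single l (m l % a)))
    rwa [Finsupp.smul_single, ← Finsupp.single_add, smul_eq_mul, Nat.div_add_mod',
      ← X_pow_eq_monomial] at h1
  have := IsLead.prod Finset.univ h
  rwa [Finsupp.univ_sum_single] at this

theorem IsLead.isHomogeneous {b : ℕ} {m : Fin (b + 1) →₀ ℕ} {f : MvPolynomial (Fin (b + 1)) ℂ}
    (h : IsLead m f) : f.IsHomogeneous m.degree := by
  rw [← mem_homogeneousSubmodule, homogeneousSubmodule_eq_restrictSupport,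
    ← sub_add_cancel f (monomial m 1)]
  refine add_mem (restrictSupport_mono ℂ (fun d hd => hd.1) h) ?_
  rw [← homogeneousSubmodule_eq_restrictSupport, mem_homogeneousSubmodule]
  exact isHomogeneous_monomial _ rfl

theorem sqWeight_le (b : ℕ) (m : Fin (b + 1) →₀ ℕ) : sqWeight b m ≤ m.degree * b ^ 2 := by
  rw [sqWeight, Finsupp.weight_apply, Finsupp.sum_fintype _ _ (by simp), Finsupp.degree_eq_sum,
    Finset.sum_mul]
  refine Finset.sum_le_sum fun i _ => ?_
  have : (i : ℕ) ≤ b := by omega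
  rw [smul_eq_mul]
  gcongr

theorem homogeneousSubmodule_le_span_leadProd (a b n : ℕ) :
    homogeneousSubmodule (Fin (b + 1)) ℂ n ≤
      Submodule.span ℂ (leadProd a b '' {m | m.degree = n}) := by
  have key : ∀ k, ∀ m : Fin (b + 1) →₀ ℕ, m.degree = n → n * b ^ 2 ≤ sqWeight b m + k →
      monomial m (1 : ℂ) ∈ Submodule.span ℂ (leadProd a b '' {m | m.degree = n}) := by
    intro k
    induction k with
    | zero =>
      intro m hm hk
      have h := isLead_leadProd a b m
      have : leadProd a b m = monomial m 1 := by
        rw [← sub_eq_zero, ← support_eq_empty, Finset.eq_empty_iff_forall_notMem]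
        intro d hd
        have h1 := (mem_restrictSupport_iff ℂ).mp h hd
        have h2 := sqWeight_le b d
        rw [Set.mem_ofPred_eq, hm] at h1
        rw [h1.1] at h2
        omega
      rw [← this]
      exact Submodule.subset_span ⟨m, hm, rfl⟩
    | succ k ih =>
      intro m hm hk
      have h := isLead_leadProd a b m
      rw [show monomial m (1 : ℂ) = leadProd a b m - (leadProd a b m - monomial m 1) by ring]
      refine sub_mem (Submodule.subset_span ⟨m, hm, rfl⟩) ?_
      rw [IsLead, restrictSupport_eq_span] at h
      refine Submodule.span_le.mpr ?_ h
      rintro _ ⟨d, hd, rfl⟩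
      rw [Set.mem_ofPred_eq, hm] at hd
      exact ih d hd.1 (by omega)
  rw [homogeneousSubmodule_eq_restrictSupport, restrictSupport_eq_span, Submodule.span_le]
  rintro _ ⟨d, hd, rfl⟩
  exact key _ d hd (Nat.le_add_left _ _)

theorem linearIndependent_leadProd (a b n : ℕ) :
    LinearIndependent ℂ
      fun m : {m : Fin (b + 1) →₀ ℕ | m.degree = n} => leadProd a b (m : Fin (b + 1) →₀ ℕ) := by
  have : Fintype {m : Fin (b + 1) →₀ ℕ | m.degree = n} := (finite_setOf_degree_eq b n).fintype
  let w : {m : Fin (b + 1) →₀ ℕ | m.degree = n} → homogeneousSubmodule (Fin (b + 1)) ℂ n :=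
    fun m => ⟨leadProd a b m, by
      have := (isLead_leadProd a b (m : Fin (b + 1) →₀ ℕ)).isHomogeneous
      rwa [show (m : Fin (b + 1) →₀ ℕ).degree = n from m.2] at this⟩
  have hw : LinearIndependent ℂ w := by
    refine linearIndependent_of_top_le_span_of_card_eq_finrank ?_ ?_
    · rintro ⟨f, hf⟩ -
      have h1 := homogeneousSubmodule_le_span_leadProd a b n hf
      have h2 : leadProd a b '' {m | m.degree = n} =
          (homogeneousSubmodule (Fin (b + 1)) ℂ n).subtype '' Set.range w := by
        rw [← Set.range_comp, Set.image_eq_range]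
        rfl
      rw [h2, Submodule.span_image] at h1
      obtain ⟨g, hg, hgf⟩ := h1
      rwa [show g = ⟨f, hf⟩ from Subtype.ext hgf] at hg
    · rw [finrank_homogeneousSubmodule, Nat.card_eq_fintype_card]
  exact hw.map' (Submodule.subtype _) (Submodule.ker_subtype _)

theorem exists_linearMap_leadProd (a b n : ℕ) {Q : Type*} [AddCommGroup Q] [Module ℂ Q]
    (φ : (Fin (b + 1) →₀ ℕ) → Q) :
    ∃ β : MvPolynomial (Fin (b + 1)) ℂ →ₗ[ℂ] Q, ∀ m, m.degree = n → β (leadProd a b m) = φ m := by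
  have h := linearIndependent_leadProd a b n
  obtain ⟨β, hβ⟩ := LinearMap.exists_extend ((Module.Basis.span h).constr ℂ fun m => φ m)
  refine ⟨β, fun m hm => ?_⟩
  have h1 := LinearMap.congr_fun hβ ((Module.Basis.span h) ⟨m, hm⟩)
  rw [Module.Basis.constr_basis, LinearMap.comp_apply, Submodule.subtype_apply,
    Module.Basis.span_apply] at h1
  exact h1

theorem powCoeff_mul_leadProd {a : ℕ} (ha : a ≠ 0) (b : ℕ) (l : Fin (b + 1))
    (m : Fin (b + 1) →₀ ℕ) :
    powCoeff a b (a * l) * leadProd a b m = leadProd a b (m + Finsupp.single l a) := by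
  rw [leadProd, leadProd, ← Finset.mul_prod_erase _ _ (Finset.mem_univ l),
    ← Finset.mul_prod_erase (a := l) _ _ (Finset.mem_univ l), ← mul_assoc, ← mul_assoc, ← pow_succ']
  congr 1
  · simp [Nat.add_div_right _ (Nat.pos_of_ne_zero ha)]
  · refine Finset.prod_congr rfl fun i hi => ?_
    simp [Finsupp.single_eq_of_ne (Finset.ne_of_mem_erase hi)]

theorem exists_eq_add_single {a b : ℕ} {m : Fin (b + 1) →₀ ℕ}
    (hm : (a - 1) * (b + 1) < m.degree) :
    ∃ (l : Fin (b + 1)) (m' : Fin (b + 1) →₀ ℕ), m = m' + Finsupp.single l a := by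
  have : ∃ l, a ≤ m l := by
    by_contra! h
    rw [Finsupp.degree_eq_sum] at hm
    have := Finset.sum_le_card_nsmul Finset.univ (fun i => m i) (a - 1) fun i _ => by
      have := h i
      omega
    simp only [Finset.card_univ, Fintype.card_fin, smul_eq_mul] at this
    rw [mul_comm] at this
    omega
  obtain ⟨l, hl⟩ := this
  refine ⟨l, m - Finsupp.single l a, (tsub_add_cancel_of_le ?_).symm⟩
  rwa [Finsupp.single_le_iff]

end LeadProd

section GenFun

/-- The exponent with values in an initial segment of `ℕ`. -/
noncomputable def toExponent {κ : Type*} [Finite κ] {d : ℕ} (s : κ → Fin (d + 1)) : κ →₀ ℕ :=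
  Finsupp.equivFunOnFinite.symm fun i => (s i : ℕ)

theorem toExponent_apply {κ : Type*} [Finite κ] {d : ℕ} (s : κ → Fin (d + 1)) (i : κ) :
    toExponent s i = s i := rfl

theorem toExponent_injective {κ : Type*} [Finite κ] {d : ℕ} :
    Function.Injective (toExponent : (κ → Fin (d + 1)) → κ →₀ ℕ) := fun s s' h => by
  funext i
  exact Fin.ext (DFunLike.congr_fun h i)

variable {κ : Type*} [Fintype κ] {A : Type*} [CommRing A] [Algebra ℂ A] {d : ℕ}

/-- The generating polynomial of the values of a functional on the products of a family `c`. -/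
noncomputable def genFun (κ : Type*) [Fintype κ] (c : Fin (d + 1) → A) (θ : A →ₗ[ℂ] ℂ) :
    MvPolynomial κ ℂ :=
  open Classical in ∑ s : κ → Fin (d + 1), monomial (toExponent s) (θ (∏ i, c (s i)))

theorem coeff_toExponent_genFun (c : Fin (d + 1) → A) (θ : A →ₗ[ℂ] ℂ) (s : κ → Fin (d + 1)) :
    coeff (toExponent s) (genFun κ c θ) = θ (∏ i, c (s i)) := by
  classical
  rw [genFun, coeff_sum, Finset.sum_eq_single s]
  · rw [coeff_monomial, if_pos rfl]
  · intro s' _ hs'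
    rw [coeff_monomial, if_neg fun h => hs' (toExponent_injective h)]
  · simp

theorem coeff_genFun_eq_zero (c : Fin (d + 1) → A) (θ : A →ₗ[ℂ] ℂ) {m : κ →₀ ℕ} {i : κ}
    (hm : d < m i) : coeff m (genFun κ c θ) = 0 := by
  classical
  rw [genFun, coeff_sum, Finset.sum_eq_zero]
  intro s _
  rw [coeff_monomial, if_neg]
  rintro rfl
  rw [toExponent_apply] at hm
  omega

theorem genFun_eq_iff {c : Fin (d + 1) → A} {θ : A →ₗ[ℂ] ℂ} {f : MvPolynomial κ ℂ} :
    genFun κ c θ = f ↔ (∀ i, degreeOf i f ≤ d) ∧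
      ∀ s : κ → Fin (d + 1), coeff (toExponent s) f = θ (∏ i, c (s i)) := by
  constructor
  · rintro rfl
    refine ⟨fun i => degreeOf_le_iff.mpr fun m hm => ?_, coeff_toExponent_genFun c θ⟩
    by_contra! h
    exact mem_support_iff.mp hm (coeff_genFun_eq_zero c θ h)
  · rintro ⟨h1, h2⟩
    ext m
    by_cases hm : ∀ i, m i ≤ d
    · obtain ⟨s, rfl⟩ : ∃ s : κ → Fin (d + 1), toExponent s = m :=
        ⟨fun i => ⟨m i, Nat.lt_succ_of_le (hm i)⟩, by ext; rfl⟩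
      rw [coeff_toExponent_genFun, h2]
    · push Not at hm
      obtain ⟨i, hi⟩ := hm
      rw [coeff_genFun_eq_zero c θ hi]
      by_contra! h
      exact absurd (degreeOf_le_iff.mp (h1 i) m (mem_support_iff.mpr h.symm)) (by omega)

theorem genFun_mem_symDegree (c : Fin (d + 1) → A) (θ : A →ₗ[ℂ] ℂ) :
    genFun κ c θ ∈ symDegree κ d := by
  rw [mem_symDegree]
  have h := genFun_eq_iff.mp (rfl : genFun κ c θ = _)
  refine ⟨fun e => Eq.symm (genFun_eq_iff.mpr ⟨fun i => ?_, fun s => ?_⟩), h.1⟩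
  · obtain ⟨i, rfl⟩ := e.surjective i
    rw [degreeOf_rename_of_injective e.injective]
    exact h.1 i
  · have : toExponent s = (toExponent (s ∘ e)).mapDomain e := by
      ext i
      obtain ⟨i, rfl⟩ := e.surjective i
      rw [Finsupp.mapDomain_apply e.injective]
      rfl
    rw [this, coeff_rename_mapDomain _ e.injective, coeff_toExponent_genFun]
    congr 1
    exact Equiv.prod_comp e fun i => c (s i)

/-- `genFun` as a linear map. -/
noncomputable def genFunHom (κ : Type*) [Fintype κ] (c : Fin (d + 1) → A) :
    Module.Dual ℂ A →ₗ[ℂ] MvPolynomial κ ℂ where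
  toFun := genFun κ c
  map_add' θ θ' := by simp [genFun, Finset.sum_add_distrib]
  map_smul' r θ := by simp [genFun, Finset.smul_sum, smul_monomial]

/-- The span of the products of a family `c` indexed by `κ`. -/
def prodSpan (κ : Type*) [Fintype κ] (c : Fin (d + 1) → A) : Submodule ℂ A :=
  Submodule.span ℂ (Set.range fun s : κ → Fin (d + 1) => ∏ i, c (s i))

theorem genFun_eq_zero_iff {c : Fin (d + 1) → A} {θ : A →ₗ[ℂ] ℂ} :
    genFun κ c θ = 0 ↔ prodSpan κ c ≤ LinearMap.ker θ := by
  rw [genFun_eq_iff, prodSpan, Submodule.span_le, Set.range_subset_iff]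
  simp [eq_comm]

instance (c : Fin (d + 1) → A) : FiniteDimensional ℂ (prodSpan κ c) := by
  classical
  exact FiniteDimensional.span_of_finite ℂ (Set.finite_range _)

theorem finrank_range_genFunHom (c : Fin (d + 1) → A) :
    Module.finrank ℂ (LinearMap.range (genFunHom κ c)) = Module.finrank ℂ (prodSpan κ c) := by
  have h : LinearMap.ker (genFunHom κ c) = LinearMap.ker (prodSpan κ c).subtype.dualMap := by
    ext θ
    rw [LinearMap.mem_ker, LinearMap.mem_ker]
    refine genFun_eq_zero_iff.trans ?_
    rw [LinearMap.ext_iff]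
    exact ⟨fun h x => h x.2, fun h x hx => h ⟨x, hx⟩⟩
  have h' : Module.finrank ℂ (LinearMap.range (prodSpan κ c).subtype.dualMap) =
      Module.finrank ℂ (prodSpan κ c) := by
    rw [LinearMap.range_eq_top.mpr (LinearMap.dualMap_surjective_of_injective
      (Submodule.subtype_injective (prodSpan κ c))), finrank_top, Subspace.dual_finrank_eq]
  rw [← h']
  exact ((genFunHom κ c).quotKerEquivRange.symm.trans ((Submodule.quotEquivOfEq _ _ h).trans
    (prodSpan κ c).subtype.dualMap.quotKerEquivRange)).finrank_eq

end GenFun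

section EvalRoots

/-- Evaluation at the coefficients of the monic polynomial with roots `t`. -/
noncomputable def evalRoots {q : ℕ} (t : Fin q → ℂ) : MvPolynomial (Fin (q + 1)) ℂ →ₐ[ℂ] ℂ :=
  aeval fun i : Fin (q + 1) => (∏ j, (Polynomial.X - Polynomial.C (t j))).coeff i

theorem map_evalRoots_genPoly {q : ℕ} (t : Fin q → ℂ) :
    (genPoly q).map (evalRoots t : MvPolynomial (Fin (q + 1)) ℂ →+* ℂ) =
      ∏ j, (Polynomial.X - Polynomial.C (t j)) := by
  have hd : (∏ j, (Polynomial.X - Polynomial.C (t j))).natDegree < q + 1 := by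
    rw [Polynomial.natDegree_prod_of_monic _ _ fun j _ => Polynomial.monic_X_sub_C (t j)]
    simp
  set P := ∏ j, (Polynomial.X - Polynomial.C (t j)) with hP
  rw [P.as_sum_range_C_mul_X_pow' hd,
    ← Fin.sum_univ_eq_sum_range fun i => Polynomial.C (P.coeff i) * Polynomial.X ^ i]
  simp [genPoly, Polynomial.map_sum, evalRoots, hP]

theorem evalRoots_powCoeff {q : ℕ} (t : Fin q → ℂ) (a j : ℕ) :
    evalRoots t (powCoeff a q j) = ((∏ j, (Polynomial.X - Polynomial.C (t j))) ^ a).coeff j := by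
  rw [← map_evalRoots_genPoly, ← Polynomial.map_pow, Polynomial.coeff_map]
  rfl

theorem natDegree_genPoly_le (b : ℕ) : (genPoly b).natDegree ≤ b :=
  Polynomial.natDegree_sum_le_of_forall_le _ _ fun i _ =>
    (Polynomial.natDegree_C_mul_X_pow_le _ _).trans (by omega)

theorem powCoeff_eq_zero {a b j : ℕ} (h : a * b < j) : powCoeff a b j = 0 :=
  Polynomial.coeff_eq_zero_of_natDegree_lt
    ((Polynomial.natDegree_pow_le_of_le a (natDegree_genPoly_le b)).trans_lt h)

theorem genFun_evalRoots {q : ℕ} (a : ℕ) {κ : Type*} [Fintype κ] [DecidableEq κ] (t : Fin q → ℂ) :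
    genFun κ (fun j : Fin (a * q + 1) => powCoeff a q j) (evalRoots t).toLinearMap =
      specialize t (kernelPoly (Fin q) κ a) := by
  set P : Polynomial ℂ := (∏ j, (Polynomial.X - Polynomial.C (t j))) ^ a with hP
  have hd : P.natDegree < a * q + 1 := by
    refine Nat.lt_succ_of_le (Polynomial.natDegree_pow_le_of_le a ?_)
    rw [Polynomial.natDegree_prod_of_monic _ _ fun j _ => Polynomial.monic_X_sub_C (t j)]
    simp
  have h1 : specialize t (kernelPoly (Fin q) κ a) = ∏ k : κ, Polynomial.aeval (X k) P := by
    rw [kernelPoly, map_prod, Fintype.prod_prod_type]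
    refine Finset.prod_congr rfl fun k _ => ?_
    simp only [hP, linFactor, map_pow, map_sub, map_prod, specialize_X_inl, specialize_X_inr,
      Polynomial.aeval_X, Polynomial.aeval_C, algebraMap_eq, Finset.prod_pow]
  have h2 : ∀ k : κ, Polynomial.aeval (X k : MvPolynomial κ ℂ) P =
      ∑ j : Fin (a * q + 1), P.coeff j • X k ^ (j : ℕ) := fun k => by
    rw [Polynomial.aeval_eq_sum_range' hd,
      Fin.sum_univ_eq_sum_range fun j => P.coeff j • (X k : MvPolynomial κ ℂ) ^ j]
  rw [h1]
  simp_rw [h2]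
  rw [Finset.prod_univ_sum, Fintype.piFinset_univ, genFun]
  refine Finset.sum_congr (by ext; simp) fun s _ => ?_
  rw [AlgHom.toLinearMap_apply, map_prod, monomial_eq, map_prod, Finsupp.prod_fintype _ _ (by simp),
    ← Finset.prod_mul_distrib]
  refine Finset.prod_congr rfl fun k _ => ?_
  rw [evalRoots_powCoeff, smul_eq_C_mul, toExponent_apply]

theorem eval_smul_of_isHomogeneous {σ : Type*} {f : MvPolynomial σ ℂ} {n : ℕ}
    (hf : f.IsHomogeneous n) (r : ℂ) (x : σ → ℂ) : eval (r • x) f = r ^ n * eval x f := by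
  rw [eval_eq, eval_eq, Finset.mul_sum]
  refine Finset.sum_congr rfl fun m hm => ?_
  have h : m.degree = n :=
    (DFunLike.congr_fun Finsupp.degree_eq_weight_one m).trans (hf (mem_support_iff.mp hm))
  simp only [Pi.smul_apply, smul_eq_mul, mul_pow, Finset.prod_mul_distrib, Finset.prod_pow_eq_pow_sum]
  rw [← h, Finsupp.degree_apply]
  ring

theorem eq_zero_of_evalRoots {q n : ℕ} {f : MvPolynomial (Fin (q + 1)) ℂ} (hf : f.IsHomogeneous n)
    (h : ∀ t : Fin q → ℂ, evalRoots t f = 0) : f = 0 := by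
  have h1 : f * X (Fin.last q) = 0 := by
    refine MvPolynomial.funext fun x => ?_
    rw [map_mul, eval_X, map_zero]
    by_cases hx : x (Fin.last q) = 0
    · rw [hx, mul_zero]
    set r := x (Fin.last q)
    let P : Polynomial ℂ := ∑ i : Fin (q + 1), Polynomial.C (r⁻¹ * x i) * Polynomial.X ^ (i : ℕ)
    have hc : ∀ i : Fin (q + 1), P.coeff i = r⁻¹ * x i := fun i => by
      simp only [P, Polynomial.finsetSum_coeff, Polynomial.coeff_C_mul_X_pow, Fin.val_inj]
      simp
    have hd : P.natDegree ≤ q := Polynomial.natDegree_sum_le_of_forall_le _ _ fun i _ =>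
      (Polynomial.natDegree_C_mul_X_pow_le _ _).trans (by omega)
    have hq : P.coeff q = 1 := by
      have := hc (Fin.last q)
      rwa [Fin.val_last, inv_mul_cancel₀ hx] at this
    have hm : P.Monic := Polynomial.monic_of_natDegree_le_of_coeff_eq_one q hd hq
    have hdeg : P.natDegree = q := le_antisymm hd
      (Polynomial.le_natDegree_of_ne_zero (by rw [hq]; exact one_ne_zero))
    have hs := IsAlgClosed.splits P
    have hcard : P.roots.toList.length = q := by
      rw [Multiset.length_toList, ← hs.natDegree_eq_card_roots, hdeg]
    obtain ⟨t, ht⟩ : ∃ t : Fin q → ℂ, List.ofFn t = P.roots.toList := by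
      rw [← hcard]
      exact ⟨_, List.ofFn_get _⟩
    have hP : P = ∏ j, (Polynomial.X - Polynomial.C (t j)) := by
      conv_lhs => rw [hs.eq_prod_roots, hm.leadingCoeff, Polynomial.C_1, one_mul,
        ← Multiset.coe_toList P.roots, Multiset.map_coe, Multiset.prod_coe, ← ht, List.map_ofFn,
        List.prod_ofFn]
      rfl
    have hx' : x = r • fun i : Fin (q + 1) => (∏ j, (Polynomial.X - Polynomial.C (t j))).coeff i := by
      funext i
      rw [← hP, Pi.smul_apply, hc, smul_eq_mul, mul_inv_cancel_left₀ hx]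
    have h2 := h t
    rw [evalRoots, aeval_eq_eval] at h2
    rw [hx', eval_smul_of_isHomogeneous hf]
    erw [h2]
    simp
  exact (mul_eq_zero.mp h1).resolve_right (X_ne_zero _)

end EvalRoots

section Spanning

/-- The coefficients of the `a`-th power of the generic polynomial of degree `q`. -/
noncomputable def powCoeffs (a q : ℕ) (j : Fin (a * q + 1)) : MvPolynomial (Fin (q + 1)) ℂ :=
  powCoeff a q j

theorem prodSpan_powCoeffs_le (a q : ℕ) (κ : Type*) [Fintype κ] :
    prodSpan κ (powCoeffs a q) ≤
      homogeneousSubmodule (Fin (q + 1)) ℂ (a * Fintype.card κ) := by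
  rw [prodSpan, Submodule.span_le]
  rintro _ ⟨s, rfl⟩
  have := IsHomogeneous.prod Finset.univ (fun i => powCoeffs a q (s i)) (fun _ => a)
    fun i _ => isHomogeneous_powCoeff a q (s i)
  rwa [Finset.sum_const, smul_eq_mul, mul_comm] at this

theorem span_evalRoots_restrict_eq_top (q n : ℕ) :
    (Submodule.span ℂ (Set.range fun t : Fin q → ℂ => (evalRoots t).toLinearMap)).map
      (homogeneousSubmodule (Fin (q + 1)) ℂ n).subtype.dualMap = ⊤ := by
  have h0 : ((Submodule.span ℂ (Set.range fun t : Fin q → ℂ => (evalRoots t).toLinearMap)).map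
      (homogeneousSubmodule (Fin (q + 1)) ℂ n).subtype.dualMap).dualCoannihilator = ⊥ := by
    rw [eq_bot_iff]
    intro f hf
    rw [Submodule.mem_dualCoannihilator] at hf
    exact (Submodule.mem_bot ℂ).mpr (Subtype.ext (eq_zero_of_evalRoots f.2 fun t =>
      hf _ (Submodule.mem_map_of_mem (Submodule.subset_span ⟨t, rfl⟩))))
  rw [← Subspace.dualCoannihilator_dualAnnihilator_eq (W := Submodule.map _ _), h0,
    Submodule.dualAnnihilator_bot]

theorem splitSpan_eq_range_genFunHom (a q : ℕ) (κ : Type*) [Fintype κ] [DecidableEq κ] :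
    splitSpan (Fin q) κ a = LinearMap.range (genFunHom κ (powCoeffs a q)) := by
  have h1 : splitSpan (Fin q) κ a =
      (Submodule.span ℂ (Set.range fun t : Fin q → ℂ => (evalRoots t).toLinearMap)).map
        (genFunHom κ (powCoeffs a q)) := by
    rw [Submodule.map_span, ← Set.range_comp, splitSpan]
    congr 2
    funext t
    exact (genFun_evalRoots a t).symm
  refine le_antisymm (h1 ▸ LinearMap.map_le_range) ?_
  rintro _ ⟨θ, rfl⟩
  have h2 := span_evalRoots_restrict_eq_top q (a * Fintype.card κ)
  have h3 : (homogeneousSubmodule (Fin (q + 1)) ℂ (a * Fintype.card κ)).subtype.dualMap θ ∈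
    (⊤ : Submodule ℂ _) := trivial
  rw [← h2] at h3
  obtain ⟨ψ, hψ, h⟩ := h3
  have h4 : genFunHom κ (powCoeffs a q) θ = genFunHom κ (powCoeffs a q) ψ := by
    rw [← sub_eq_zero, ← map_sub]
    refine genFun_eq_zero_iff.mpr fun f hf => ?_
    have := LinearMap.congr_fun h ⟨f, prodSpan_powCoeffs_le a q κ hf⟩
    rw [LinearMap.mem_ker, LinearMap.sub_apply, sub_eq_zero]
    exact this.symm
  rw [h4, h1]
  exact Submodule.mem_map_of_mem hψ

theorem finrank_splitSpan (a q : ℕ) (κ : Type*) [Fintype κ] [DecidableEq κ] :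
    Module.finrank ℂ (splitSpan (Fin q) κ a) =
      Module.finrank ℂ (prodSpan κ (powCoeffs a q)) := by
  rw [splitSpan_eq_range_genFunHom, finrank_range_genFunHom]

theorem mul_mem_prodSpan_succ {A : Type*} [CommRing A] [Algebra ℂ A] {d k : ℕ}
    (c : Fin (d + 1) → A) (j : Fin (d + 1)) {f : A} (hf : f ∈ prodSpan (Fin k) c) :
    c j * f ∈ prodSpan (Fin (k + 1)) c := by
  rw [prodSpan] at hf
  induction hf using Submodule.span_induction with
  | mem f hf =>
    obtain ⟨s, rfl⟩ := hf
    refine Submodule.subset_span ⟨Fin.cons j s, ?_⟩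
    simp [Fin.prod_univ_succ]
  | zero => rw [mul_zero]; exact zero_mem _
  | add f g _ _ hf hg => rw [mul_add]; exact add_mem hf hg
  | smul r f _ hf => rw [mul_smul_comm]; exact Submodule.smul_mem _ _ hf

theorem leadProd_mem_of_degree_eq {a q k : ℕ} (ha : a ≠ 0) (hk : q ≤ k)
    {m : Fin (q + 1) →₀ ℕ} (hm : m.degree = a * (k + 1)) :
    ∃ (l : Fin (q + 1)) (m' : Fin (q + 1) →₀ ℕ), m = m' + Finsupp.single l a ∧
      m'.degree = a * k := by
  obtain ⟨l, m', rfl⟩ := exists_eq_add_single (a := a) (m := m) (by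
    rw [hm]
    exact Nat.mul_lt_mul_of_lt_of_le (by omega) (by omega) (by omega))
  refine ⟨l, m', rfl, ?_⟩
  rw [map_add, Finsupp.degree_single] at hm
  linarith

theorem prodSpan_succ_eq {a q k : ℕ} (ha : a ≠ 0) (hk : q ≤ k)
    (h : prodSpan (Fin k) (powCoeffs a q) = homogeneousSubmodule (Fin (q + 1)) ℂ (a * k)) :
    prodSpan (Fin (k + 1)) (powCoeffs a q) =
      homogeneousSubmodule (Fin (q + 1)) ℂ (a * (k + 1)) := by
  refine le_antisymm (by simpa using prodSpan_powCoeffs_le a q (Fin (k + 1))) ?_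
  refine (homogeneousSubmodule_le_span_leadProd a q _).trans (Submodule.span_le.mpr ?_)
  rintro _ ⟨m, hm, rfl⟩
  obtain ⟨l, m', rfl, hm'⟩ := leadProd_mem_of_degree_eq ha hk hm
  have h1 : leadProd a q m' ∈ prodSpan (Fin k) (powCoeffs a q) := by
    rw [h, mem_homogeneousSubmodule, ← hm']
    exact (isLead_leadProd a q m').isHomogeneous
  rw [← powCoeff_mul_leadProd ha]
  exact mul_mem_prodSpan_succ (powCoeffs a q)
    ⟨a * l, Nat.lt_succ_of_le (Nat.mul_le_mul_left a (by omega))⟩ h1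

theorem prodSpan_eq_of_le {a q : ℕ} (ha : a ≠ 0)
    (h : prodSpan (Fin q) (powCoeffs a q) = homogeneousSubmodule (Fin (q + 1)) ℂ (a * q))
    {k : ℕ} (hk : q ≤ k) :
    prodSpan (Fin k) (powCoeffs a q) = homogeneousSubmodule (Fin (q + 1)) ℂ (a * k) := by
  induction k, hk using Nat.le_induction with
  | base => exact h
  | succ k hk ih => exact prodSpan_succ_eq ha hk ih

theorem choose_le_finrank_splitSpan {a q : ℕ}
    (h : prodSpan (Fin (q + 1)) (powCoeffs a q) =
      homogeneousSubmodule (Fin (q + 1)) ℂ (a * (q + 1))) :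
    (a * (q + 1) + q).choose q ≤ Module.finrank ℂ (splitSpan (Fin q) (Fin (q + 1)) a) := by
  rw [finrank_splitSpan, h, finrank_homogeneousSubmodule_eq_choose]

theorem prodSpan_powCoeffs_self {a : ℕ} (ha : a ≠ 0) (q : ℕ) :
    prodSpan (Fin q) (powCoeffs a q) = homogeneousSubmodule (Fin (q + 1)) ℂ (a * q) := by
  induction q with
  | zero =>
    refine le_antisymm (by simpa using prodSpan_powCoeffs_le a 0 (Fin 0)) ?_
    change homogeneousSubmodule (Fin 1) ℂ 0 ≤ _
    rw [homogeneousSubmodule_zero, Submodule.one_eq_span, Submodule.span_le,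
      Set.singleton_subset_iff]
    exact Submodule.subset_span ⟨Fin.elim0, by simp⟩
  | succ q ih =>
    have h1 := (splitSpan_chain ha (choose_le_finrank_splitSpan (prodSpan_succ_eq ha le_rfl ih))).1
    refine Submodule.eq_of_le_of_finrank_eq
      (by simpa using prodSpan_powCoeffs_le a (q + 1) (Fin (q + 1))) ?_
    rw [← finrank_splitSpan, h1, finrank_homogeneousSubmodule_eq_choose]

theorem prodSpan_powCoeffs {a q k : ℕ} (ha : a ≠ 0) (hk : q ≤ k) :
    prodSpan (Fin k) (powCoeffs a q) = homogeneousSubmodule (Fin (q + 1)) ℂ (a * k) :=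
  prodSpan_eq_of_le ha (prodSpan_powCoeffs_self ha q) hk

/-- Symmetric polynomials killed by the product of all Dunkl operators are generating
polynomials of functionals. -/
theorem exists_genFun_eq_of_dunklHom_eq_zero {a q : ℕ} (ha : a ≠ 0)
    {f : MvPolynomial (Fin (q + 1)) ℂ} (hf : f ∈ symDegree (Fin (q + 1)) (a * (q + 1)))
    (h : dunklHom (a : ℂ) (Function.Embedding.refl _) (∏ i, X i) f = 0) :
    ∃ θ, genFun (Fin (q + 1)) (powCoeffs a q) θ = f := by
  have h1 := (splitSpan_chain ha (choose_le_finrank_splitSpan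
    (prodSpan_powCoeffs ha (Nat.le_succ q)))).2 f hf h
  rw [splitSpan_eq_range_genFunHom] at h1
  exact h1

end Spanning

section Alternate

set_option linter.unusedSectionVars false

variable {κ : Type*} [Fintype κ] [DecidableEq κ]

/-- The signed sum over all permutations of the variables. -/
noncomputable def alternate (κ : Type*) [Fintype κ] [DecidableEq κ] :
    MvPolynomial κ ℂ →ₗ[ℂ] MvPolynomial κ ℂ :=
  ∑ w : Equiv.Perm κ, ((w.sign : ℤ) : ℂ) • (rename w : MvPolynomial κ ℂ →ₐ[ℂ] _).toLinearMap

theorem alternate_apply (f : MvPolynomial κ ℂ) :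
    alternate κ f = ∑ w : Equiv.Perm κ, ((w.sign : ℤ) : ℂ) • rename w f := by
  simp [alternate, LinearMap.sum_apply]

theorem alternate_swapVar {i j : κ} (h : i ≠ j) (f : MvPolynomial κ ℂ) :
    alternate κ (swapVar i j f) = -alternate κ f := by
  rw [alternate_apply, alternate_apply, ← Finset.sum_neg_distrib]
  refine Fintype.sum_equiv (Equiv.mulRight (Equiv.swap i j)) _ _ fun w => ?_
  rw [Equiv.coe_mulRight, Equiv.Perm.sign_mul, Equiv.Perm.sign_swap h, swapVar, rename_rename]
  simp [Equiv.Perm.coe_mul]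

theorem alternate_eq_zero {i j : κ} (h : i ≠ j) {f : MvPolynomial κ ℂ} (hf : swapVar i j f = f) :
    alternate κ f = 0 := by
  have := alternate_swapVar h f
  rw [hf] at this
  exact self_eq_neg.mp this

theorem alternate_mul_divDiff {i j : κ} (h : i ≠ j) (f g : MvPolynomial κ ℂ) :
    alternate κ (g * divDiff i j f) = alternate κ (divDiff i j g * f) := by
  rw [← sub_eq_zero, ← map_sub]
  refine alternate_eq_zero h (mul_left_cancel₀ (X_sub_X_ne_zero h) ?_)
  have h1 : (X i - X j) * (g * divDiff i j f - divDiff i j g * f) =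
      swapVar i j g * f - g * swapVar i j f := by
    linear_combination g * X_sub_X_mul_divDiff i j f - f * X_sub_X_mul_divDiff i j g
  have h2 := congrArg (swapVar i j) h1
  simp only [map_mul, map_sub, swapVar_X, Equiv.swap_apply_left, Equiv.swap_apply_right,
    swapVar_swapVar] at h2
  rw [h1]
  simp only [map_mul, map_sub]
  linear_combination -h2

theorem alternate_mul_of_isSymmetric (g : MvPolynomial κ ℂ) {f : MvPolynomial κ ℂ}
    (hf : f.IsSymmetric) : alternate κ (g * f) = alternate κ g * f := by
  rw [alternate_apply, alternate_apply, Finset.sum_mul]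
  refine Finset.sum_congr rfl fun w _ => ?_
  rw [map_mul, hf w, smul_mul_assoc]

/-- The monomial with exponent function `e`. -/
noncomputable def monoPow (e : κ → ℕ) : MvPolynomial κ ℂ := ∏ k, X k ^ e k

theorem rename_monoPow (w : Equiv.Perm κ) (e : κ → ℕ) :
    rename w (monoPow e) = monoPow (e ∘ w.symm) := by
  rw [monoPow, monoPow, map_prod]
  refine Fintype.prod_equiv w _ _ fun k => ?_
  simp

theorem monoPow_eq_monomial (e : κ → ℕ) :
    monoPow e = monomial (Finsupp.equivFunOnFinite.symm e) 1 := by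
  rw [monomial_eq, Finsupp.prod_fintype _ _ (by simp), C_1, one_mul]
  rfl

theorem swapVar_monoPow {i j : κ} {e : κ → ℕ} (h : e i = e j) :
    swapVar i j (monoPow e) = monoPow e := by
  rw [swapVar, rename_monoPow]
  congr 1
  funext k
  rw [Function.comp_apply, Equiv.symm_swap]
  by_cases hi : k = i
  · rw [hi, Equiv.swap_apply_left, h]
  by_cases hj : k = j
  · rw [hj, Equiv.swap_apply_right, h]
  rw [Equiv.swap_apply_of_ne_of_ne hi hj]

theorem alternate_monoPow_ne_zero {e : κ → ℕ} (he : Function.Injective e) :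
    alternate κ (monoPow e) ≠ 0 := by
  intro h
  have h1 := congrArg (coeff (Finsupp.equivFunOnFinite.symm e)) h
  rw [alternate_apply, coeff_sum, Finset.sum_eq_single 1, coeff_zero] at h1
  · simp [monoPow_eq_monomial] at h1
  · intro w _ hw
    rw [rename_monoPow, monoPow_eq_monomial, coeff_smul, coeff_monomial, if_neg, smul_zero]
    intro h2
    have h3 : e ∘ w.symm = e := Finsupp.equivFunOnFinite.symm.injective h2
    refine hw (Equiv.ext fun k => ?_)
    have := congrFun h3 (w k)
    rw [Function.comp_apply, Equiv.symm_apply_apply] at this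
    exact (he this).symm
  · simp

theorem monoPow_update (e : κ → ℕ) (i : κ) (p : ℕ) :
    monoPow (Function.update e i p) = X i ^ p * monoPow (Function.update e i 0) := by
  rw [monoPow, monoPow, ← Finset.mul_prod_erase _ _ (Finset.mem_univ i),
    ← Finset.mul_prod_erase (a := i) _ (fun k => X k ^ Function.update e i 0 k) (Finset.mem_univ i)]
  simp only [Function.update_self, pow_zero, one_mul]
  congr 1
  refine Finset.prod_congr rfl fun k hk => ?_
  rw [Function.update_of_ne (Finset.ne_of_mem_erase hk),
    Function.update_of_ne (Finset.ne_of_mem_erase hk)]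

theorem monoPow_update_update {i j : κ} (h : i ≠ j) (e : κ → ℕ) (p r : ℕ) :
    monoPow (Function.update (Function.update e i p) j r) =
      X i ^ p * X j ^ r * monoPow (Function.update (Function.update e i 0) j 0) := by
  rw [monoPow_update, Function.update_comm h, monoPow_update, Function.update_comm h.symm]
  ring

theorem divDiff_monoPow {i j : κ} (h : i ≠ j) (e : κ → ℕ) (r n : ℕ) :
    divDiff i j (monoPow (Function.update (Function.update e i (r + n)) j r)) =
      ∑ s ∈ Finset.range n,
        monoPow (Function.update (Function.update e i (r + (n - 1 - s))) j (r + s)) := by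
  rw [monoPow_update_update h e,
    Finset.sum_congr rfl fun s _ => monoPow_update_update h e (r + (n - 1 - s)) (r + s)]
  set g := monoPow (Function.update (Function.update e i 0) j 0)
  have hg : swapVar i j g = g := swapVar_monoPow (by
    rw [Function.update_of_ne h, Function.update_self, Function.update_self])
  refine divDiff_eq_of_mul_eq h ?_
  simp only [map_mul, map_pow, swapVar_X, Equiv.swap_apply_left, Equiv.swap_apply_right, hg]
  have := geom_sum₂_mul (X j : MvPolynomial κ ℂ) (X i) n
  have e1 : ∑ s ∈ Finset.range n, (X i : MvPolynomial κ ℂ) ^ (r + (n - 1 - s)) * X j ^ (r + s) * g =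
      (X i * X j) ^ r * g * ∑ s ∈ Finset.range n, X j ^ s * X i ^ (n - 1 - s) := by
    rw [Finset.mul_sum]
    refine Finset.sum_congr rfl fun s _ => ?_
    rw [pow_add, pow_add, mul_pow]
    ring
  rw [e1, pow_add, pow_add]
  linear_combination (-(X i * X j) ^ r * g) * this

end Alternate

section Staircase

/-- The part of the staircase exponent `(b, b - 1, …, 0)` supported on indices at least `m`. -/
def stairs (b m : ℕ) (k : Fin (b + 1)) : ℕ := if m ≤ k then b - k else 0

/-- The operator `y_k^(b-k) ∂_k - a (b-k) y_k^(b-k-1)`. -/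
noncomputable def stairOp (a b : ℕ) (k : Fin (b + 1)) :
    Module.End ℂ (MvPolynomial (Fin (b + 1)) ℂ) :=
  LinearMap.mulLeft ℂ (X k ^ (b - (k : ℕ))) ∘ₗ (pderiv k).toLinearMap -
    ((a * (b - k : ℕ) : ℕ) : ℂ) • LinearMap.mulLeft ℂ (X k ^ (b - (k : ℕ) - 1))

theorem stairOp_apply (a b : ℕ) (k : Fin (b + 1)) (f : MvPolynomial (Fin (b + 1)) ℂ) :
    stairOp a b k f = X k ^ (b - (k : ℕ)) * pderiv k f -
      ((a * (b - k : ℕ) : ℕ) : ℂ) • (X k ^ (b - (k : ℕ) - 1) * f) := rfl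

/-- Operators commuting with the variables of index at least `m` and with their permutations. -/
structure CommutesFrom {b : ℕ} (m : ℕ) (A : Module.End ℂ (MvPolynomial (Fin (b + 1)) ℂ)) :
    Prop where
  X_mul : ∀ k : Fin (b + 1), m ≤ k → ∀ f, A (X k * f) = X k * A f
  swapVar : ∀ i j : Fin (b + 1), m ≤ i → m ≤ j → ∀ f, A (swapVar i j f) = swapVar i j (A f)

namespace CommutesFrom

variable {a b m : ℕ} {A : Module.End ℂ (MvPolynomial (Fin (b + 1)) ℂ)}

theorem X_pow_mul (hA : CommutesFrom m A) {k : Fin (b + 1)} (hk : m ≤ k) (n : ℕ)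
    (f : MvPolynomial (Fin (b + 1)) ℂ) : A (X k ^ n * f) = X k ^ n * A f := by
  induction n with
  | zero => simp
  | succ n ih => rw [pow_succ', mul_assoc, hA.X_mul k hk, ih, mul_assoc]

theorem divDiff (hA : CommutesFrom m A) {i j : Fin (b + 1)} (hi : m ≤ i) (hj : m ≤ j)
    (f : MvPolynomial (Fin (b + 1)) ℂ) : A (divDiff i j f) = divDiff i j (A f) := by
  by_cases h : i = j
  · rw [h, divDiff_self, divDiff_self, map_zero]
  refine (divDiff_eq_of_mul_eq h ?_).symm
  rw [sub_mul, ← hA.X_mul i hi, ← hA.X_mul j hj, ← hA.swapVar i j hi hj, ← map_sub, ← map_sub,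
    ← sub_mul, X_sub_X_mul_divDiff]

theorem mul_stairOp {m : Fin (b + 1)} (hA : CommutesFrom m A) :
    CommutesFrom (m + 1) (A * stairOp a b m) where
  X_mul k hk f := by
    have hne : k ≠ m := by rintro rfl; omega
    rw [Module.End.mul_apply, Module.End.mul_apply, ← hA.X_mul k (by omega), stairOp_apply,
      stairOp_apply, Derivation.leibniz, pderiv_X_of_ne hne]
    congr 1
    simp only [smul_eq_mul, mul_zero, add_zero, mul_sub, mul_smul_comm]
    ring_nf
  swapVar i j hi hj f := by
    have hi' : m ≠ i := by rintro rfl; omega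
    have hj' : m ≠ j := by rintro rfl; omega
    rw [Module.End.mul_apply, Module.End.mul_apply, ← hA.swapVar i j (by omega) (by omega),
      stairOp_apply, stairOp_apply, pderiv_swapVar_of_ne hi' hj']
    simp only [map_sub, map_smul, map_mul, map_pow, swapVar_X,
      Equiv.swap_apply_of_ne_of_ne hi' hj']

end CommutesFrom

theorem stairs_succ {b : ℕ} (m : Fin (b + 1)) :
    stairs b (m + 1) = Function.update (stairs b m) m 0 := by
  funext k
  by_cases h : k = m
  · subst h; simp [stairs]
  · rw [Function.update_of_ne h, stairs, stairs]
    have : (k : ℕ) ≠ m := fun e => h (Fin.ext e)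
    congr 1
    exact propext ⟨fun h => by omega, fun h => by omega⟩

theorem monoPow_stairs {b : ℕ} (m : Fin (b + 1)) :
    monoPow (stairs b m) = X m ^ (b - (m : ℕ)) * monoPow (stairs b (m + 1)) := by
  rw [stairs_succ, ← monoPow_update]
  congr 1
  have : b - (m : ℕ) = stairs b m m := by simp [stairs]
  rw [this, Function.update_eq_self]

theorem alternate_divDiff_stairs {b : ℕ} {m j : Fin (b + 1)} (h : m < j)
    {F : MvPolynomial (Fin (b + 1)) ℂ} (hF : ∀ i j, m < i → m < j → swapVar i j F = F) :
    alternate (Fin (b + 1)) (divDiff m j (monoPow (stairs b m)) * F) =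
      alternate (Fin (b + 1)) (X m ^ (b - (m : ℕ) - 1) * monoPow (stairs b (m + 1)) * F) := by
  have hlt : (m : ℕ) < j := h
  have hj : (j : ℕ) ≤ b := by omega
  have hst : stairs b m = Function.update (Function.update (stairs b m) m
      ((b - j) + (j - m : ℕ))) j (b - j : ℕ) := by
    funext k
    by_cases h1 : k = j
    · subst h1; simp [stairs, hlt.le]
    by_cases h2 : k = m
    · subst h2
      rw [Function.update_of_ne h1, Function.update_self, stairs, if_pos le_rfl]
      omega
    rw [Function.update_of_ne h1, Function.update_of_ne h2]
  rw [hst, divDiff_monoPow h.ne, Finset.sum_mul, map_sum, Finset.sum_eq_single 0]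
  · rw [add_zero, Function.update_comm h.ne, monoPow_update, stairs_succ, Function.update_comm h.ne']
    congr 3
    · congr 1; omega
    · congr 1
      funext k
      by_cases hk : k = j
      · subst hk
        rw [Function.update_self, Function.update_of_ne h.ne', stairs, if_pos hlt.le]
      · rw [Function.update_of_ne hk]
  · intro s hs hs0
    rw [Finset.mem_range] at hs
    have hj' : (j : ℕ) - s < b + 1 := by omega
    have hmj : m < ⟨j - s, hj'⟩ := by rw [Fin.lt_def]; simp; omega
    have hjj : (⟨j - s, hj'⟩ : Fin (b + 1)) ≠ j := by
      rw [Ne, Fin.ext_iff]; simp; omega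
    refine alternate_eq_zero hjj ?_
    rw [map_mul, hF _ _ hmj h, swapVar_monoPow]
    rw [Function.update_of_ne hjj, Function.update_of_ne hmj.ne', Function.update_self, stairs,
      if_pos (Fin.le_def.mp hmj.le)]
    simp only
    omega
  · intro h0
    rw [Finset.mem_range] at h0
    omega

theorem alternate_stairs_mul_dunkl (a : ℕ) {b : ℕ} {m : Fin (b + 1)}
    {A : Module.End ℂ (MvPolynomial (Fin (b + 1)) ℂ)} (hA : CommutesFrom m A)
    {f : MvPolynomial (Fin (b + 1)) ℂ} (hf : ∀ i j, m < i → m < j → swapVar i j f = f)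
    (hf' : ∀ j, j < m → swapVar m j f = f) :
    alternate (Fin (b + 1)) (monoPow (stairs b m) *
        A (dunkl (a : ℂ) (Function.Embedding.refl _) m f)) =
      alternate (Fin (b + 1)) (monoPow (stairs b (m + 1)) * (A * stairOp a b m) f) := by
  have hAf : ∀ i j, m < i → m < j → swapVar i j (A f) = A f := fun i j hi hj => by
    rw [← hA.swapVar i j (Fin.le_def.mp hi.le) (Fin.le_def.mp hj.le), hf i j hi hj]
  have h1 : ∑ j, divDiff m j f = ∑ j ∈ Finset.Ioi m, divDiff m j f := by
    symm
    refine Finset.sum_subset (Finset.subset_univ _) fun j _ hj => ?_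
    rw [Finset.mem_Ioi, not_lt] at hj
    rcases hj.lt_or_eq with hj | rfl
    · exact divDiff_eq_zero (hf' j hj)
    · exact divDiff_self _ _
  have h2 : ∑ j ∈ Finset.Ioi m, alternate (Fin (b + 1)) (monoPow (stairs b m) * A (divDiff m j f)) =
      (b - (m : ℕ)) • alternate (Fin (b + 1))
        (X m ^ (b - (m : ℕ) - 1) * monoPow (stairs b (m + 1)) * A f) := by
    rw [Finset.sum_congr rfl fun j hj => ?_, Finset.sum_const, Fin.card_Ioi]
    · congr 1
    · have hj := Finset.mem_Ioi.mp hj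
      rw [hA.divDiff le_rfl (Fin.le_def.mp hj.le), alternate_mul_divDiff hj.ne,
        alternate_divDiff_stairs hj hAf]
  rw [dunkl_apply]
  simp only [Function.Embedding.refl_apply]
  rw [h1, map_sub, mul_sub, map_sub, map_smul, mul_smul_comm, map_smul, map_sum, Finset.mul_sum,
    map_sum, h2, Module.End.mul_apply, stairOp_apply, map_sub, map_smul, hA.X_pow_mul le_rfl,
    hA.X_pow_mul le_rfl, mul_sub, map_sub, mul_smul_comm, map_smul, monoPow_stairs]
  congr 1
  · congr 1; ring
  · rw [← Nat.cast_smul_eq_nsmul ℂ, smul_smul, Nat.cast_mul]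
    congr 2
    ring

/-- The composition of the first `m` of the operators `stairOp`. -/
noncomputable def stairOps (a b : ℕ) : ℕ → Module.End ℂ (MvPolynomial (Fin (b + 1)) ℂ)
  | 0 => 1
  | m + 1 => if h : m < b + 1 then stairOps a b m * stairOp a b ⟨m, h⟩ else stairOps a b m

theorem commutesFrom_stairOps (a b : ℕ) {m : ℕ} (hm : m ≤ b + 1) :
    CommutesFrom m (stairOps a b m) := by
  induction m with
  | zero => exact ⟨fun _ _ _ => rfl, fun _ _ _ _ _ => rfl⟩
  | succ m ih =>
    rw [stairOps, dif_pos (by omega)]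
    exact CommutesFrom.mul_stairOp (m := ⟨m, by omega⟩) (ih (by omega))

/-- The product of Dunkl operators of index at least `m`. -/
noncomputable def tailDunkl (a b m : ℕ) : Module.End ℂ (MvPolynomial (Fin (b + 1)) ℂ) :=
  dunklHom (a : ℂ) (Function.Embedding.refl _) (∏ k ∈ Finset.univ.filter fun k : Fin (b + 1) => m ≤ (k : ℕ), X k)

theorem tailDunkl_apply (a b : ℕ) (m : Fin (b + 1)) (f : MvPolynomial (Fin (b + 1)) ℂ) :
    tailDunkl a b m f = dunkl (a : ℂ) (Function.Embedding.refl _) m (tailDunkl a b (m + 1) f) := by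
  rw [tailDunkl, tailDunkl, ← dunklHom_X_mul_apply, ← Finset.prod_insert (by simp)]
  congr 3
  ext k
  simp only [Finset.mem_filter, Finset.mem_univ, true_and, Finset.mem_insert, Fin.ext_iff]
  omega

theorem swapVar_tailDunkl (a : ℕ) {b m : ℕ} {i j : Fin (b + 1)} (h : m ≤ i ↔ m ≤ j)
    {f : MvPolynomial (Fin (b + 1)) ℂ} (hf : f.IsSymmetric) :
    swapVar i j (tailDunkl a b m f) = tailDunkl a b m f := by
  rw [tailDunkl, swapVar, rename_dunklHom (a : ℂ) (Function.Embedding.refl _)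
    (Function.Embedding.refl _) (Equiv.swap i j) (Equiv.swap i j) fun _ => rfl, hf]
  congr 2
  exact swapVar_prod_X_of_mem (by simpa using h)

theorem alternate_mul_dunklHom_prod_X (a b : ℕ) {f : MvPolynomial (Fin (b + 1)) ℂ}
    (hf : f.IsSymmetric) :
    alternate (Fin (b + 1)) (monoPow fun k => b - (k : ℕ)) *
        dunklHom (a : ℂ) (Function.Embedding.refl _) (∏ k, X k) f =
      alternate (Fin (b + 1)) (stairOps a b (b + 1) f) := by
  have key : ∀ m ≤ b + 1, alternate (Fin (b + 1)) (monoPow (stairs b 0) * tailDunkl a b 0 f) =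
      alternate (Fin (b + 1)) (monoPow (stairs b m) * stairOps a b m (tailDunkl a b m f)) := by
    intro m
    induction m with
    | zero => intro _; rfl
    | succ m ih =>
      intro hm
      rw [ih (by omega)]
      have h := tailDunkl_apply a b ⟨m, by omega⟩ f
      have h' := alternate_stairs_mul_dunkl a (commutesFrom_stairOps a b (m := m) (by omega))
        (m := ⟨m, by omega⟩) (f := tailDunkl a b (m + 1) f)
        (fun i j hi hj => swapVar_tailDunkl a (by simp [Fin.lt_def] at hi hj; omega) hf)
        (fun j hj => swapVar_tailDunkl a (by simp [Fin.lt_def] at hj ⊢; omega) hf)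
      simp only at h h'
      rw [h, h', stairOps, dif_pos (by omega)]
  have h0 := key (b + 1) le_rfl
  have h1 : monoPow (stairs b (b + 1)) = (1 : MvPolynomial (Fin (b + 1)) ℂ) := by
    refine Finset.prod_eq_one fun k _ => ?_
    rw [stairs, if_neg (by omega), pow_zero]
  have h2 : tailDunkl a b (b + 1) f = f := by
    rw [tailDunkl, Finset.filter_false_of_mem fun k _ => by omega, Finset.prod_empty, map_one]
    rfl
  rw [h1, h2, one_mul] at h0
  have h3 : stairs b 0 = fun k : Fin (b + 1) => b - (k : ℕ) :=
    funext fun k => if_pos (Nat.zero_le _)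
  have h4 : tailDunkl a b 0 f = dunklHom (a : ℂ) (Function.Embedding.refl _) (∏ k, X k) f := by
    rw [tailDunkl, Finset.filter_true_of_mem fun k _ => Nat.zero_le _]
  have h5 : (dunklHom (a : ℂ) (Function.Embedding.refl (Fin (b + 1))) (∏ k, X k) f).IsSymmetric := by
    intro w
    rw [rename_dunklHom (a : ℂ) (Function.Embedding.refl _) (Function.Embedding.refl _) w w
      fun _ => rfl, hf, isSymmetric_prod_X]
  rw [← h0, ← alternate_mul_of_isSymmetric _ h5, h3, h4]

end Staircase

section Representation

variable {A : Type*} [CommRing A] [Algebra ℂ A]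

/-- The coefficients of `f` are the values of `ℓ` on products of entries of the sequences `s k`. -/
def IsRep {κ : Type*} [Fintype κ] (ℓ : A →ₗ[ℂ] ℂ) (s : κ → ℕ → A) (f : MvPolynomial κ ℂ) : Prop :=
  ∀ ρ : κ →₀ ℕ, coeff ρ f = ℓ (∏ k, s k (ρ k))

theorem IsRep.coeff_alternate {κ : Type*} [Fintype κ] [DecidableEq κ] {ℓ : A →ₗ[ℂ] ℂ}
    {s : κ → ℕ → A} {f : MvPolynomial κ ℂ} (h : IsRep ℓ s f) (ρ : κ →₀ ℕ) :
    coeff ρ (alternate κ f) = ℓ (Matrix.det (Matrix.of fun i k => s k (ρ i))) := by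
  rw [alternate_apply, coeff_sum, Matrix.det_apply, map_sum]
  refine Finset.sum_congr rfl fun w _ => ?_
  have hρ : ρ = (ρ.mapDomain w.symm).mapDomain w := by
    rw [← Finsupp.mapDomain_comp]; simp
  have hρ' : ∀ k, ρ.mapDomain w.symm k = ρ (w k) := fun k => by
    conv_lhs => rw [← w.symm_apply_apply k]
    rw [Finsupp.mapDomain_apply w.symm.injective]
  rw [coeff_smul]
  conv_lhs => rw [hρ]
  rw [coeff_rename_mapDomain _ w.injective, h]
  simp only [hρ', Matrix.of_apply]
  rw [Units.smul_def, map_zsmul, ← Int.cast_smul_eq_zsmul ℂ]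

/-- The sequence `r ↦ (r + 1 - (a + 1) μ) s_(r + 1 - μ)`. -/
noncomputable def shiftSeq (a μ : ℕ) (s : ℕ → A) (r : ℕ) : A :=
  if μ ≤ r + 1 then ((r : ℂ) + 1 - (a + 1) * μ) • s (r + 1 - μ) else 0

theorem coeff_stairOp (a b : ℕ) (k : Fin (b + 1)) (f : MvPolynomial (Fin (b + 1)) ℂ)
    (ρ : Fin (b + 1) →₀ ℕ) :
    coeff ρ (stairOp a b k f) = if b - (k : ℕ) ≤ ρ k + 1 then
      ((ρ k : ℂ) + 1 - (a + 1) * (b - k : ℕ)) * coeff (ρ.update k (ρ k + 1 - (b - k : ℕ))) f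
      else 0 := by
  rw [stairOp_apply]
  generalize b - (k : ℕ) = μ
  have hle : ∀ n, Finsupp.single k n ≤ ρ ↔ n ≤ ρ k := fun n => Finsupp.single_le_iff
  rw [coeff_sub, coeff_smul, X_pow_eq_monomial, X_pow_eq_monomial, coeff_monomial_mul',
    coeff_monomial_mul']
  simp only [hle, one_mul, coeff_pderiv]
  have h1 : μ ≤ ρ k → ρ - Finsupp.single k μ + Finsupp.single k 1 =
      ρ.update k (ρ k + 1 - μ) := fun h => by
    ext j
    by_cases hj : j = k
    · subst hj; simp; omega
    · simp [hj]
  have h2 : μ ≠ 0 → μ ≤ ρ k + 1 → ρ - Finsupp.single k (μ - 1) = ρ.update k (ρ k + 1 - μ) :=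
    fun h0 h => by
    ext j
    by_cases hj : j = k
    · subst hj; simp; omega
    · simp [hj]
  rcases Nat.eq_zero_or_pos μ with rfl | h0
  · rw [h1 (Nat.zero_le _)]
    simp
    ring
  · by_cases hμ : μ ≤ ρ k
    · rw [if_pos hμ, if_pos (by omega), if_pos (by omega), h1 hμ, h2 h0.ne' (by omega)]
      simp [Nat.cast_sub hμ]
      ring
    · by_cases hμ' : μ ≤ ρ k + 1
      · rw [if_neg hμ, if_pos (by omega), if_pos hμ', h2 h0.ne' hμ']
        obtain rfl : μ = ρ k + 1 := by omega
        simp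
        ring
      · rw [if_neg hμ, if_neg (by omega), if_neg hμ']
        simp

theorem IsRep.stairOp {b : ℕ} (a : ℕ) {ℓ : A →ₗ[ℂ] ℂ} {s : Fin (b + 1) → ℕ → A}
    {f : MvPolynomial (Fin (b + 1)) ℂ} (h : IsRep ℓ s f) (k : Fin (b + 1)) :
    IsRep ℓ (Function.update s k (shiftSeq a (b - k) (s k))) (stairOp a b k f) := by
  intro ρ
  rw [coeff_stairOp, h, ← Finset.mul_prod_erase _ _ (Finset.mem_univ k),
    ← Finset.mul_prod_erase _ (fun j => Function.update s k _ j (ρ j)) (Finset.mem_univ k),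
    Function.update_self, shiftSeq]
  have h1 : ∀ n, ∏ j ∈ Finset.univ.erase k, s j (ρ.update k n j) =
      ∏ j ∈ Finset.univ.erase k, s j (ρ j) := fun n =>
    Finset.prod_congr rfl fun j hj => by
      rw [Finsupp.update_apply, if_neg (Finset.ne_of_mem_erase hj)]
  have h2 : ∏ j ∈ Finset.univ.erase k, Function.update s k (shiftSeq a (b - k) (s k)) j (ρ j) =
      ∏ j ∈ Finset.univ.erase k, s j (ρ j) :=
    Finset.prod_congr rfl fun j hj => by rw [Function.update_of_ne (Finset.ne_of_mem_erase hj)]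
  rw [h1, h2]
  split_ifs
  · rw [smul_mul_assoc, map_smul, smul_eq_mul, Finsupp.update_apply, if_pos rfl]
  · rw [zero_mul, map_zero]

theorem IsRep.stairOps {b : ℕ} (a : ℕ) {ℓ : A →ₗ[ℂ] ℂ} {m : ℕ} (hm : m ≤ b + 1)
    {s : Fin (b + 1) → ℕ → A} {f : MvPolynomial (Fin (b + 1)) ℂ} (h : IsRep ℓ s f) :
    IsRep ℓ (fun k : Fin (b + 1) => if (k : ℕ) < m then shiftSeq a (b - k) (s k) else s k)
      (stairOps a b m f) := by
  induction m generalizing s f with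
  | zero => simpa [_root_.stairOps] using h
  | succ m ih =>
    rw [_root_.stairOps, dif_pos (by omega), Module.End.mul_apply]
    convert ih (by omega) (h.stairOp a ⟨m, by omega⟩) using 1
    funext k
    by_cases hk : k = ⟨m, by omega⟩
    · subst hk
      simp
    · have : (k : ℕ) ≠ m := fun e => hk (Fin.ext e)
      simp only [Function.update_of_ne hk]
      congr 1
      exact propext ⟨fun h => by omega, fun h => by omega⟩

/-- The extension of a finite sequence by zero. -/
noncomputable def extendZero {d : ℕ} (c : Fin (d + 1) → A) (r : ℕ) : A :=
  if h : r < d + 1 then c ⟨r, h⟩ else 0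

theorem isRep_genFun {κ : Type*} [Fintype κ] {d : ℕ} (c : Fin (d + 1) → A) (ℓ : A →ₗ[ℂ] ℂ) :
    IsRep ℓ (fun _ => extendZero c) (genFun κ c ℓ) := by
  intro ρ
  by_cases hρ : ∀ i, ρ i ≤ d
  · obtain ⟨s, rfl⟩ : ∃ s : κ → Fin (d + 1), toExponent s = ρ :=
      ⟨fun i => ⟨ρ i, Nat.lt_succ_of_le (hρ i)⟩, by ext; rfl⟩
    rw [coeff_toExponent_genFun]
    congr 1
    refine Finset.prod_congr rfl fun k _ => ?_
    beta_reduce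
    rw [toExponent_apply, extendZero, dif_pos (s k).2]
  · push Not at hρ
    obtain ⟨i, hi⟩ := hρ
    rw [coeff_genFun_eq_zero c ℓ hi, Finset.prod_eq_zero (Finset.mem_univ i), map_zero]
    beta_reduce
    rw [extendZero, dif_neg (by omega)]

theorem coeff_alternate_stairOps_genFun (a b : ℕ) {d : ℕ} (c : Fin (d + 1) → A)
    (ℓ : A →ₗ[ℂ] ℂ) (ρ : Fin (b + 1) →₀ ℕ) :
    coeff ρ (alternate (Fin (b + 1)) (stairOps a b (b + 1) (genFun (Fin (b + 1)) c ℓ))) =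
      ℓ (Matrix.det (Matrix.of fun i k : Fin (b + 1) =>
        shiftSeq a (b - (k : ℕ)) (extendZero c) (ρ i))) := by
  rw [((isRep_genFun c ℓ).stairOps a le_rfl).coeff_alternate]
  congr 2
  ext i k
  simp only [Matrix.of_apply, if_pos k.2]

end Representation

section JacMatrix

/-- The exponent of `x^m y^n`. -/
noncomputable abbrev binExp (m n : ℕ) : Fin 2 →₀ ℕ :=
  Finsupp.single (0 : Fin 2) m + Finsupp.single (1 : Fin 2) n

theorem binExp_inj {m n m' n' : ℕ} : binExp m n = binExp m' n' ↔ m = m' ∧ n = n' := by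
  constructor
  · intro h
    have h0 := DFunLike.congr_fun h 0
    have h1 := DFunLike.congr_fun h 1
    simpa using And.intro h0 h1
  · rintro ⟨rfl, rfl⟩
    rfl

theorem C_mul_X_pow_mul_X_pow {R : Type*} [CommSemiring R] (r : R) (m n : ℕ) :
    (C r * X (0 : Fin 2) ^ m * X (1 : Fin 2) ^ n : MvPolynomial (Fin 2) R) =
      monomial (binExp m n) r := by
  rw [X_pow_eq_monomial, X_pow_eq_monomial, C_mul_monomial, monomial_mul, mul_one, mul_one]

theorem coeffC_eq_powCoeff {a b j : ℕ} (hj : j ≤ a * b) : coeffC a b j = powCoeff a b j := by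
  rw [coeffC, powCoeff_eq_sum, genForm, Fintype.sum_pow, coeff_sum]
  refine Finset.sum_congr rfl fun s _ => ?_
  rw [Finset.prod_mul_distrib, Finset.prod_mul_distrib, ← map_prod, Finset.prod_pow_eq_pow_sum,
    Finset.prod_pow_eq_pow_sum, C_mul_X_pow_mul_X_pow, coeff_monomial]
  have h : ∑ i, (b - (s i : ℕ)) + ∑ i, (s i : ℕ) = a * b := by
    rw [← Finset.sum_add_distrib, Finset.sum_congr rfl fun i _ => Nat.sub_add_cancel
      (Nat.lt_succ_iff.mp (s i).2)]
    simp
  refine if_congr (binExp_inj.trans ⟨fun h => h.1, fun h' => ⟨h', by omega⟩⟩) rfl rfl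

theorem FH_eq_aeval_powCoeffs (a b : ℕ) : FH a b = aeval (powCoeffs a b) := by
  rw [FH]
  congr 1
  funext j
  exact coeffC_eq_powCoeff (Nat.lt_succ_iff.mp j.2)

theorem pderiv_zero_binExp {R : Type*} [CommSemiring R] (r : R) (m n : ℕ) :
    pderiv (0 : Fin 2) (monomial (binExp m n) r) = monomial (binExp (m - 1) n) (r * m) := by
  have h : binExp m n - Finsupp.single 0 1 = binExp (m - 1) n := by
    ext i; fin_cases i <;> simp
  rw [pderiv_monomial, h]
  simp

theorem pderiv_one_binExp {R : Type*} [CommSemiring R] (r : R) (m n : ℕ) :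
    pderiv (1 : Fin 2) (monomial (binExp m n) r) = monomial (binExp m (n - 1)) (r * n) := by
  have h : binExp m n - Finsupp.single 1 1 = binExp m (n - 1) := by
    ext i; fin_cases i <;> simp
  rw [pderiv_monomial, h]
  simp

theorem binExp_add (m n m' n' : ℕ) : binExp m n + binExp m' n' = binExp (m + m') (n + n') := by
  ext i; fin_cases i <;> simp

theorem jacPair_eq_sum {a b c : ℕ} (hc : c ≤ b) :
    jacPair a b c = ∑ i : Fin (a * b + 1), monomial
      (binExp ((i : ℕ) + c - 1) (a * b + b - i - c - 1))
        (((b : ℂ) * ((i : ℂ) - a * c)) • (X i : MvPolynomial (Fin (a * b + 1)) ℂ)) := by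
  have hg : (X (0 : Fin 2) ^ c * X (1 : Fin 2) ^ (b - c) :
      MvPolynomial (Fin 2) (MvPolynomial (Fin (a * b + 1)) ℂ)) = monomial (binExp c (b - c)) 1 := by
    rw [← C_mul_X_pow_mul_X_pow, C_1, one_mul]
  rw [jacPair, hg, genForm, map_sum, map_sum, Finset.sum_mul, Finset.sum_mul,
    ← Finset.sum_sub_distrib]
  refine Finset.sum_congr rfl fun i _ => ?_
  have hi := Nat.lt_succ_iff.mp i.2
  rw [C_mul_X_pow_mul_X_pow, pderiv_zero_binExp, pderiv_zero_binExp, pderiv_one_binExp,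
    pderiv_one_binExp, monomial_mul, monomial_mul, binExp_add, binExp_add]
  have h1 : monomial (binExp ((i : ℕ) - 1 + c) (a * b - i + (b - c - 1)))
      ((X i : MvPolynomial (Fin (a * b + 1)) ℂ) * (i : ℕ) * (1 * ((b - c : ℕ) : MvPolynomial (Fin (a * b + 1)) ℂ))) =
      monomial (binExp ((i : ℕ) + c - 1) (a * b + b - i - c - 1))
      ((X i : MvPolynomial (Fin (a * b + 1)) ℂ) * (i : ℕ) * (1 * ((b - c : ℕ) : MvPolynomial (Fin (a * b + 1)) ℂ))) := by
    rcases Nat.eq_zero_or_pos (i : ℕ) with h0 | h0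
    · simp [h0]
    rcases Nat.eq_zero_or_pos (b - c) with h0' | h0'
    · simp [h0']
    congr 2
    congr 1 <;> omega
  have h2 : monomial (binExp ((i : ℕ) + (c - 1)) (a * b - i - 1 + (b - c)))
      ((X i : MvPolynomial (Fin (a * b + 1)) ℂ) * (a * b - i : ℕ) * (1 * (c : MvPolynomial (Fin (a * b + 1)) ℂ))) =
      monomial (binExp ((i : ℕ) + c - 1) (a * b + b - i - c - 1))
      ((X i : MvPolynomial (Fin (a * b + 1)) ℂ) * (a * b - i : ℕ) * (1 * (c : MvPolynomial (Fin (a * b + 1)) ℂ))) := by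
    rcases Nat.eq_zero_or_pos (a * b - i) with h0 | h0
    · simp [h0]
    rcases Nat.eq_zero_or_pos c with h0' | h0'
    · simp [h0']
    congr 2
    congr 1 <;> omega
  rw [h1, h2, ← map_sub]
  congr 1
  rw [Nat.cast_sub hi, Nat.cast_sub hc, smul_eq_C_mul]
  push_cast [map_mul, map_sub, map_natCast]
  ring

theorem jacMatrix_apply (a b : ℕ) (r : Fin (a * b + b - 1)) (c : Fin (b + 1)) :
    jacMatrix a b r c = (b : ℂ) • shiftSeq a c (extendZero X) r := by
  have hr := r.2
  have hc := Nat.lt_succ_iff.mp c.2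
  rw [jacMatrix, jacPair_eq_sum hc, coeff_sum, shiftSeq]
  simp only [coeff_monomial, binExp_inj]
  by_cases h : (c : ℕ) ≤ r + 1 ∧ (r : ℕ) + 1 - c < a * b + 1
  · rw [if_pos h.1, extendZero, dif_pos h.2, Finset.sum_eq_single ⟨(r : ℕ) + 1 - c, h.2⟩,
      if_pos (by constructor <;> simp only <;> omega), smul_smul]
    · congr 1
      push_cast [Nat.cast_sub h.1]
      ring
    · intro i _ hi
      have hi' : (i : ℕ) ≠ r + 1 - c := fun e => hi (Fin.ext e)
      split_ifs with h'
      · have h1 : (i : ℕ) = 0 := by omega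
        have h2 : (c : ℕ) = 0 := by omega
        simp [h1, h2]
      · rfl
    · simp
  · have h0 : (if (c : ℕ) ≤ r + 1 then ((r : ℂ) + 1 - (a + 1) * (c : ℕ)) •
        extendZero (X : Fin (a * b + 1) → MvPolynomial (Fin (a * b + 1)) ℂ) (r + 1 - c) else 0) = 0 := by
      split_ifs with h1
      · rw [extendZero, dif_neg fun h2 => h ⟨h1, h2⟩, smul_zero]
      · rfl
    rw [h0, smul_zero]
    refine Finset.sum_eq_zero fun i _ => ?_
    have hi := i.2
    split_ifs with h'
    · by_cases h3 : (i : ℕ) = 0 ∧ (c : ℕ) = 0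
      · simp [h3.1, h3.2]
      · exact absurd ⟨by omega, by omega⟩ h
    · rfl

/-- The ideal generated by the maximal minors of `jacMatrix a b`. -/
noncomputable abbrev minorIdeal (a b : ℕ) : Ideal (MvPolynomial (Fin (a * b + 1)) ℂ) :=
  Ideal.span {q : MvPolynomial (Fin (a * b + 1)) ℂ |
    ∃ f : Fin (b + 1) → Fin (a * b + b - 1), Function.Injective f ∧
      q = ((jacMatrix a b).submatrix f id).det}

theorem shiftSeq_extendZero_X_eq_zero {a b r c : ℕ} (hb : b ≠ 0) (hc : c ≤ b)
    (hr : a * b + b - 1 ≤ r) :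
    shiftSeq a c (extendZero (X : Fin (a * b + 1) → MvPolynomial (Fin (a * b + 1)) ℂ)) r = 0 := by
  rw [shiftSeq]
  split_ifs with h
  · by_cases h' : r + 1 - c < a * b + 1
    · obtain rfl : c = b := by omega
      obtain h2 : r + 1 = a * c + c := by omega
      have h3 : (r : ℂ) + 1 = a * c + c := by exact_mod_cast h2
      rw [h3]
      ring_nf
      simp
    · rw [extendZero, dif_neg h', smul_zero]
  · rfl

theorem det_shiftSeq_mem_minorIdeal {a b : ℕ} (hb : b ≠ 0) (ρ : Fin (b + 1) → ℕ) :
    Matrix.det (Matrix.of fun i k : Fin (b + 1) => shiftSeq a (b - (k : ℕ))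
      (extendZero (X : Fin (a * b + 1) → MvPolynomial (Fin (a * b + 1)) ℂ)) (ρ i)) ∈
      minorIdeal a b := by
  by_cases hρ : Function.Injective ρ
  swap
  · obtain ⟨i, j, hij, hne⟩ := Function.not_injective_iff.mp hρ
    rw [Matrix.det_zero_of_row_eq hne (by funext k; simp only [Matrix.of_apply, hij])]
    exact zero_mem _
  by_cases hr : ∀ i, ρ i < a * b + b - 1
  swap
  · push Not at hr
    obtain ⟨i, hi⟩ := hr
    rw [Matrix.det_eq_zero_of_row_eq_zero i fun k =>
      shiftSeq_extendZero_X_eq_zero hb (Nat.sub_le _ _) hi]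
    exact zero_mem _
  have hmem : ((jacMatrix a b).submatrix (fun i => ⟨ρ i, hr i⟩) id).det ∈ minorIdeal a b :=
    Ideal.subset_span ⟨_, fun i j h => hρ (Fin.mk.inj_iff.mp h), rfl⟩
  have hb' : (b : ℂ) ≠ 0 := Nat.cast_ne_zero.mpr hb
  have h1 : (Matrix.of fun i k : Fin (b + 1) => shiftSeq a (b - (k : ℕ))
      (extendZero (X : Fin (a * b + 1) → MvPolynomial (Fin (a * b + 1)) ℂ)) (ρ i)) =
      (C (b : ℂ)⁻¹ : MvPolynomial (Fin (a * b + 1)) ℂ) • ((jacMatrix a b).submatrix (fun i => ⟨ρ i, hr i⟩) id).submatrix id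
        Fin.revPerm := by
    ext1 i k
    rw [Matrix.smul_apply, Matrix.submatrix_apply, Matrix.submatrix_apply, jacMatrix_apply,
      smul_eq_mul, ← smul_eq_C_mul, smul_smul, inv_mul_cancel₀ hb', one_smul, Matrix.of_apply]
    simp [Fin.val_rev]
  rw [h1, Matrix.det_smul, Matrix.det_permute']
  exact Ideal.mul_mem_left _ _ (Ideal.mul_mem_left _ _ hmem)

theorem FH_shiftSeq (a b c r : ℕ) :
    FH a b (shiftSeq a c (extendZero X) r) = shiftSeq a c (powCoeff a b) r := by
  rw [shiftSeq, shiftSeq]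
  split_ifs
  · rw [map_smul, extendZero]
    congr 1
    split_ifs with h
    · rw [FH_eq_aeval_powCoeffs, aeval_X, powCoeffs]
    · rw [map_zero, powCoeff_eq_zero (by omega)]
  · exact map_zero _

theorem sum_shiftSeq_powCoeff (a b r : ℕ) :
    ∑ c : Fin (b + 1), shiftSeq a c (powCoeff a b) r * X c = 0 := by
  set f := genPoly b ^ a with hf
  have h0 : ∑ c : Fin (b + 1), (Polynomial.derivative f * Polynomial.X -
      Polynomial.C ((a * (c : ℕ) : ℕ) : MvPolynomial (Fin (b + 1)) ℂ) * f) *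
        Polynomial.X ^ (c : ℕ) * Polynomial.C (X c) = 0 := by
    have h1 : ∑ c : Fin (b + 1), Polynomial.C ((a * (c : ℕ) : ℕ) : MvPolynomial (Fin (b + 1)) ℂ) *
        f * Polynomial.X ^ (c : ℕ) * Polynomial.C (X c) =
        (a : Polynomial (MvPolynomial (Fin (b + 1)) ℂ)) * f *
          (Polynomial.derivative (genPoly b) * Polynomial.X) := by
      conv_rhs => rw [genPoly, map_sum, Finset.sum_mul, Finset.mul_sum]
      refine Finset.sum_congr rfl fun c _ => ?_
      rw [Polynomial.derivative_C_mul_X_pow]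
      rcases hc : (c : ℕ) with _ | n
      · simp
      · simp only [Nat.add_sub_cancel, map_mul, map_natCast, Nat.cast_mul, pow_succ]
        ring
    have h2 : ∑ c : Fin (b + 1), Polynomial.derivative f * Polynomial.X *
        Polynomial.X ^ (c : ℕ) * Polynomial.C (X c) =
        Polynomial.derivative f * Polynomial.X * genPoly b := by
      conv_rhs => rw [genPoly, Finset.mul_sum]
      exact Finset.sum_congr rfl fun c _ => by ring
    simp only [sub_mul, Finset.sum_sub_distrib]
    rw [h1, h2, hf]
    rcases a with _ | a
    · simp
    · rw [Polynomial.derivative_pow]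
      simp only [Nat.add_sub_cancel, pow_succ, map_natCast]
      ring
  have h1 := congrArg (fun p => Polynomial.coeff p (r + 1)) h0
  simp only [Polynomial.finsetSum_coeff, Polynomial.coeff_zero] at h1
  rw [← h1]
  refine Finset.sum_congr rfl fun c _ => ?_
  rw [Polynomial.coeff_mul_C, Polynomial.coeff_mul_X_pow', shiftSeq]
  congr 1
  split_ifs with hc
  · have h3 : (Polynomial.derivative f * Polynomial.X).coeff (r + 1 - c) =
        ((r + 1 - c : ℕ) : MvPolynomial (Fin (b + 1)) ℂ) * f.coeff (r + 1 - c) := by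
      rcases r + 1 - (c : ℕ) with _ | n
      · simp
      · rw [Polynomial.coeff_mul_X, Polynomial.coeff_derivative]
        push_cast
        ring
    rw [Polynomial.coeff_sub, Polynomial.coeff_C_mul, h3, powCoeff, ← hf, smul_eq_C_mul,
      Nat.cast_sub hc]
    push_cast [map_mul, map_sub, map_add, map_natCast, map_one]
    ring
  · rfl

theorem minorIdeal_le_ker (a b : ℕ) : minorIdeal a b ≤ RingHom.ker (FH a b).toRingHom := by
  rw [Ideal.span_le]
  rintro _ ⟨f, -, rfl⟩
  rw [SetLike.mem_coe, RingHom.mem_ker]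
  refine (RingHom.map_det _ _).trans (Matrix.exists_mulVec_eq_zero_iff.mp ⟨X, ?_, ?_⟩)
  · intro h
    exact X_ne_zero (R := ℂ) (0 : Fin (b + 1)) (congrFun h 0)
  · funext i
    have h := sum_shiftSeq_powCoeff a b (f i)
    rw [Pi.zero_apply, Matrix.mulVec, dotProduct, ← smul_zero (b : ℂ), ← h, Finset.smul_sum]
    refine Finset.sum_congr rfl fun c _ => ?_
    rw [← smul_mul_assoc, ← FH_shiftSeq, ← map_smul, ← jacMatrix_apply]
    rfl

end JacMatrix

section Kernel

theorem homogeneousSubmodule_le_prodSpan_X (d n : ℕ) :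
    homogeneousSubmodule (Fin (d + 1)) ℂ n ≤
      prodSpan (Fin n) (X : Fin (d + 1) → MvPolynomial (Fin (d + 1)) ℂ) := by
  rw [homogeneousSubmodule_eq_restrictSupport, restrictSupport_eq_span, Submodule.span_le]
  rintro _ ⟨m, hm, rfl⟩
  induction n generalizing m with
  | zero =>
    obtain rfl : m = 0 := (Finsupp.degree_eq_zero_iff m).mp hm
    exact Submodule.subset_span ⟨Fin.elim0, by simp⟩
  | succ n ih =>
    obtain ⟨j, m', rfl⟩ : ∃ j m', m = m' + Finsupp.single j 1 := by
      have h0 : m ≠ 0 := by rintro rfl; simp at hm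
      obtain ⟨j, hj⟩ := Finsupp.ne_iff.mp h0
      refine ⟨j, m - Finsupp.single j 1, (tsub_add_cancel_of_le ?_).symm⟩
      exact Finsupp.single_le_iff.mpr (Nat.one_le_iff_ne_zero.mpr hj)
    have h : (monomial (m' + Finsupp.single j 1) (1 : ℂ)) = X j * monomial m' 1 := by
      rw [X, monomial_mul, mul_one, add_comm m']
    beta_reduce
    rw [h]
    refine mul_mem_prodSpan_succ X j (ih m' ?_)
    simpa using hm

theorem FH_X (a b : ℕ) (j : Fin (a * b + 1)) : FH a b (X j) = powCoeffs a b j := by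
  rw [FH_eq_aeval_powCoeffs, aeval_X]

theorem FH_mem_homogeneousSubmodule {a b k : ℕ} {f : MvPolynomial (Fin (a * b + 1)) ℂ}
    (hf : f ∈ homogeneousSubmodule (Fin (a * b + 1)) ℂ k) :
    FH a b f ∈ homogeneousSubmodule (Fin (b + 1)) ℂ (a * k) := by
  have h : prodSpan (Fin k) (X : Fin (a * b + 1) → MvPolynomial (Fin (a * b + 1)) ℂ) ≤
      (homogeneousSubmodule (Fin (b + 1)) ℂ (a * k)).comap (FH a b).toLinearMap := by
    rw [prodSpan, Submodule.span_le]
    rintro _ ⟨s, rfl⟩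
    have := prodSpan_powCoeffs_le a b (Fin k) (Submodule.subset_span ⟨s, rfl⟩)
    simpa [FH_X] using this
  exact h (homogeneousSubmodule_le_prodSpan_X _ _ hf)

theorem exists_FH_eq {a b k : ℕ} (ha : a ≠ 0) (hk : b ≤ k) {h : MvPolynomial (Fin (b + 1)) ℂ}
    (hh : h ∈ homogeneousSubmodule (Fin (b + 1)) ℂ (a * k)) :
    ∃ f ∈ homogeneousSubmodule (Fin (a * b + 1)) ℂ k, FH a b f = h := by
  have h1 : prodSpan (Fin k) (powCoeffs a b) ≤
      (homogeneousSubmodule (Fin (a * b + 1)) ℂ k).map (FH a b).toLinearMap := by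
    rw [prodSpan, Submodule.span_le]
    rintro _ ⟨s, rfl⟩
    refine ⟨∏ i, X (s i), ?_, by simp [FH_X]⟩
    have := IsHomogeneous.prod Finset.univ
      (fun i => (X (s i) : MvPolynomial (Fin (a * b + 1)) ℂ)) (fun _ => 1)
      fun i _ => isHomogeneous_X _ _
    simpa using this
  rw [prodSpan_powCoeffs ha hk] at h1
  exact h1 hh

theorem eq_zero_of_FH_eq_zero {a b : ℕ} (ha : a ≠ 0) {f : MvPolynomial (Fin (a * b + 1)) ℂ}
    (hf : f ∈ homogeneousSubmodule (Fin (a * b + 1)) ℂ b) (h : FH a b f = 0) : f = 0 := by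
  let L : homogeneousSubmodule (Fin (a * b + 1)) ℂ b →ₗ[ℂ]
      homogeneousSubmodule (Fin (b + 1)) ℂ (a * b) :=
    (FH a b).toLinearMap.restrict fun f hf => FH_mem_homogeneousSubmodule hf
  have hL : Function.Injective L := by
    rw [LinearMap.injective_iff_surjective_of_finrank_eq_finrank]
    · rintro ⟨g, hg⟩
      obtain ⟨f, hf, rfl⟩ := exists_FH_eq ha le_rfl hg
      exact ⟨⟨f, hf⟩, rfl⟩
    · rw [finrank_homogeneousSubmodule_eq_choose, finrank_homogeneousSubmodule_eq_choose, add_comm,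
        Nat.choose_symm_add]
  have := hL (a₁ := ⟨f, hf⟩) (a₂ := 0) (by rw [map_zero]; exact Subtype.ext h)
  exact congrArg Subtype.val this

theorem mem_minorIdeal_of_FH_eq_zero {a b : ℕ} (ha : a ≠ 0) (hb : b ≠ 0)
    {f : MvPolynomial (Fin (a * b + 1)) ℂ}
    (hf : f ∈ homogeneousSubmodule (Fin (a * b + 1)) ℂ (b + 1)) (h : FH a b f = 0) :
    f ∈ minorIdeal a b := by
  by_contra hJ
  obtain ⟨ℓ, hℓ, hker⟩ := ((minorIdeal a b).restrictScalars ℂ).exists_le_ker_of_notMem hJ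
  have hsym := genFun_mem_symDegree (κ := Fin (b + 1)) X ℓ
  rw [mem_symDegree] at hsym
  have h1 : alternate (Fin (b + 1))
      (stairOps a b (b + 1) (genFun (Fin (b + 1)) X ℓ)) = 0 := by
    ext ρ
    rw [coeff_alternate_stairOps_genFun, coeff_zero]
    exact hker (det_shiftSeq_mem_minorIdeal hb ρ)
  rw [← alternate_mul_dunklHom_prod_X a b hsym.1] at h1
  have h2 := (mul_eq_zero.mp h1).resolve_left (alternate_monoPow_ne_zero fun i j hij => by
    have hi := i.2
    have hj := j.2
    have : b - (i : ℕ) = b - (j : ℕ) := hij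
    omega)
  obtain ⟨θ, hθ⟩ := exists_genFun_eq_of_dunklHom_eq_zero ha (mem_symDegree.mpr
    ⟨hsym.1, fun i => (hsym.2 i).trans (Nat.mul_le_mul_left a (Nat.le_succ b))⟩) h2
  have h3 : prodSpan (Fin (b + 1)) (X : Fin (a * b + 1) → MvPolynomial (Fin (a * b + 1)) ℂ) ≤
      LinearMap.ker (ℓ - θ ∘ₗ (FH a b).toLinearMap) := by
    rw [prodSpan, Submodule.span_le]
    rintro _ ⟨s, rfl⟩
    have h4 := coeff_toExponent_genFun (κ := Fin (b + 1)) X ℓ s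
    rw [← hθ, coeff_toExponent_genFun] at h4
    rw [SetLike.mem_coe, LinearMap.mem_ker, LinearMap.sub_apply, ← h4, sub_eq_zero]
    simp [FH_X]
  have h4 := h3 (homogeneousSubmodule_le_prodSpan_X _ _ hf)
  rw [LinearMap.mem_ker, LinearMap.sub_apply, LinearMap.comp_apply, AlgHom.toLinearMap_apply, h,
    map_zero, sub_zero] at h4
  exact hℓ h4

end Kernel

section Induction

/-- In degree `k`, classes modulo the ideal of minors are determined by values under `FH a b`. -/
def FactorsThrough (a b k : ℕ)
    (β : MvPolynomial (Fin (b + 1)) ℂ →ₗ[ℂ] MvPolynomial (Fin (a * b + 1)) ℂ ⧸ minorIdeal a b) :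
    Prop :=
  ∀ f ∈ homogeneousSubmodule (Fin (a * b + 1)) ℂ k,
    β (FH a b f) = Ideal.Quotient.mk (minorIdeal a b) f

theorem exists_factorsThrough {a b k : ℕ}
    (h : ∀ f ∈ homogeneousSubmodule (Fin (a * b + 1)) ℂ k, FH a b f = 0 → f ∈ minorIdeal a b) :
    ∃ β, FactorsThrough a b k β := by
  set H := homogeneousSubmodule (Fin (a * b + 1)) ℂ k
  let F : H →ₗ[ℂ] MvPolynomial (Fin (b + 1)) ℂ := (FH a b).toLinearMap ∘ₗ H.subtype
  let G : H →ₗ[ℂ] MvPolynomial (Fin (a * b + 1)) ℂ ⧸ minorIdeal a b :=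
    (Ideal.Quotient.mkₐ ℂ (minorIdeal a b)).toLinearMap ∘ₗ H.subtype
  have hFG : LinearMap.ker F ≤ LinearMap.ker G := fun f hf =>
    Ideal.Quotient.eq_zero_iff_mem.mpr (h f f.2 hf)
  obtain ⟨β, hβ⟩ := LinearMap.exists_extend
    ((LinearMap.ker F).liftQ G hFG ∘ₗ F.quotKerEquivRange.symm.toLinearMap)
  refine ⟨β, fun f hf => ?_⟩
  have h1 := LinearMap.congr_fun hβ ⟨F ⟨f, hf⟩, ⟨_, rfl⟩⟩
  have h2 : F.quotKerEquivRange.symm ⟨F ⟨f, hf⟩, ⟨_, rfl⟩⟩ = (LinearMap.ker F).mkQ ⟨f, hf⟩ := by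
    rw [LinearEquiv.symm_apply_eq]
    rfl
  exact h1.trans (congrArg ((LinearMap.ker F).liftQ G hFG) h2)

/-- The index of the coefficient of `x^(a l)` in the `a`-th power of a form of degree `b`. -/
def leadIndex (a : ℕ) {b : ℕ} (l : Fin (b + 1)) : Fin (a * b + 1) :=
  ⟨a * l, Nat.lt_succ_of_le (Nat.mul_le_mul_left a (Nat.lt_succ_iff.mp l.2))⟩

theorem powCoeffs_leadIndex (a : ℕ) {b : ℕ} (l : Fin (b + 1)) :
    powCoeffs a b (leadIndex a l) = powCoeff a b (a * l) := rfl

theorem X_mul_mem_homogeneousSubmodule {d k : ℕ} (j : Fin (d + 1)) {f : MvPolynomial (Fin (d + 1)) ℂ}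
    (hf : f ∈ homogeneousSubmodule (Fin (d + 1)) ℂ k) :
    X j * f ∈ homogeneousSubmodule (Fin (d + 1)) ℂ (k + 1) := by
  rw [add_comm k 1]
  exact (isHomogeneous_X ℂ j).mul hf

theorem leadProd_mem_homogeneousSubmodule {a b n : ℕ} {m : Fin (b + 1) →₀ ℕ}
    (hm : m.degree = n) : leadProd a b m ∈ homogeneousSubmodule (Fin (b + 1)) ℂ n :=
  hm ▸ (isLead_leadProd a b m).isHomogeneous

theorem FactorsThrough.mk_X_mul {a b k : ℕ} (ha : a ≠ 0) (hk : b ≤ k)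
    {β β' : MvPolynomial (Fin (b + 1)) ℂ →ₗ[ℂ] MvPolynomial (Fin (a * b + 1)) ℂ ⧸ minorIdeal a b}
    (h : FactorsThrough a b k β) (h' : FactorsThrough a b (k + 1) β') (j : Fin (a * b + 1))
    {g : MvPolynomial (Fin (b + 1)) ℂ} (hg : g ∈ homogeneousSubmodule (Fin (b + 1)) ℂ (a * k)) :
    Ideal.Quotient.mk (minorIdeal a b) (X j) * β g = β' (powCoeffs a b j * g) := by
  obtain ⟨f, hf, rfl⟩ := exists_FH_eq ha hk hg
  rw [h f hf, ← map_mul, ← FH_X, ← map_mul, h' _ (X_mul_mem_homogeneousSubmodule j hf)]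

theorem FactorsThrough.exists_lift {a b k : ℕ} (ha : a ≠ 0) (hk : b ≤ k)
    {β β' : MvPolynomial (Fin (b + 1)) ℂ →ₗ[ℂ] MvPolynomial (Fin (a * b + 1)) ℂ ⧸ minorIdeal a b}
    (h : FactorsThrough a b k β) (h' : FactorsThrough a b (k + 1) β') :
    ∃ β'' : MvPolynomial (Fin (b + 1)) ℂ →ₗ[ℂ] MvPolynomial (Fin (a * b + 1)) ℂ ⧸ minorIdeal a b,
      ∀ (l : Fin (b + 1)) (m : Fin (b + 1) →₀ ℕ), m.degree = a * (k + 1) →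
        β'' (leadProd a b (m + Finsupp.single l a)) =
          Ideal.Quotient.mk (minorIdeal a b) (X (leadIndex a l)) * β' (leadProd a b m) := by
  classical
  let φ : (Fin (b + 1) →₀ ℕ) → MvPolynomial (Fin (a * b + 1)) ℂ ⧸ minorIdeal a b := fun m =>
    if h : ∃ (l : Fin (b + 1)) (m' : Fin (b + 1) →₀ ℕ), m = m' + Finsupp.single l a then
      Ideal.Quotient.mk (minorIdeal a b) (X (leadIndex a h.choose)) *
        β' (leadProd a b h.choose_spec.choose)
    else 0
  obtain ⟨β'', hβ⟩ := exists_linearMap_leadProd a b (a * (k + 1 + 1)) φ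
  refine ⟨β'', fun l m hm => ?_⟩
  have hex : ∃ (l' : Fin (b + 1)) (m' : Fin (b + 1) →₀ ℕ),
      m + Finsupp.single l a = m' + Finsupp.single l' a := ⟨l, m, rfl⟩
  rw [hβ _ (by rw [map_add, hm, Finsupp.degree_single]; ring)]
  simp only [φ]
  rw [dif_pos hex]
  have hspec := hex.choose_spec.choose_spec
  generalize hex.choose_spec.choose = m' at hspec ⊢
  generalize hex.choose = l' at hspec ⊢
  by_cases hl : l = l'
  · subst hl
    rw [add_right_cancel hspec]
  obtain ⟨n, rfl, rfl⟩ : ∃ n, m = n + Finsupp.single l' a ∧ m' = n + Finsupp.single l a := by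
    have h1 : Finsupp.single l' a ≤ m := by
      have := DFunLike.congr_fun hspec l'
      rw [Finsupp.single_le_iff]
      simp [hl] at this
      omega
    refine ⟨m - Finsupp.single l' a, (tsub_add_cancel_of_le h1).symm, ?_⟩
    rw [← add_left_inj (Finsupp.single l' a), ← hspec, add_right_comm, tsub_add_cancel_of_le h1]
  have hn : n.degree = a * k := by
    rw [map_add, Finsupp.degree_single] at hm
    linarith
  have hn' := leadProd_mem_homogeneousSubmodule (a := a) hn
  rw [← powCoeff_mul_leadProd ha, ← powCoeff_mul_leadProd ha, ← powCoeffs_leadIndex,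
    ← powCoeffs_leadIndex, ← h.mk_X_mul ha hk h' _ hn', ← h.mk_X_mul ha hk h' _ hn']
  ring

theorem eq_of_forall_leadProd {a b n : ℕ} {Q : Type*} [AddCommGroup Q] [Module ℂ Q]
    {A B : MvPolynomial (Fin (b + 1)) ℂ →ₗ[ℂ] Q}
    (h : ∀ m : Fin (b + 1) →₀ ℕ, m.degree = n → A (leadProd a b m) = B (leadProd a b m))
    {f : MvPolynomial (Fin (b + 1)) ℂ} (hf : f ∈ homogeneousSubmodule (Fin (b + 1)) ℂ n) :
    A f = B f := by
  have h1 : homogeneousSubmodule (Fin (b + 1)) ℂ n ≤ LinearMap.eqLocus A B := by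
    refine (homogeneousSubmodule_le_span_leadProd a b n).trans (Submodule.span_le.mpr ?_)
    rintro _ ⟨m, hm, rfl⟩
    exact h m hm
  exact h1 hf

theorem FactorsThrough.exists_succ {a b k : ℕ} (ha : a ≠ 0) (hk : b ≤ k)
    {β β' : MvPolynomial (Fin (b + 1)) ℂ →ₗ[ℂ] MvPolynomial (Fin (a * b + 1)) ℂ ⧸ minorIdeal a b}
    (h : FactorsThrough a b k β) (h' : FactorsThrough a b (k + 1) β') :
    ∃ β'', FactorsThrough a b (k + 1 + 1) β'' := by
  obtain ⟨β'', hβ⟩ := h.exists_lift ha hk h'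
  refine ⟨β'', ?_⟩
  let x := fun j : Fin (a * b + 1) => Ideal.Quotient.mk (minorIdeal a b) (X j)
  have h1 : ∀ (l : Fin (b + 1)) {g : MvPolynomial (Fin (b + 1)) ℂ},
      g ∈ homogeneousSubmodule (Fin (b + 1)) ℂ (a * (k + 1)) →
      x (leadIndex a l) * β' g = β'' (powCoeff a b (a * l) * g) := fun l g hg => by
    refine eq_of_forall_leadProd (A := LinearMap.mulLeft ℂ (x (leadIndex a l)) ∘ₗ β')
      (B := β'' ∘ₗ LinearMap.mulLeft ℂ (powCoeff a b (a * l))) (a := a) (fun m hm => ?_) hg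
    simp only [LinearMap.comp_apply, LinearMap.mulLeft_apply]
    rw [powCoeff_mul_leadProd ha, hβ l m hm]
  have h2 : ∀ (j : Fin (a * b + 1)) {g : MvPolynomial (Fin (b + 1)) ℂ},
      g ∈ homogeneousSubmodule (Fin (b + 1)) ℂ (a * (k + 1)) →
      x j * β' g = β'' (powCoeffs a b j * g) := fun j g hg => by
    refine eq_of_forall_leadProd (A := LinearMap.mulLeft ℂ (x j) ∘ₗ β')
      (B := β'' ∘ₗ LinearMap.mulLeft ℂ (powCoeffs a b j)) (a := a) (fun m hm => ?_) hg
    simp only [LinearMap.comp_apply, LinearMap.mulLeft_apply]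
    obtain ⟨l, m', rfl, hm'⟩ := leadProd_mem_of_degree_eq ha hk hm
    have hv := leadProd_mem_homogeneousSubmodule (a := a) hm'
    have hcv : powCoeffs a b j * leadProd a b m' ∈
        homogeneousSubmodule (Fin (b + 1)) ℂ (a * (k + 1)) := by
      rw [mul_add_one, add_comm (a * k)]
      exact (isHomogeneous_powCoeff a b j).mul hv
    rw [← powCoeff_mul_leadProd ha, mul_left_comm, ← h1 l hcv, ← h.mk_X_mul ha hk h' j hv,
      ← powCoeffs_leadIndex, ← h.mk_X_mul ha hk h' _ hv]
    exact mul_left_comm _ _ _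
  intro f hf
  have h3 : prodSpan (Fin (k + 1 + 1)) (X : Fin (a * b + 1) → MvPolynomial (Fin (a * b + 1)) ℂ) ≤
      LinearMap.eqLocus (β'' ∘ₗ (FH a b).toLinearMap)
        (Ideal.Quotient.mkₐ ℂ (minorIdeal a b)).toLinearMap := by
    rw [prodSpan, Submodule.span_le]
    rintro _ ⟨s, rfl⟩
    have hP : ∏ i : Fin (k + 1), (X (s i.succ) : MvPolynomial (Fin (a * b + 1)) ℂ) ∈
        homogeneousSubmodule (Fin (a * b + 1)) ℂ (k + 1) := by
      have := IsHomogeneous.prod Finset.univ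
        (fun i : Fin (k + 1) => (X (s i.succ) : MvPolynomial (Fin (a * b + 1)) ℂ)) (fun _ => 1)
        fun i _ => isHomogeneous_X _ _
      simpa using this
    have h4 := h2 (s 0) (FH_mem_homogeneousSubmodule hP)
    rw [h' _ hP] at h4
    simp only [Fin.prod_univ_succ (n := k + 1)]
    rw [SetLike.mem_coe, LinearMap.mem_eqLocus, LinearMap.comp_apply, AlgHom.toLinearMap_apply,
      AlgHom.toLinearMap_apply, map_mul, FH_X, ← h4, ← map_mul]
    rfl
  exact h3 (homogeneousSubmodule_le_prodSpan_X _ _ hf)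

theorem exists_factorsThrough_of_le {a b k : ℕ} (ha : a ≠ 0) (hb : b ≠ 0) (hk : b ≤ k) :
    ∃ β, FactorsThrough a b k β := by
  have key : (∃ β, FactorsThrough a b k β) ∧ ∃ β, FactorsThrough a b (k + 1) β := by
    induction k, hk using Nat.le_induction with
    | base =>
      refine ⟨exists_factorsThrough fun f hf h => ?_, exists_factorsThrough fun f hf h =>
        mem_minorIdeal_of_FH_eq_zero ha hb hf h⟩
      rw [eq_zero_of_FH_eq_zero ha hf h]
      exact zero_mem _
    | succ k hk ih =>
      obtain ⟨⟨β, h⟩, β', h'⟩ := ih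
      exact ⟨⟨β', h'⟩, h.exists_succ ha hk h'⟩
  exact key.1

theorem mem_minorIdeal_of_isHomogeneous {a b k : ℕ} (ha : a ≠ 0) (hb : b ≠ 0)
    {f : MvPolynomial (Fin (a * b + 1)) ℂ}
    (hf : f ∈ homogeneousSubmodule (Fin (a * b + 1)) ℂ k) (h : FH a b f = 0) :
    f ∈ minorIdeal a b := by
  rcases le_or_gt b k with hk | hk
  · obtain ⟨β, hβ⟩ := exists_factorsThrough_of_le ha hb hk
    have h1 := hβ f hf
    rw [h, map_zero] at h1
    exact Ideal.Quotient.eq_zero_iff_mem.mp h1.symm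
  · have h1 : X 0 ^ (b - k) * f ∈ homogeneousSubmodule (Fin (a * b + 1)) ℂ b := by
      have := ((isHomogeneous_X ℂ (0 : Fin (a * b + 1))).pow (b - k)).mul hf
      rwa [one_mul, Nat.sub_add_cancel hk.le] at this
    have h2 := eq_zero_of_FH_eq_zero ha h1 (by rw [map_mul, h, mul_zero])
    rw [(mul_eq_zero.mp h2).resolve_left (pow_ne_zero _ (X_ne_zero _))]
    exact zero_mem _

theorem FH_homogeneousComponent {a : ℕ} (ha : a ≠ 0) (b n : ℕ)
    (f : MvPolynomial (Fin (a * b + 1)) ℂ) :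
    FH a b (homogeneousComponent n f) = homogeneousComponent (a * n) (FH a b f) := by
  conv_rhs => rw [← sum_homogeneousComponent f, map_sum, map_sum]
  have h : ∀ i, homogeneousComponent (a * n) (FH a b (homogeneousComponent i f)) =
      if n = i then FH a b (homogeneousComponent i f) else 0 := fun i => by
    rw [homogeneousComponent_of_mem
      (FH_mem_homogeneousSubmodule (homogeneousComponent_mem i f))]
    simp only [mul_right_inj' ha]
  simp only [h]
  rw [Finset.sum_ite_eq]
  split_ifs with hn
  · rfl
  · rw [homogeneousComponent_eq_zero n f (by simpa [Nat.lt_succ_iff] using hn), map_zero]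

theorem ker_le_minorIdeal {a b : ℕ} (ha : a ≠ 0) (hb : b ≠ 0) :
    RingHom.ker (FH a b).toRingHom ≤ minorIdeal a b := by
  intro f hf
  have hf' : FH a b f = 0 := hf
  rw [← sum_homogeneousComponent f]
  refine sum_mem fun n _ => mem_minorIdeal_of_isHomogeneous ha hb (homogeneousComponent_mem n f) ?_
  rw [FH_homogeneousComponent ha, hf', map_zero]

end Induction

/-- For `a, b ≥ 2`, the ideal `I(X) = ker α` is generated by the `(b+1) × (b+1)`
minors of the matrix `jacMatrix a b`, i.e. by the determinants of the square
submatrices obtained by selecting `b+1` of its rows. -/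
theorem kernel_FH_eq_span_minors (a b : ℕ) (ha : 2 ≤ a) (hb : 2 ≤ b) :
    RingHom.ker (FH a b).toRingHom =
      Ideal.span {q : MvPolynomial (Fin (a * b + 1)) ℂ |
        ∃ f : Fin (b + 1) → Fin (a * b + b - 1), Function.Injective f ∧
          q = ((jacMatrix a b).submatrix f id).det} :=
  le_antisymm (ker_le_minorIdeal (by omega) (by omega)) (minorIdeal_le_ker a b)
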